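/- For all integers k ≥ 3 and 1 ≤ ℓ ≤ k-1 and every real α > 0, there exists n₀ such that the following holds for every integer n ≥ n₀ divisible by k-ℓ: if H is a k-graph on n vertices with minimum positive codegree δ⁺(H) ≥ (1 - 1/(⌊k/(k-ℓ)⌋(k-ℓ)))·n + αn and H has no isolated vertices, then H contains a Hamilton ℓ-cycle. -/

import Mathlib

open Finset

/-- The degree of a vertex set `S` in the `k`-graph with edge set `E`:
the number of edges containing `S`. -/
def degH {V : Type*} [DecidableEq V] (E : Finset (Finset V)) (S : Finset V) : ℕ :=
  (E.filter (fun e => S ⊆ e)).card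

/-- The minimum positive codegree `δ⁺`: the minimum of `deg(S)` over all
`(k-1)`-element vertex sets `S` with `deg(S) ≥ 1`. -/
noncomputable def posCodeg {V : Type*} [DecidableEq V] (k : ℕ) (E : Finset (Finset V)) : ℕ :=
  sInf {d : ℕ | ∃ S : Finset V, S.card = k - 1 ∧ 1 ≤ degH E S ∧ degH E S = d}

/-- The edge set of the `k`-uniform `ℓ`-cycle whose cyclic vertex order is given by `vs`:
for each `i < |vs|/(k-ℓ)`, the `k` consecutive vertices starting at position `i(k-ℓ)`
(indices taken cyclically). -/
def cycleEdges {V : Type*} [DecidableEq V] (k ℓ : ℕ) (vs : List V) : Finset (Finset V) :=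
  (Finset.range (vs.length / (k - ℓ))).image
    (fun i => (((vs ++ vs).drop (i * (k - ℓ))).take k).toFinset)

/-- `E` contains a Hamilton `ℓ`-cycle: there is a cyclic ordering `vs` of all the vertices
such that every block of `k` consecutive vertices (stepping by `k - ℓ`) is an edge of `E`. -/
def HasHamiltonLCycle {V : Type*} [DecidableEq V] [Fintype V] (k ℓ : ℕ)
    (E : Finset (Finset V)) : Prop :=
  ∃ vs : List V, vs.Nodup ∧ vs.toFinset = Finset.univ ∧ k ≤ vs.length ∧
    (k - ℓ) ∣ vs.length ∧ cycleEdges k ℓ vs ⊆ E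

set_option linter.unusedSectionVars false
set_option linter.unusedVariables false
set_option linter.style.setOption false

section PartA
open scoped Classical
variable {V : Type} [Fintype V] [DecidableEq V]

/-- Numerical parameters: window size `k`, step `d`, and `t = ⌊k/d⌋ d`. -/
structure Par (k d t : ℕ) : Prop where
  hd : 1 ≤ d
  hdt : d ∣ t
  ht : 2 ≤ t
  htk : t ≤ k
  hkt : k < t + d

lemma Par.ktd {k d t : ℕ} (h : Par k d t) : k ≤ t * d := by
  obtain ⟨hd, hdt, ht, htk, hkt⟩ := h
  rcases Nat.lt_or_ge 1 d with h1 | h1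
  · nlinarith
  · have : d = 1 := by omega
    subst this; omega

/-- The shadow system: a down-closed family with large extension degrees. -/
structure Sys (sh : Finset V → Prop) (k t : ℕ) (α : ℝ) : Prop where
  mono : ∀ S T, S ⊆ T → sh T → sh S
  emp : sh ∅
  sing : ∀ v, sh {v}
  deg : ∀ S, sh S → S.card < k →
    (1 - 1 / (t : ℝ) + α) * Fintype.card V ≤ ((univ.filter fun v => sh (insert v S)).card : ℝ)

/-- Contents of the `i`-th window of a partial word. -/
def cont (k d : ℕ) (f : ℕ → Option V) (i : ℕ) : Finset V :=
  (Finset.Ico (i * d) (i * d + k)).biUnion fun p => (f p).toFinset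

lemma mem_cont {k d : ℕ} {f : ℕ → Option V} {i : ℕ} {v : V} :
    v ∈ cont k d f i ↔ ∃ p, i * d ≤ p ∧ p < i * d + k ∧ f p = some v := by
  simp [cont, and_assoc]

/-- A partial word is good if the contents of each window lie in the shadow. -/
def GoodF (sh : Finset V → Prop) (k d : ℕ) (f : ℕ → Option V) : Prop :=
  ∀ i, sh (cont k d f i)

/-- Good list of vertices. -/
def Good (sh : Finset V → Prop) (k d : ℕ) (l : List V) : Prop :=
  GoodF sh k d (fun p => l[p]?)

/-- Good word with blanks. -/
def GoodW (sh : Finset V → Prop) (k d : ℕ) (w : List (Option V)) : Prop :=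
  GoodF sh k d (fun p => (w[p]?).join)

lemma goodW_map {sh : Finset V → Prop} {k d : ℕ} {l : List V} :
    GoodW sh k d (l.map some) ↔ Good sh k d l := by
  unfold GoodW Good
  have : (fun (p : ℕ) => ((l.map some)[p]?).join) = fun (p : ℕ) => l[p]? := by
    funext p
    rw [List.getElem?_map]
    cases l[p]? <;> rfl
  rw [this]

lemma goodF_of {sh : Finset V → Prop} {k d : ℕ} {f : ℕ → Option V}
    (mono : ∀ S T, S ⊆ T → sh T → sh S)
    (h : ∀ i, ∃ S, sh S ∧ ∀ p v, i * d ≤ p → p < i * d + k → f p = some v → v ∈ S) :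
    GoodF sh k d f := by
  intro i
  obtain ⟨S, hS, h⟩ := h i
  refine mono _ S ?_ hS
  intro v hv
  obtain ⟨p, h1, h2, h3⟩ := mem_cont.1 hv
  exact h p v h1 h2 h3

section words
variable {sh : Finset V → Prop} {k d : ℕ}


lemma good_front (mono : ∀ S T, S ⊆ T → sh T → sh S) {X Y : List V} (h : Good sh k d (X ++ Y)) : Good sh k d X := by
  refine goodF_of mono fun i => ⟨_, h i, ?_⟩
  intro p v h1 h2 h3
  refine mem_cont.2 ⟨p, h1, h2, ?_⟩
  have : p < X.length := (List.getElem?_eq_some_iff.1 h3).1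
  simpa [List.getElem?_append_left this] using h3

lemma good_suffix (mono : ∀ S T, S ⊆ T → sh T → sh S) {X Y : List V} (hd : d ∣ X.length) (h : Good sh k d (X ++ Y)) :
    Good sh k d Y := by
  obtain ⟨c, hc⟩ := hd
  refine goodF_of mono fun i => ⟨_, h (i + c), ?_⟩
  intro p v h1 h2 h3
  have e : (i + c) * d = i * d + X.length := by rw [hc]; ring
  refine mem_cont.2 ⟨p + X.length, by omega, by omega, ?_⟩
  rw [List.getElem?_append_right (by omega)]
  simpa using h3

lemma good_glue (mono : ∀ S T, S ⊆ T → sh T → sh S) {U A W : List V} (hd1 : 1 ≤ d) (hd : d ∣ U.length) (hA : k ≤ A.length + 1)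
    (h1 : Good sh k d (U ++ A)) (h2 : Good sh k d (A ++ W)) : Good sh k d (U ++ A ++ W) := by
  obtain ⟨c, hc⟩ := hd
  refine goodF_of mono fun i => ?_
  by_cases hi : i * d + k ≤ U.length + A.length
  · refine ⟨_, h1 i, ?_⟩
    intro p v e1 e2 e3
    refine mem_cont.2 ⟨p, e1, e2, ?_⟩
    rwa [List.getElem?_append_left (by simp; omega)] at e3
  · have hci : c ≤ i := by
      by_contra hlt
      have : (i + 1) * d ≤ c * d := Nat.mul_le_mul_right _ (by omega)
      have : c * d = U.length := by rw [hc]; ring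
      have : (i + 1) * d = i * d + d := by ring
      omega
    refine ⟨_, h2 (i - c), ?_⟩
    intro p v e1 e2 e3
    have e : (i - c) * d = i * d - U.length := by
      rw [hc, Nat.sub_mul]; congr 1; ring
    have e' : U.length ≤ i * d := by
      rw [hc, mul_comm]; exact Nat.mul_le_mul_right _ hci
    refine mem_cont.2 ⟨p - U.length, by omega, by omega, ?_⟩
    rw [List.append_assoc, List.getElem?_append_right (by omega)] at e3
    exact e3

/-- `x` can be replaced by `x'` in every aligned context. -/
def Repl (sh : Finset V → Prop) (k d : ℕ) (x x' : List V) : Prop :=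
  d ∣ x'.length ∧ ∀ U Y : List V, d ∣ U.length → Good sh k d (U ++ x ++ Y) →
    Good sh k d (U ++ x' ++ Y)

lemma Repl.refl {x : List V} (h : d ∣ x.length) : Repl sh k d x x :=
  ⟨h, fun _ _ _ h => h⟩

lemma Repl.append {x x' y y' : List V} (h : Repl sh k d x x') (h' : Repl sh k d y y') :
    Repl sh k d (x ++ y) (x' ++ y') := by
  refine ⟨by simpa using Dvd.dvd.add h.1 h'.1, ?_⟩
  intro U Y hU hg
  have h1 : Good sh k d (U ++ x' ++ (y ++ Y)) := by
    apply h.2 U (y ++ Y) hU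
    simpa [List.append_assoc] using hg
  have h2 := h'.2 (U ++ x') Y (by simpa using Dvd.dvd.add hU h.1)
    (by simpa [List.append_assoc] using h1)
  simpa [List.append_assoc] using h2

lemma Repl.flatten {xs xs' : List (List V)} (h : List.Forall₂ (Repl sh k d) xs xs') :
    Repl sh k d xs.flatten xs'.flatten := by
  induction h with
  | nil => exact Repl.refl (by simp)
  | cons h1 _ ih => simpa using h1.append ih

lemma rep_gadget (mono : ∀ S T, S ⊆ T → sh T → sh S) {A M M' B : List V} (hd1 : 1 ≤ d) (hA : k ≤ A.length + 1)
    (hB : k ≤ B.length + 1) (h1 : d ∣ (A ++ M).length) (h2 : d ∣ (A ++ M').length)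
    (h3 : d ∣ B.length) (hg : Good sh k d (A ++ M' ++ B)) :
    Repl sh k d (A ++ M ++ B) (A ++ M' ++ B) := by
  refine ⟨by rw [List.length_append]; exact Dvd.dvd.add h2 h3, ?_⟩
  intro U Y hU hG
  have g1 : Good sh k d (U ++ A) := by
    apply good_front mono (Y := M ++ B ++ Y)
    simpa [List.append_assoc] using hG
  have g2 : Good sh k d (B ++ Y) := by
    apply good_suffix mono (X := U ++ (A ++ M))
    · rw [List.length_append]; exact Dvd.dvd.add hU h1
    · simpa [List.append_assoc] using hG
  have g3 : Good sh k d ((U ++ A) ++ (M' ++ B)) :=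
    good_glue mono hd1 hU hA g1 (by simpa [List.append_assoc] using hg)
  have g4 : Good sh k d ((U ++ (A ++ M')) ++ B ++ Y) := by
    apply good_glue mono hd1 _ hB _ g2
    · rw [List.length_append]; exact Dvd.dvd.add hU h2
    · simpa [List.append_assoc] using g3
  simpa [List.append_assoc] using g4

/-- concatenating words with a run of blanks in between -/
lemma goodW_blank (mono : ∀ S T, S ⊆ T → sh T → sh S) {w₁ w₂ : List (Option V)} {g : ℕ} (hd1 : 1 ≤ d) (hd : d ∣ w₁.length)
    (hdg : d ∣ g) (hg : k ≤ g) (h1 : GoodW sh k d w₁) (h2 : GoodW sh k d w₂) :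
    GoodW sh k d (w₁ ++ List.replicate g none ++ w₂) := by
  obtain ⟨c, hc⟩ := Dvd.dvd.add hd hdg
  refine goodF_of mono fun i => ?_
  by_cases hi : i * d + k ≤ w₁.length + g
  · refine ⟨_, h1 i, ?_⟩
    intro p v e1 e2 e3
    refine mem_cont.2 ⟨p, e1, e2, ?_⟩
    rw [List.getElem?_append_left (by simp; omega)] at e3
    by_cases hp : p < w₁.length
    · rwa [List.getElem?_append_left hp] at e3
    · rw [List.getElem?_append_right (by omega), List.getElem?_replicate] at e3
      split_ifs at e3 <;> simp at e3
  · by_cases hci : c ≤ i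
    · refine ⟨_, h2 (i - c), ?_⟩
      intro p v e1 e2 e3
      have e : (i - c) * d = i * d - (w₁.length + g) := by
        rw [hc, Nat.sub_mul]; congr 1; ring
      have e' : w₁.length + g ≤ i * d := by
        rw [hc, mul_comm]; exact Nat.mul_le_mul_right _ hci
      refine mem_cont.2 ⟨p - (w₁.length + g), by omega, by omega, ?_⟩
      rw [List.getElem?_append_right (by simp; omega)] at e3
      simpa using e3
    · refine ⟨_, h2 0, ?_⟩
      intro p v e1 e2 e3
      by_cases hp : p < w₁.length + g
      · exfalso
        rw [List.getElem?_append_left (by simpa using hp), List.getElem?_append_right (by omega),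
          List.getElem?_replicate] at e3
        split_ifs at e3 <;> simp at e3
      · have : i * d < c * d := Nat.mul_lt_mul_of_pos_right (by omega) hd1
        have e' : w₁.length + g = c * d := by rw [hc, mul_comm]
        refine mem_cont.2 ⟨p - (w₁.length + g), by omega, by omega, ?_⟩
        rw [List.getElem?_append_right (by simp; omega)] at e3
        simpa using e3

end words

/-- fill the blanks of a word from a list -/
def fill : List (Option V) → List V → List V
  | [], _ => []
  | some v :: w, c => v :: fill w c
  | none :: w, x :: c => x :: fill w c
  | none :: w, [] => fill w []

lemma fill_map (l : List V) (w : List (Option V)) (c : List V) :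
    fill (l.map some ++ w) c = l ++ fill w c := by
  induction l with
  | nil => rfl
  | cons a l ih => simp [fill, ih]

lemma fill_blank (g : ℕ) (w : List (Option V)) (c : List V) (h : g ≤ c.length) :
    fill (List.replicate g none ++ w) c = c.take g ++ fill w (c.drop g) := by
  induction g generalizing c with
  | zero => simp
  | succ g ih =>
    cases c with
    | nil => simp at h
    | cons a c =>
      simp [List.replicate_succ, fill, ih c (by simpa using h)]

/-- Availability: every `t` shadow sets have at least `m` common extensions in `R`. -/
def Avail (sh : Finset V → Prop) (k t : ℕ) (R : Finset V) (m : ℕ) : Prop :=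
  ∀ g : Fin t → Finset V, (∀ j, sh (g j) ∧ (g j).card < k) →
    m ≤ (R.filter fun v => ∀ j, sh (insert v (g j))).card

lemma fill_step {sh : Finset V → Prop} {k d t m : ℕ} {R : Finset V}
    (par : Par k d t)
    (mono : ∀ S T, S ⊆ T → sh T → sh S) (emp : sh ∅) (hav : Avail sh k t R m)
    (l : List V) (w : List (Option V)) (h : GoodW sh k d (l.map some ++ none :: w)) :
    m ≤ (R.filter fun v => GoodW sh k d ((l ++ [v]).map some ++ w)).card := by
  set f : ℕ → Option V := fun p => ((l.map some ++ none :: w)[p]?).join with hf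
  set P := l.length with hP
  have hfP : f P = none := by simp [hf, hP]
  have hcard : ∀ i, i * d ≤ P → P < i * d + k → (cont k d f i).card < k := by
    intro i h1 h2
    have hsub : cont k d f i ⊆ ((Finset.Ico (i*d) (i*d+k)).erase P).biUnion
        fun p => (f p).toFinset := by
      intro v hv
      obtain ⟨p, a, b, c⟩ := mem_cont.1 hv
      have : p ≠ P := by rintro rfl; rw [hfP] at c; simp at c
      simp only [mem_biUnion, Finset.mem_erase, Finset.mem_Ico]
      exact ⟨p, ⟨this, a, b⟩, by simp [c]⟩
    refine lt_of_le_of_lt ((card_le_card hsub).trans card_biUnion_le) ?_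
    have h3 : ∀ p ∈ (Finset.Ico (i*d) (i*d+k)).erase P, ((f p).toFinset).card ≤ 1 := by
      intro p _
      cases f p <;> simp
    refine lt_of_le_of_lt (Finset.sum_le_card_nsmul _ _ 1 h3) ?_
    rw [Finset.card_erase_of_mem (by simp; omega)]
    simp
    have := par.ht; have := par.htk
    omega
  let g : Fin t → Finset V := fun j =>
    if (j : ℕ) ≤ P / d ∧ P < (P / d - j) * d + k then cont k d f (P / d - j) else ∅
  have hg : ∀ j, sh (g j) ∧ (g j).card < k := by
    intro j
    by_cases hj : (j : ℕ) ≤ P / d ∧ P < (P / d - j) * d + k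
    · simp only [g, if_pos hj]
      refine ⟨h _, hcard _ ?_ hj.2⟩
      calc (P / d - j) * d ≤ (P / d) * d := Nat.mul_le_mul_right _ (by omega)
        _ ≤ P := Nat.div_mul_le_self _ _
    · simp only [g, if_neg hj]
      have := par.ht; have := par.htk
      exact ⟨emp, by simp; omega⟩
  refine (hav g hg).trans (card_le_card ?_)
  intro v hv
  simp only [mem_filter] at hv ⊢
  refine ⟨hv.1, ?_⟩
  have hfv : ∀ p u, (((l ++ [v]).map some ++ w)[p]?).join = some u →
      (p = P ∧ u = v) ∨ (p ≠ P ∧ f p = some u) := by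
    intro p u hpu
    rcases lt_trichotomy p P with hlt | heq | hgt
    · right
      refine ⟨hlt.ne, ?_⟩
      simp only [hf]
      rw [List.getElem?_append_left (by simpa using hlt)]
      rw [List.getElem?_append_left (by simp; omega)] at hpu
      simp only [List.map_append] at hpu
      rwa [List.getElem?_append_left (by simpa using hlt)] at hpu
    · left
      subst heq
      refine ⟨rfl, ?_⟩
      rw [List.getElem?_append_left (by simp; omega)] at hpu
      simp [hP] at hpu
      exact hpu.symm
    · right
      refine ⟨hgt.ne', ?_⟩
      simp only [hf]
      rw [List.getElem?_append_right (by simp; omega)] at hpu ⊢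
      simp only [List.length_map, List.length_append, List.length_singleton] at hpu ⊢
      have : p - l.length = (p - (l.length + 1)) + 1 := by omega
      rw [this, List.getElem?_cons_succ]
      exact hpu
  refine goodF_of mono fun i => ?_
  by_cases hi : i * d ≤ P ∧ P < i * d + k
  · have hid : i ≤ P / d := (Nat.le_div_iff_mul_le par.hd).2 hi.1
    have hjt : P / d - i < t := by
      by_contra hcon
      have h1 : (P / d) * d ≤ P := Nat.div_mul_le_self _ _
      have h2 : t * d ≤ (P / d - i) * d := Nat.mul_le_mul_right _ (by omega)
      rw [Nat.sub_mul] at h2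
      have := par.ktd
      omega
    have hv' := hv.2 ⟨P / d - i, hjt⟩
    have e : P / d - (P / d - i) = i := by omega
    have hgi : g ⟨P / d - i, hjt⟩ = cont k d f i := by
      simp only [g]
      rw [e, if_pos ⟨by omega, hi.2⟩]
    rw [hgi] at hv'
    refine ⟨_, hv', ?_⟩
    intro p u h1 h2 h3
    rcases hfv p u h3 with ⟨_, rfl⟩ | ⟨_, h4⟩
    · simp
    · exact mem_insert_of_mem (mem_cont.2 ⟨p, h1, h2, h4⟩)
  · refine ⟨_, h i, ?_⟩
    intro p u h1 h2 h3
    rcases hfv p u h3 with ⟨rfl, rfl⟩ | ⟨_, h4⟩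
    · exact absurd ⟨h1, h2⟩ hi
    · exact mem_cont.2 ⟨p, h1, h2, h4⟩

/-- Greedy filling of all blanks. -/
lemma fill_exists {sh : Finset V → Prop} {k d t m : ℕ} {R : Finset V}
    (par : Par k d t)
    (mono : ∀ S T, S ⊆ T → sh T → sh S) (emp : sh ∅) (hav : Avail sh k t R m)
    (w : List (Option V)) : ∀ (l : List V) (X : Finset V),
    GoodW sh k d (l.map some ++ w) → w.count none + X.card ≤ m →
    ∃ c : List V, c.Nodup ∧ c.length = w.count none ∧ (∀ v ∈ c, v ∈ R ∧ v ∉ X) ∧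
      Good sh k d (l ++ fill w c) := by
  induction w with
  | nil =>
    intro l X h _
    exact ⟨[], by simp, by simp, by simp, by simpa [fill, goodW_map] using h⟩
  | cons a w ih =>
    intro l X h hm
    cases a with
    | some v =>
      obtain ⟨c, h1, h2, h3, h4⟩ := ih (l ++ [v]) X (by simpa using h) (by simpa using hm)
      exact ⟨c, h1, by simpa using h2, h3, by simpa [fill] using h4⟩
    | none =>
      have hs := fill_step par mono emp hav l w h
      have hc : (none :: w).count none = w.count none + 1 := by simp
      have : ∃ v ∈ R.filter (fun v => GoodW sh k d ((l ++ [v]).map some ++ w)), v ∉ X := by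
        by_contra hcon
        push Not at hcon
        have := card_le_card (show _ ⊆ X from hcon)
        omega
      obtain ⟨v, hv, hvX⟩ := this
      obtain ⟨hvR, hvG⟩ := mem_filter.1 hv
      obtain ⟨c, h1, h2, h3, h4⟩ := ih (l ++ [v]) (insert v X) hvG
        (by rw [card_insert_of_notMem hvX]; omega)
      refine ⟨v :: c, ?_, by simp [h2], ?_, by simpa [fill] using h4⟩
      · rw [List.nodup_cons]
        refine ⟨fun hvc => ?_, h1⟩
        exact (h3 v hvc).2 (mem_insert_self _ _)
      · intro u hu
        rcases List.mem_cons.1 hu with rfl | hu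
        · exact ⟨hvR, hvX⟩
        · exact ⟨(h3 u hu).1, fun hx => (h3 u hu).2 (mem_insert_of_mem hx)⟩

/-- In the whole vertex set at least `t α n` common extensions exist. -/
lemma avail_univ {sh : Finset V → Prop} {k t : ℕ} {α : ℝ} (ht : 2 ≤ t) (S : Sys sh k t α)
    (g : Fin t → Finset V) (hg : ∀ j, sh (g j) ∧ (g j).card < k) :
    t * α * Fintype.card V ≤ ((univ.filter fun v => ∀ j, sh (insert v (g j))).card : ℝ) := by
  have h1 : univ.filter (fun v => ¬ ∀ j, sh (insert v (g j))) ⊆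
      (univ : Finset (Fin t)).biUnion fun j => univ.filter fun v => ¬ sh (insert v (g j)) := by
    intro v hv
    simpa using hv
  have h2 := (card_le_card h1).trans card_biUnion_le
  have h3 : ∀ j : Fin t, ((univ.filter fun v => ¬ sh (insert v (g j))).card : ℝ) ≤
      (1 / t - α) * Fintype.card V := by
    intro j
    have := S.deg (g j) (hg j).1 (hg j).2
    have e := card_filter_add_card_filter_not (s := (univ : Finset V)) (fun v => sh (insert v (g j)))
    have e' : ((univ.filter fun v => sh (insert v (g j))).card : ℝ) +
      ((univ.filter fun v => ¬ sh (insert v (g j))).card : ℝ) = Fintype.card V := by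
      rw [← card_univ]; exact_mod_cast e
    linarith
  have h4 : ((univ.filter (fun v => ¬ ∀ j, sh (insert v (g j)))).card : ℝ) ≤
      t * ((1 / t - α) * Fintype.card V) := by
    calc _ ≤ ((∑ j : Fin t, (univ.filter fun v => ¬ sh (insert v (g j))).card : ℕ) : ℝ) := by
          exact_mod_cast h2
      _ = ∑ j : Fin t, ((univ.filter fun v => ¬ sh (insert v (g j))).card : ℝ) := by push_cast; rfl
      _ ≤ ∑ j : Fin t, (1 / t - α) * Fintype.card V := Finset.sum_le_sum fun j _ => h3 j
      _ = _ := by simp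
  have e := card_filter_add_card_filter_not (s := (univ : Finset V))
    (fun v => ∀ j, sh (insert v (g j)))
  have e' : ((univ.filter fun v => ∀ j, sh (insert v (g j))).card : ℝ) +
      ((univ.filter fun v => ¬ ∀ j, sh (insert v (g j))).card : ℝ) = Fintype.card V := by
    rw [← card_univ]; exact_mod_cast e
  have ht0 : (t : ℝ) ≠ 0 := by positivity
  have : (t : ℝ) * ((1 / t - α) * Fintype.card V) = Fintype.card V - t * α * Fintype.card V := by
    field_simp
  linarith

end PartA

set_option linter.unusedSectionVars false
set_option linter.unusedVariables false

section PartD1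
open scoped Classical

/-- Dense `j`-partite structures contain complete `j`-partite ones with parts of size `B`. -/
lemma kst (B : ℕ) : ∀ (j : ℕ) (c : ℝ), 0 < c → ∃ β0 : ℕ, ∀ β : ℕ, β0 ≤ β →
    ∀ (V : Type) (Y : Fin j → Finset V), (∀ i, (Y i).card ≤ β) →
    ∀ P : (Fin j → V) → Prop, c * (β : ℝ) ^ j ≤ (((Fintype.piFinset Y).filter P).card : ℝ) →
    ∃ Z : Fin j → Finset V, (∀ i, Z i ⊆ Y i ∧ (Z i).card = B) ∧
      ∀ x : Fin j → V, (∀ i, x i ∈ Z i) → P x := by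
  intro j
  induction j with
  | zero =>
    intro c hc
    refine ⟨0, fun β _ V Y _ P h => ?_⟩
    have hpos : 0 < ((Fintype.piFinset Y).filter P).card := by
      have : (0 : ℝ) < (((Fintype.piFinset Y).filter P).card : ℝ) := lt_of_lt_of_le (by simpa using hc) h
      exact_mod_cast this
    obtain ⟨x, hx⟩ := card_pos.1 hpos
    refine ⟨Y, fun i => i.elim0, fun y _ => ?_⟩
    have : y = x := Subsingleton.elim _ _
    rw [this]; exact (mem_filter.1 hx).2
  | succ j ih =>
    intro c hc
    obtain ⟨β1, hβ1⟩ := ih (c / 2 * (c / 4) ^ B) (by positivity)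
    obtain ⟨β2, hβ2⟩ := exists_nat_ge (4 * (B : ℝ) / c)
    refine ⟨max (max β1 β2) 1, fun β hβ V Y hY P h => ?_⟩
    have hb1 : β1 ≤ β := by omega
    have hb2 : (β2 : ℝ) ≤ β := by exact_mod_cast (by omega : β2 ≤ β)
    have hbpos : (0 : ℝ) < β := by exact_mod_cast (by omega : 0 < β)
    have hB : (B : ℝ) ≤ c * β / 4 := by
      have := hβ2.trans hb2
      rw [div_le_iff₀ hc] at this
      linarith
    set F := (Fintype.piFinset Y).filter P with hF
    set G := Fintype.piFinset (fun i : Fin j => Y i.succ) with hG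
    let N : (Fin j → V) → Finset V := fun y => (Y 0).filter fun v => P (Fin.cons v y)
    have hNle : ∀ y, ((N y).card : ℝ) ≤ β := fun y => by
      exact_mod_cast (card_filter_le _ _).trans (hY 0)
    have hFG : F.card ≤ ∑ y ∈ G, (N y).card := by
      rw [card_eq_sum_card_fiberwise (f := Fin.tail) (t := G)]
      · refine sum_le_sum fun y hy => ?_
        refine card_le_card_of_injOn (fun x => x 0) ?_ ?_
        · intro x hx
          simp only [coe_filter, Set.mem_ofPred_eq, hF, mem_filter, Fintype.mem_piFinset] at hx
          obtain ⟨⟨h1, h2⟩, h3⟩ := hx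
          simp only [N, coe_filter, Set.mem_ofPred_eq]
          refine ⟨h1 0, ?_⟩
          rw [← h3, Fin.cons_self_tail]; exact h2
        · intro x hx x' hx' hxx
          simp only [coe_filter, Set.mem_ofPred_eq] at hx hx'
          rw [← Fin.cons_self_tail x, ← Fin.cons_self_tail x', hx.2, hx'.2]
          simp only at hxx
          rw [hxx]
      · intro x hx
        simp only [hF, coe_filter, Set.mem_ofPred_eq, Fintype.mem_piFinset] at hx
        simp only [hG, mem_coe, Fintype.mem_piFinset]
        intro i
        exact hx.1 i.succ
    have hGle : (G.card : ℝ) ≤ (β : ℝ) ^ j := by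
      rw [hG, Fintype.card_piFinset]
      push_cast
      calc ∏ i : Fin j, ((Y i.succ).card : ℝ) ≤ ∏ i : Fin j, (β : ℝ) :=
            prod_le_prod (fun _ _ => by positivity) fun i _ => by exact_mod_cast hY _
        _ = _ := by simp
    set G' := G.filter fun y => c * β / 2 ≤ ((N y).card : ℝ) with hG'
    have hsum : (∑ y ∈ G, ((N y).card : ℝ)) ≤ G'.card * β + G.card * (c * β / 2) := by
      rw [← sum_filter_add_sum_filter_not G (fun y => c * β / 2 ≤ ((N y).card : ℝ))]
      refine add_le_add ?_ ?_
      · rw [← nsmul_eq_mul]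
        exact sum_le_card_nsmul _ _ _ fun y _ => hNle y
      · calc _ ≤ ((G.filter fun y => ¬ c * β / 2 ≤ ((N y).card : ℝ)).card : ℝ) * (c * β / 2) := by
              rw [← nsmul_eq_mul]
              refine sum_le_card_nsmul _ _ _ fun y hy => ?_
              exact (not_le.1 (mem_filter.1 hy).2).le
          _ ≤ _ := by
              refine mul_le_mul_of_nonneg_right ?_ (by positivity)
              exact_mod_cast card_filter_le _ _
    have hG'c : c / 2 * (β : ℝ) ^ j ≤ G'.card := by
      have h1 : (F.card : ℝ) ≤ ∑ y ∈ G, ((N y).card : ℝ) := by exact_mod_cast hFG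
      have h2 : c * (β : ℝ) ^ (j + 1) ≤ G'.card * β + (β : ℝ) ^ j * (c * β / 2) := by
        refine h.trans (h1.trans (hsum.trans ?_))
        gcongr
      have h3 : c / 2 * (β : ℝ) ^ j * β ≤ G'.card * β := by
        rw [pow_succ] at h2; linarith
      exact le_of_mul_le_mul_right h3 hbpos
    have hG'ne : G'.Nonempty := by
      rw [← card_pos]
      have : (0 : ℝ) < G'.card := lt_of_lt_of_le (by positivity) hG'c
      exact_mod_cast this
    have hmB : ∀ y ∈ G', c * β / 4 + B ≤ ((N y).card : ℝ) := by
      intro y hy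
      have := (mem_filter.1 hy).2
      linarith
    have hch : ∀ y ∈ G', (c * β / 4) ^ B ≤ (B.factorial : ℝ) * ((N y).card.choose B : ℝ) := by
      intro y hy
      have h1 := Nat.pow_le_choose (α := ℝ) B (N y).card
      have h3 := hmB y hy
      have h2 : c * β / 4 ≤ (((N y).card + 1 - B : ℕ) : ℝ) := by
        have : B ≤ (N y).card + 1 := by
          have : (B : ℝ) ≤ ((N y).card : ℝ) := by
            have : 0 ≤ c * β / 4 := by positivity
            linarith
          have : B ≤ (N y).card := by exact_mod_cast this
          omega
        rw [Nat.cast_sub this]; push_cast; linarith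
      rw [div_le_iff₀ (by positivity)] at h1
      refine (pow_le_pow_left₀ (by positivity) h2 B).trans ?_
      push_cast at h1 ⊢
      linarith
    have hPne : (powersetCard B (Y 0)).Nonempty := by
      obtain ⟨y, hy⟩ := hG'ne
      rw [powersetCard_nonempty]
      have h1 : (B : ℝ) ≤ ((N y).card : ℝ) := by
        have := hmB y hy
        have : 0 ≤ c * β / 4 := by positivity
        linarith
      have h2 : B ≤ (N y).card := by exact_mod_cast h1
      exact h2.trans (card_filter_le _ _)
    have hdc : ∑ S ∈ powersetCard B (Y 0), ((G.filter fun y => S ⊆ N y).card) =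
        ∑ y ∈ G, ((powersetCard B (Y 0)).filter fun S => S ⊆ N y).card := by
      exact sum_card_bipartiteAbove_eq_sum_card_bipartiteBelow (fun S y => S ⊆ N y)
    have hpc : ∀ y, (N y).card.choose B ≤ ((powersetCard B (Y 0)).filter fun S => S ⊆ N y).card := by
      intro y
      rw [← card_powersetCard]
      refine card_le_card fun S hS => ?_
      rw [mem_powersetCard] at hS
      rw [mem_filter, mem_powersetCard]
      exact ⟨⟨hS.1.trans (filter_subset _ _), hS.2⟩, hS.1⟩
    obtain ⟨S, hS, hSc⟩ : ∃ S ∈ powersetCard B (Y 0),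
        c / 2 * (c / 4) ^ B * (β : ℝ) ^ j ≤ ((G.filter fun y => S ⊆ N y).card : ℝ) := by
      apply exists_le_of_sum_le hPne
      have e1 : (∑ S ∈ powersetCard B (Y 0), ((G.filter fun y => S ⊆ N y).card : ℝ)) =
          ∑ y ∈ G, (((powersetCard B (Y 0)).filter fun S => S ⊆ N y).card : ℝ) := by
        exact_mod_cast hdc
      rw [e1, sum_const, nsmul_eq_mul, card_powersetCard]
      have hf : (0 : ℝ) < B.factorial := by exact_mod_cast B.factorial_pos
      refine le_of_mul_le_mul_left ?_ hf
      have h1 : (B.factorial : ℝ) * ((Y 0).card.choose B : ℝ) ≤ (β : ℝ) ^ B := by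
        have := Nat.choose_le_pow_div (α := ℝ) B (Y 0).card
        rw [le_div_iff₀ hf] at this
        calc _ ≤ ((Y 0).card : ℝ) ^ B := by linarith
          _ ≤ _ := pow_le_pow_left₀ (by positivity) (by exact_mod_cast hY 0) _
      calc (B.factorial : ℝ) * (((Y 0).card.choose B : ℝ) * (c / 2 * (c / 4) ^ B * (β : ℝ) ^ j))
          = (B.factorial : ℝ) * ((Y 0).card.choose B : ℝ) * (c / 2 * (c / 4) ^ B * (β : ℝ) ^ j) := by ring
        _ ≤ (β : ℝ) ^ B * (c / 2 * (c / 4) ^ B * (β : ℝ) ^ j) := by gcongr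
        _ = (c / 2 * (β : ℝ) ^ j) * (c * β / 4) ^ B := by
            rw [show c * (β : ℝ) / 4 = (c / 4) * β by ring, mul_pow]; ring
        _ ≤ G'.card * (c * β / 4) ^ B := by gcongr
        _ = ∑ y ∈ G', (c * β / 4) ^ B := by simp
        _ ≤ ∑ y ∈ G', (B.factorial : ℝ) * ((N y).card.choose B : ℝ) := sum_le_sum hch
        _ ≤ ∑ y ∈ G', (B.factorial : ℝ) *
              (((powersetCard B (Y 0)).filter fun S => S ⊆ N y).card : ℝ) := by
            refine sum_le_sum fun y _ => ?_
            have := hpc y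
            gcongr
        _ ≤ ∑ y ∈ G, (B.factorial : ℝ) *
              (((powersetCard B (Y 0)).filter fun S => S ⊆ N y).card : ℝ) := by
            refine sum_le_sum_of_subset_of_nonneg (filter_subset _ _) ?_
            intros; positivity
        _ = _ := by rw [mul_sum]
    obtain ⟨Z, hZ, hZP⟩ := hβ1 β hb1 V (fun i => Y i.succ) (fun i => hY _) (fun y => S ⊆ N y)
      (by convert hSc)
    rw [mem_powersetCard] at hS
    refine ⟨Fin.cons S Z, ?_, ?_⟩
    · intro i
      refine Fin.cases ?_ ?_ i
      · simpa using hS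
      · intro i; simpa using hZ i
    · intro x hx
      have h0 : x 0 ∈ S := by simpa using hx 0
      have h1 : S ⊆ N (Fin.tail x) := hZP _ fun i => by simpa [Fin.tail] using hx i.succ
      have := (mem_filter.1 (h1 h0)).2
      rwa [Fin.cons_self_tail] at this

end PartD1

set_option linter.unusedSectionVars false
set_option linter.unusedVariables false

section PartD2
open scoped Classical
variable {V : Type} [Fintype V] [DecidableEq V]

/-- number of shadow transversals of a tuple of cells -/
noncomputable def cnt {ι : Type} (sh : Finset V → Prop) (C : ι → Finset V) {j : ℕ}
    (c : Fin j → ι) : ℕ :=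
  ((Fintype.piFinset fun i => C (c i)).filter fun x => sh (univ.image x)).card

lemma image_cons {j : ℕ} (v : V) (x : Fin j → V) :
    univ.image (Fin.cons v x : Fin (j + 1) → V) = insert v (univ.image x) := by
  ext u
  simp only [mem_image, mem_univ, true_and, mem_insert]
  constructor
  · rintro ⟨i, rfl⟩
    refine Fin.cases ?_ (fun i => ?_) i
    · simp
    · right; exact ⟨i, by simp⟩
  · rintro (rfl | ⟨i, rfl⟩)
    · exact ⟨0, by simp⟩
    · exact ⟨i.succ, by simp⟩

lemma cnt_cons {ι : Type} {sh : Finset V → Prop}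
    (mono : ∀ S T, S ⊆ T → sh T → sh S) (C : ι → Finset V) {j : ℕ}
    (c : Fin j → ι) (a : ι) :
    cnt sh C (Fin.cons a c : Fin (j + 1) → ι) =
      ∑ x ∈ (Fintype.piFinset fun i => C (c i)).filter (fun x => sh (univ.image x)),
        ((C a).filter fun v => sh (insert v (univ.image x))).card := by
  rw [← card_sigma, cnt]
  refine card_nbij' (fun y => ⟨Fin.tail y, y 0⟩) (fun p => Fin.cons p.2 p.1) ?_ ?_ ?_ ?_
  · intro y hy
    simp only [coe_filter, Set.mem_ofPred_eq, Fintype.mem_piFinset] at hy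
    obtain ⟨h1, h2⟩ := hy
    rw [← Fin.cons_self_tail y, image_cons] at h2
    simp only [coe_sigma, Set.mem_sigma_iff, coe_filter, Set.mem_ofPred_eq, Fintype.mem_piFinset]
    refine ⟨⟨fun i => by simpa [Fin.tail] using h1 i.succ, mono _ _ (subset_insert _ _) h2⟩,
      by simpa using h1 0, h2⟩
  · rintro ⟨x, v⟩ hp
    simp only [coe_sigma, Set.mem_sigma_iff, coe_filter, Set.mem_ofPred_eq,
      Fintype.mem_piFinset] at hp
    simp only [coe_filter, Set.mem_ofPred_eq, Fintype.mem_piFinset]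
    refine ⟨fun i => ?_, by rw [image_cons]; exact hp.2.2⟩
    refine Fin.cases ?_ (fun i => ?_) i
    · simpa using hp.2.1
    · simpa using hp.1.1 i
  · intro y _; simp
  · rintro ⟨x, v⟩ _; simp

lemma cells_le {ι : Type} [Fintype ι] {C : ι → Finset V}
    (hdis : ∀ a b, a ≠ b → Disjoint (C a) (C b)) {β : ℕ} (hC : ∀ a, (C a).card = β) :
    (univ.biUnion C).card = Fintype.card ι * β := by
  rw [card_biUnion fun a _ b _ hab => hdis a b hab]
  simp [hC]

/-- Extending dense tuples of cells. -/
lemma dens {ι : Type} [Fintype ι] {sh : Finset V → Prop} {k t : ℕ} {α : ℝ} (ht : 2 ≤ t)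
    (hα : 0 < α) (S : Sys sh k t α) {C : ι → Finset V}
    (hdis : ∀ a b, a ≠ b → Disjoint (C a) (C b)) {β : ℕ} (hβ : 0 < β)
    (hC : ∀ a, (C a).card = β) (hn : Fintype.card V ≤ Fintype.card ι * β + β)
    {j : ℕ} (hj : j < k) (c : Fin j → ι) {γ : ℝ} (hγ : 0 < γ)
    (hc : γ * (β : ℝ) ^ j ≤ cnt sh C c) :
    (1 - 1 / (t : ℝ) + 3 * α / 4) * Fintype.card ι - 1 ≤
      ((univ.filter fun a => α / 4 * γ * (β : ℝ) ^ (j + 1) ≤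
        cnt sh C (Fin.cons a c : Fin (j + 1) → ι)).card : ℝ) := by
  set X := (Fintype.piFinset fun i => C (c i)).filter fun x => sh (univ.image x) with hX
  set D := univ.filter fun a => α / 4 * γ * (β : ℝ) ^ (j + 1) ≤
        cnt sh C (Fin.cons a c : Fin (j + 1) → ι) with hD
  have hcX : cnt sh C c = X.card := rfl
  rw [hcX] at hc
  have hb : (0 : ℝ) < β := by exact_mod_cast hβ
  have hXpos : (0 : ℝ) < X.card := lt_of_lt_of_le (by positivity) hc
  set n := Fintype.card V with hn'
  set N := Fintype.card ι with hN'
  have hNn : N * β ≤ n := by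
    rw [← cells_le hdis hC]; exact card_le_univ _
  have ht1 : (0 : ℝ) ≤ 1 - 1 / t := by
    have : (2 : ℝ) ≤ t := by exact_mod_cast ht
    rw [sub_nonneg, div_le_one (by linarith)]; linarith
  -- lower bound per `x`
  have hlow : ∀ x ∈ X, (1 - 1 / (t : ℝ) + α) * n - β ≤
      ∑ a : ι, (((C a).filter fun v => sh (insert v (univ.image x))).card : ℝ) := by
    intro x hx
    have hx := (mem_filter.1 hx).2
    have h1 := S.deg (univ.image x) hx
      (lt_of_le_of_lt (card_image_le.trans (by simp)) hj)
    have h2 : univ.filter (fun v => sh (insert v (univ.image x))) ⊆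
        (univ.biUnion fun a => (C a).filter fun v => sh (insert v (univ.image x))) ∪
          (univ \ univ.biUnion C) := by
      intro v hv
      rw [mem_filter] at hv
      by_cases hvC : ∃ a, v ∈ C a
      · obtain ⟨a, ha⟩ := hvC
        apply mem_union_left
        rw [mem_biUnion]
        exact ⟨a, mem_univ _, mem_filter.2 ⟨ha, hv.2⟩⟩
      · apply mem_union_right
        simp only [mem_sdiff, mem_univ, mem_biUnion, true_and]
        exact hvC
    have h3 := (card_le_card h2).trans (card_union_le _ _)
    have h4 : (univ \ univ.biUnion C : Finset V).card ≤ β := by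
      rw [card_sdiff_of_subset (subset_univ _), cells_le hdis hC, card_univ]
      exact Nat.sub_le_iff_le_add'.2 hn
    have h5 := card_biUnion_le (s := (univ : Finset ι))
      (t := fun a => (C a).filter fun v => sh (insert v (univ.image x)))
    have h6 : (univ.filter (fun v => sh (insert v (univ.image x)))).card ≤
      ∑ a : ι, ((C a).filter fun v => sh (insert v (univ.image x))).card + β := by omega
    have h7 : ((univ.filter (fun v => sh (insert v (univ.image x)))).card : ℝ) ≤
      ∑ a : ι, (((C a).filter fun v => sh (insert v (univ.image x))).card : ℝ) + β := by
      exact_mod_cast h6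
    linarith
  have hcnt : ∀ a : ι, (cnt sh C (Fin.cons a c : Fin (j + 1) → ι) : ℝ) =
      ∑ x ∈ X, (((C a).filter fun v => sh (insert v (univ.image x))).card : ℝ) := by
    intro a
    rw [cnt_cons S.mono]; push_cast; rfl
  have hA : X.card * ((1 - 1 / (t : ℝ) + α) * n - β) ≤
      ∑ a : ι, (cnt sh C (Fin.cons a c : Fin (j + 1) → ι) : ℝ) := by
    simp_rw [hcnt]
    rw [sum_comm, ← nsmul_eq_mul]
    exact card_nsmul_le_sum _ _ _ hlow
  have hup : ∀ a : ι, (cnt sh C (Fin.cons a c : Fin (j + 1) → ι) : ℝ) ≤ X.card * β := by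
    intro a
    rw [hcnt, ← nsmul_eq_mul]
    refine sum_le_card_nsmul _ _ _ fun x _ => ?_
    rw [← hC a]; exact_mod_cast card_filter_le _ _
  have hB : ∑ a : ι, (cnt sh C (Fin.cons a c : Fin (j + 1) → ι) : ℝ) ≤
      D.card * (X.card * β) + N * (α / 4 * X.card * β) := by
    rw [← sum_filter_add_sum_filter_not univ (fun a => α / 4 * γ * (β : ℝ) ^ (j + 1) ≤
        cnt sh C (Fin.cons a c : Fin (j + 1) → ι))]
    refine add_le_add ?_ ?_
    · rw [← nsmul_eq_mul]
      exact sum_le_card_nsmul _ _ _ fun a _ => hup a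
    · calc _ ≤ ((univ.filter fun a => ¬ α / 4 * γ * (β : ℝ) ^ (j + 1) ≤
            cnt sh C (Fin.cons a c : Fin (j + 1) → ι)).card : ℝ) * (α / 4 * X.card * β) := by
            rw [← nsmul_eq_mul]
            refine sum_le_card_nsmul _ _ _ fun a ha => ?_
            refine (not_le.1 (mem_filter.1 ha).2).le.trans ?_
            calc α / 4 * γ * (β : ℝ) ^ (j + 1) = α / 4 * (γ * (β : ℝ) ^ j) * β := by ring
              _ ≤ _ := by gcongr
        _ ≤ _ := by
            refine mul_le_mul_of_nonneg_right ?_ (by positivity)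
            exact_mod_cast card_filter_le _ _
  have h1 : (X.card : ℝ) * ((1 - 1 / (t : ℝ) + α) * n - β) ≤
      X.card * (D.card * β + N * (α / 4 * β)) := by
    refine (hA.trans hB).trans (le_of_eq ?_); ring
  have h2 := le_of_mul_le_mul_left h1 hXpos
  have h3 : ((1 - 1 / (t : ℝ) + α) * (N * β)) ≤ (1 - 1 / (t : ℝ) + α) * n := by
    apply mul_le_mul_of_nonneg_left _ (by linarith)
    exact_mod_cast hNn
  have h4 : ((1 - 1 / (t : ℝ) + 3 * α / 4) * N - 1) * β ≤ D.card * β := by nlinarith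
  exact le_of_mul_le_mul_right h4 hb

/-- Choosing a dense edge with prescribed last cell and the others in a large set. -/
lemma pick {ι : Type} [Fintype ι] {sh : Finset V → Prop} {k t : ℕ} {α : ℝ} (ht : 2 ≤ t)
    (hα : 0 < α) (S : Sys sh k t α) {C : ι → Finset V}
    (hdis : ∀ a b, a ≠ b → Disjoint (C a) (C b)) {β : ℕ} (hβ : 0 < β)
    (hC : ∀ a, (C a).card = β) (hn : Fintype.card V ≤ Fintype.card ι * β + β)
    (hN : (k + 1 : ℝ) ≤ 3 * α / 4 * Fintype.card ι)
    (L : Finset ι) (hL : Fintype.card ι < L.card * t) (a : ι) :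
    ∀ j : ℕ, j < k → ∃ e : Fin (j + 1) → ι, Function.Injective e ∧ e (Fin.last j) = a ∧
      (∀ i, i ≠ Fin.last j → e i ∈ L) ∧ (α / 4) ^ j * (β : ℝ) ^ (j + 1) ≤ cnt sh C e := by
  intro j
  induction j with
  | zero =>
    intro hk
    refine ⟨fun _ => a, fun x y _ => Subsingleton.elim (α := Fin 1) x y, rfl, ?_, ?_⟩
    · intro i hi; exact absurd (Subsingleton.elim (α := Fin 1) i _) hi
    · have : cnt sh C (fun _ : Fin 1 => a) = β := by
        rw [cnt, filter_true_of_mem, Fintype.card_piFinset]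
        · simp [hC]
        · intro x _
          have : univ.image x = {x 0} := by
            ext u; simp
          rw [this]; exact S.sing _
      rw [this]; simp
  | succ j ih =>
    intro hjk
    obtain ⟨e, he1, he2, he3, he4⟩ := ih (by omega)
    have h1 := dens ht hα S hdis hβ hC hn (j := j + 1) hjk e (γ := (α / 4) ^ j) (by positivity) he4
    set D := univ.filter fun a => α / 4 * (α / 4) ^ j * (β : ℝ) ^ (j + 1 + 1) ≤
        cnt sh C (Fin.cons a e : Fin (j + 1 + 1) → ι) with hD
    have : ∃ a', a' ∈ D ∧ a' ∈ L ∧ a' ∉ univ.image e := by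
      by_contra hcon
      push Not at hcon
      have hsub : D ⊆ (univ \ L) ∪ univ.image e := by
        intro x hx
        by_cases hxL : x ∈ L
        · exact mem_union_right _ (hcon x hx hxL)
        · exact mem_union_left _ (by simp [hxL])
      have h2 := (card_le_card hsub).trans (card_union_le _ _)
      have h3 : (univ.image e).card ≤ k := card_image_le.trans (by simp; omega)
      rw [card_sdiff_of_subset (subset_univ _), card_univ] at h2
      have h4 : L.card ≤ Fintype.card ι := card_le_univ _
      have h5 : D.card + L.card ≤ Fintype.card ι + k := by omega
      have h6 : (D.card : ℝ) + L.card ≤ Fintype.card ι + k := by exact_mod_cast h5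
      have h7 : (Fintype.card ι : ℝ) < L.card * t := by exact_mod_cast hL
      have ht0 : (0 : ℝ) < t := by positivity
      have h8 : (Fintype.card ι : ℝ) / t < L.card := by rwa [div_lt_iff₀ ht0]
      have h9 : (1 - 1 / (t : ℝ) + 3 * α / 4) * Fintype.card ι =
        Fintype.card ι - Fintype.card ι / t + 3 * α / 4 * Fintype.card ι := by ring
      linarith
    obtain ⟨a', ha1, ha2, ha3⟩ := this
    refine ⟨Fin.cons a' e, ?_, ?_, ?_, ?_⟩
    · rw [Fin.cons_injective_iff]
      refine ⟨?_, he1⟩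
      rintro ⟨i, hi⟩
      exact ha3 (by simp [← hi])
    · rw [← Fin.succ_last, Fin.cons_succ, he2]
    · intro i
      refine Fin.cases ?_ (fun i => ?_) i
      · intro _; simpa using ha2
      · intro hi
        rw [Fin.cons_succ]
        apply he3
        rintro rfl
        exact hi (Fin.succ_last _)
    · have := (mem_filter.1 ha1).2
      rw [pow_succ']
      exact this

end PartD2

set_option linter.unusedSectionVars false
set_option linter.unusedVariables false
set_option linter.unusedSimpArgs false

section PartD3
open scoped Classical

/-- weights of the colour classes of a tile -/
def wt (K t : ℕ) (i : Fin (K + 1)) : ℕ := if i = Fin.last K then K else t - 1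

lemma sum_wt {K t : ℕ} (ht : 1 ≤ t) : ∑ i, wt K t i = K * t := by
  rw [Fin.sum_univ_castSucc]
  have : ∀ i : Fin K, wt K t i.castSucc = t - 1 := fun i => by
    simp [wt, (Fin.castSucc_lt_last i).ne]
  simp only [this, wt, if_true, sum_const, card_univ, Fintype.card_fin, smul_eq_mul]
  obtain ⟨u, rfl⟩ : ∃ u, t = u + 1 := ⟨t - 1, by omega⟩
  simp; ring

variable {ι : Type} [Fintype ι]

/-- load of an edge on a cell -/
noncomputable def lw (K t : ℕ) (e : Fin (K + 1) → ι) (c : ι) : ℕ :=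
  ∑ i, if e i = c then wt K t i else 0

/-- load of a list of edges on a cell -/
noncomputable def load (K t : ℕ) (es : List (Fin (K + 1) → ι)) (c : ι) : ℕ :=
  (es.map fun e => lw K t e c).sum

lemma sum_lw_mul {K t : ℕ} (e : Fin (K + 1) → ι) (x : ι → ℕ) :
    ∑ c, x c * lw K t e c = ∑ i, wt K t i * x (e i) := by
  simp only [lw, mul_sum]
  rw [sum_comm]
  refine sum_congr rfl fun i _ => ?_
  simp [mul_ite, mul_comm]

lemma sum_lw {K t : ℕ} (ht : 1 ≤ t) (e : Fin (K + 1) → ι) : ∑ c, lw K t e c = K * t := by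
  have := sum_lw_mul (t := t) e (fun _ => 1)
  simp only [one_mul, mul_one] at this
  rw [this, sum_wt ht]

lemma sum_load {K t : ℕ} (ht : 1 ≤ t) (es : List (Fin (K + 1) → ι)) :
    ∑ c, load K t es c = K * t * es.length := by
  induction es with
  | nil => simp [load]
  | cons e es ih =>
    simp only [load, List.map_cons, List.sum_cons, sum_add_distrib] at ih ⊢
    rw [ih, sum_lw ht]; simp; ring

lemma greedy_arith {N q t m θ : ℕ} (ht : 1 ≤ t) (hq : q ≤ N) (hm : m ≤ θ) (h : q * t ≤ N) :
    N * (m + (t - 1) * θ) ≤ t * (q * m + (N - q) * θ) := by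
  obtain ⟨u, rfl⟩ : ∃ u, t = u + 1 := ⟨t - 1, by omega⟩
  obtain ⟨r, rfl⟩ : ∃ r, N = q + r := ⟨N - q, by omega⟩
  obtain ⟨y, rfl⟩ : ∃ y, θ = m + y := ⟨θ - m, by omega⟩
  simp only [Nat.add_sub_cancel_left, Nat.add_sub_cancel]
  have : q * u ≤ r := by nlinarith
  nlinarith [Nat.mul_le_mul_right y this]

/-- one greedy step -/
lemma greedy_step [Nonempty ι] {K t : ℕ} (ht : 2 ≤ t) {Q : (Fin (K + 1) → ι) → Prop}
    (hQ : ∀ (L : Finset ι), Fintype.card ι < L.card * t → ∀ a, ∃ e : Fin (K + 1) → ι,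
      Q e ∧ e (Fin.last K) = a ∧ ∀ i, i ≠ Fin.last K → e i ∈ L) (x : ι → ℕ) :
    ∃ e, Q e ∧ Fintype.card ι * ∑ i, wt K t i * x (e i) ≤ K * t * ∑ c, x c := by
  set N := Fintype.card ι with hN
  have hNpos : 0 < N := Fintype.card_pos
  obtain ⟨a, -, ha⟩ := exists_min_image (univ : Finset ι) x univ_nonempty
  have hex : ∃ θ : ℕ, N < (univ.filter fun c => x c ≤ θ).card * t := by
    refine ⟨∑ c, x c, ?_⟩
    rw [filter_true_of_mem fun c _ => single_le_sum (f := x) (fun _ _ => Nat.zero_le _) (mem_univ c),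
      card_univ]
    nlinarith
  set θ := Nat.find hex with hθ
  have h1 : N < (univ.filter fun c => x c ≤ θ).card * t := Nat.find_spec hex
  have h2 : (univ.filter fun c => x c < θ).card * t ≤ N := by
    rcases Nat.eq_zero_or_pos θ with h0 | h0
    · rw [h0]; simp
    · have := Nat.find_min hex (m := θ - 1) (by omega)
      push Not at this
      refine le_trans (Nat.mul_le_mul_right _ (card_le_card ?_)) this
      intro c hc
      simp only [mem_filter, mem_univ, true_and] at hc ⊢
      omega
  obtain ⟨e, he1, he2, he3⟩ := hQ _ h1 a
  refine ⟨e, he1, ?_⟩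
  have haθ : x a ≤ θ := by
    have : 0 < (univ.filter fun c => x c ≤ θ).card := by
      rcases Nat.eq_zero_or_pos (univ.filter fun c => x c ≤ θ).card with h | h
      · rw [h] at h1; omega
      · exact h
    obtain ⟨c, hc⟩ := card_pos.1 this
    exact (ha c (mem_univ _)).trans (mem_filter.1 hc).2
  have h3 : ∑ i, wt K t i * x (e i) ≤ K * x a + K * ((t - 1) * θ) := by
    rw [Fin.sum_univ_castSucc]
    have hl : wt K t (Fin.last K) = K := by simp [wt]
    rw [hl, he2, add_comm]
    refine Nat.add_le_add_left ?_ _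
    calc _ ≤ ∑ i : Fin K, (t - 1) * θ := by
          refine sum_le_sum fun i _ => ?_
          have hw : wt K t i.castSucc = t - 1 := by
            simp [wt, (Fin.castSucc_lt_last i).ne]
          rw [hw]
          refine Nat.mul_le_mul_left _ ?_
          exact (mem_filter.1 (he3 i.castSucc (Fin.castSucc_lt_last i).ne)).2
      _ = _ := by simp
  set q := (univ.filter fun c => x c < θ).card with hq
  have h4 : q * x a + (N - q) * θ ≤ ∑ c, x c := by
    rw [← sum_filter_add_sum_filter_not univ (fun c => x c < θ)]
    refine Nat.add_le_add ?_ ?_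
    · rw [← smul_eq_mul]
      exact card_nsmul_le_sum _ _ _ fun c _ => ha c (mem_univ _)
    · have : N - q = (univ.filter fun c => ¬ x c < θ).card := by
        have := card_filter_add_card_filter_not (s := (univ : Finset ι)) (fun c => x c < θ)
        rw [card_univ] at this
        omega
      rw [this, ← smul_eq_mul]
      exact card_nsmul_le_sum _ _ _ fun c hc => not_lt.1 (mem_filter.1 hc).2
  have hqN : q ≤ N := card_le_univ _
  have h5 : N * (x a + (t - 1) * θ) ≤ t * ∑ c, x c := by
    exact le_trans (greedy_arith (by omega) hqN haθ h2) (Nat.mul_le_mul_left t h4)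
  calc N * ∑ i, wt K t i * x (e i) ≤ N * (K * x a + K * ((t - 1) * θ)) := Nat.mul_le_mul_left _ h3
    _ = K * (N * (x a + (t - 1) * θ)) := by ring
    _ ≤ K * (t * ∑ c, x c) := Nat.mul_le_mul_left _ h5
    _ = _ := by ring

lemma greedy [Nonempty ι] {K t : ℕ} (ht : 2 ≤ t) {Q : (Fin (K + 1) → ι) → Prop}
    (hQ : ∀ (L : Finset ι), Fintype.card ι < L.card * t → ∀ a, ∃ e : Fin (K + 1) → ι,
      Q e ∧ e (Fin.last K) = a ∧ ∀ i, i ≠ Fin.last K → e i ∈ L) (T : ℕ) :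
    ∃ es : List (Fin (K + 1) → ι), es.length = T ∧ (∀ e ∈ es, Q e) ∧
      Fintype.card ι * ∑ c, (load K t es c) ^ 2 ≤
        (K * t * T) ^ 2 + (K * t) ^ 2 * T * Fintype.card ι := by
  induction T with
  | zero => exact ⟨[], rfl, by simp, by simp [load]⟩
  | succ T ih =>
    obtain ⟨es, h1, h2, h3⟩ := ih
    obtain ⟨e, he1, he2⟩ := greedy_step ht hQ (load K t es)
    refine ⟨e :: es, by simp [h1], by simpa using ⟨he1, h2⟩, ?_⟩
    rw [sum_load (by omega), h1, ← sum_lw_mul] at he2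
    have h4 : ∑ c, lw K t e c ^ 2 ≤ (K * t) ^ 2 := by
      rw [← sum_lw (t := t) (by omega) e]
      exact sum_sq_le_sq_sum_of_nonneg (fun _ _ => Nat.zero_le _)
    have h5 : ∑ c, load K t (e :: es) c ^ 2 = ∑ c, load K t es c ^ 2 +
        2 * ∑ c, load K t es c * lw K t e c + ∑ c, lw K t e c ^ 2 := by
      rw [mul_sum, ← sum_add_distrib, ← sum_add_distrib]
      refine sum_congr rfl fun c _ => ?_
      simp only [load, List.map_cons, List.sum_cons]; ring
    rw [h5]
    have h6 := Nat.mul_le_mul_left (Fintype.card ι) h4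
    nlinarith

/-- delete edges until no cell is overloaded -/
lemma prune {K t : ℕ} (A : ℕ) (m : ℕ) : ∀ es : List (Fin (K + 1) → ι), es.length = m →
    ∃ es' : List (Fin (K + 1) → ι), (∀ e ∈ es', e ∈ es) ∧ (∀ c, load K t es' c ≤ A) ∧
      es.length ≤ es'.length + ∑ c, (load K t es c - A) := by
  induction m with
  | zero =>
    intro es hes
    refine ⟨es, fun _ h => h, fun c => ?_, by omega⟩
    rw [List.length_eq_zero_iff] at hes
    simp [hes, load]
  | succ m ih =>
    intro es hes
    by_cases h : ∀ c, load K t es c ≤ A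
    · exact ⟨es, fun _ h => h, h, by omega⟩
    push Not at h
    obtain ⟨c, hc⟩ := h
    have : ∃ e ∈ es, 1 ≤ lw K t e c := by
      by_contra hcon
      push Not at hcon
      have : load K t es c = 0 := by
        rw [load, List.sum_eq_zero]
        intro x hx
        obtain ⟨e, he, rfl⟩ := List.mem_map.1 hx
        have := hcon e he
        omega
      omega
    obtain ⟨e, he, hec⟩ := this
    have hl : ∀ c, load K t es c = lw K t e c + load K t (es.erase e) c := by
      intro c
      have := (List.perm_cons_erase he).map (fun e => lw K t e c)
      simp only [load]
      rw [this.sum_eq]; simp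
    have hlen := List.length_erase_of_mem he
    obtain ⟨es', h1, h2, h3⟩ := ih (es.erase e) (by omega)
    refine ⟨es', fun e' he' => List.mem_of_mem_erase (h1 e' he'), h2, ?_⟩
    have : ∑ c, (load K t (es.erase e) c - A) < ∑ c, (load K t es c - A) := by
      refine sum_lt_sum (fun c _ => ?_) ⟨c, mem_univ _, ?_⟩
      · have := hl c; omega
      · have := hl c; omega
    omega

lemma loads [Nonempty ι] {K t : ℕ} (hK : 1 ≤ K) (ht : 2 ≤ t) {Q : (Fin (K + 1) → ι) → Prop}
    (hQ : ∀ (L : Finset ι), Fintype.card ι < L.card * t → ∀ a, ∃ e : Fin (K + 1) → ι,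
      Q e ∧ e (Fin.last K) = a ∧ ∀ i, i ≠ Fin.last K → e i ∈ L)
    {ζ : ℝ} (hζ : 0 < ζ) {A : ℕ} (hA1 : 8 * ((K * t : ℕ) : ℝ) ^ 3 ≤ ζ ^ 2 * A)
    (hA2 : 2 ≤ ζ * A) (hN : K * t ≤ Fintype.card ι) :
    ∃ es : List (Fin (K + 1) → ι), (∀ e ∈ es, Q e) ∧ (∀ c, load K t es c ≤ A) ∧
      (1 - ζ) * (A * Fintype.card ι) ≤ ((K * t : ℕ) : ℝ) * es.length := by
  set N := Fintype.card ι with hN'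
  set s := K * t with hs
  have hs1 : 1 ≤ s := by nlinarith
  set T := A * N / s with hT
  obtain ⟨es0, h1, h2, h3⟩ := greedy ht hQ T
  obtain ⟨es, g1, g2, g3⟩ := prune (K := K) (t := t) A _ es0 rfl
  refine ⟨es, fun e he => h2 e (g1 e he), g2, ?_⟩
  have hT1 : s * T ≤ A * N := Nat.mul_div_le _ _
  have hT2 : A * N < s * T + s := by
    have := Nat.lt_mul_div_succ (A * N) hs1
    rw [← hT] at this; nlinarith
  set x : ι → ℝ := fun c => (load K t es0 c : ℝ) with hx
  set O : ℕ := ∑ c, (load K t es0 c - A) with hO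
  have hA0 : 1 ≤ A := by
    rcases Nat.eq_zero_or_pos A with h | h
    · rw [h] at hA2; norm_num at hA2
    · exact h
  have hsR : (1 : ℝ) ≤ s := by exact_mod_cast hs1
  have hAR : (1 : ℝ) ≤ A := by exact_mod_cast hA0
  have hNR : (s : ℝ) ≤ N := by exact_mod_cast hN
  have hT1R : (s : ℝ) * T ≤ A * N := by exact_mod_cast hT1
  have hT2R : (A : ℝ) * N < s * T + s := by exact_mod_cast hT2
  have e1 : ∑ c, x c = s * T := by
    have := sum_load (ι := ι) (K := K) (t := t) (by omega) es0
    rw [h1] at this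
    simp only [hx]; exact_mod_cast this
  have e2 : (N : ℝ) * ∑ c, x c ^ 2 ≤ (s * T) ^ 2 + s ^ 2 * T * N := by
    simp only [hx]; exact_mod_cast h3
  have e3 : ∑ c, (x c - A) ^ 2 = ∑ c, x c ^ 2 - 2 * A * (s * T) + A ^ 2 * N := by
    rw [← e1]
    simp only [sub_sq, sum_add_distrib, sum_sub_distrib]
    rw [mul_sum]
    simp only [sum_const, card_univ, nsmul_eq_mul, hN']
    have : ∑ i, 2 * x i * (A : ℝ) = ∑ i, 2 * A * x i := sum_congr rfl fun _ _ => by ring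
    rw [this]; ring
  have e4 : (N : ℝ) * ∑ c, (x c - A) ^ 2 ≤ 2 * s * A * N ^ 2 := by
    have a1 : (N : ℝ) * ∑ c, (x c - A) ^ 2 ≤ (A * N - s * T) ^ 2 + s ^ 2 * T * N := by
      rw [e3]; nlinarith
    have a2 : ((A : ℝ) * N - s * T) ^ 2 ≤ s ^ 2 := pow_le_pow_left₀ (by linarith) (by linarith) 2
    have a3 : (s : ℝ) ^ 2 ≤ s * A * N ^ 2 := by
      calc (s : ℝ) ^ 2 = s * 1 * s := by ring
        _ ≤ s * A * N ^ 2 := by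
          gcongr
          nlinarith
    have a4 : (s : ℝ) ^ 2 * T * N ≤ s * A * N ^ 2 := by
      calc (s : ℝ) ^ 2 * T * N = s * N * (s * T) := by ring
        _ ≤ s * N * (A * N) := by gcongr
        _ = _ := by ring
    linarith
  have e5 : ((O : ℝ)) ^ 2 ≤ 2 * s * A * N ^ 2 := by
    refine le_trans ?_ e4
    have : (O : ℝ) = ∑ c, ((load K t es0 c - A : ℕ) : ℝ) := by rw [hO]; push_cast; rfl
    rw [this]
    refine (sq_sum_le_card_mul_sum_sq).trans ?_
    rw [card_univ]
    refine mul_le_mul_of_nonneg_left (sum_le_sum fun c _ => ?_) (by positivity)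
    rcases le_total A (load K t es0 c) with h | h
    · rw [Nat.cast_sub h]
    · rw [Nat.sub_eq_zero_of_le h]; simp; positivity
  have e6 : (s : ℝ) * O ≤ ζ / 2 * A * N := by
    refine abs_le_of_sq_le_sq' ?_ (by positivity) |>.2
    calc ((s : ℝ) * O) ^ 2 = (s : ℝ) ^ 2 * (O : ℝ) ^ 2 := by ring
      _ ≤ (s : ℝ) ^ 2 * (2 * s * A * (N : ℝ) ^ 2) := by gcongr
      _ = 8 * (s : ℝ) ^ 3 * ((A : ℝ) * (N : ℝ) ^ 2 / 4) := by ring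
      _ ≤ ζ ^ 2 * A * ((A : ℝ) * (N : ℝ) ^ 2 / 4) := by gcongr
      _ = _ := by ring
  have e7 : (T : ℝ) ≤ es.length + O := by
    rw [h1] at g3; exact_mod_cast g3
  have e8 : (s : ℝ) * T ≤ s * (es.length + O) := by gcongr
  have e9 : (s : ℝ) ≤ ζ / 2 * A * N := by nlinarith
  nlinarith

end PartD3

set_option linter.unusedSectionVars false
set_option linter.unusedVariables false
set_option linter.unusedSimpArgs false

section PartD4
open scoped Classical

/-- A tile: a complete `(K+1)`-partite piece of the shadow with prescribed part sizes. -/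
structure Tile {V : Type} [DecidableEq V] (sh : Finset V → Prop) (K t b : ℕ)
    (T : Fin (K + 1) → Finset V) : Prop where
  card : ∀ i, (T i).card = wt K t i * b
  dis : ∀ i j, i ≠ j → Disjoint (T i) (T j)
  tr : ∀ x : Fin (K + 1) → V, (∀ i, x i ∈ T i) → sh (univ.image x)

/-- union of the parts -/
def un {V : Type} [DecidableEq V] {K : ℕ} (T : Fin (K + 1) → Finset V) : Finset V :=
  univ.biUnion T

lemma sub_un {V : Type} [DecidableEq V] {K : ℕ} (T : Fin (K + 1) → Finset V) (i) : T i ⊆ un T :=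
  subset_biUnion_of_mem T (mem_univ i)

/-- disjoint tiles -/
def TD {V : Type} [DecidableEq V] {K : ℕ} (T T' : Fin (K + 1) → Finset V) : Prop :=
  Disjoint (un T) (un T')

variable {V : Type} [Fintype V] [DecidableEq V]

lemma Tile.card_un {sh : Finset V → Prop} {K t b : ℕ} {T : Fin (K + 1) → Finset V}
    (h : Tile sh K t b T) (ht : 1 ≤ t) : (un T).card = K * t * b := by
  rw [un, card_biUnion fun i _ j _ hij => h.dis i j hij]
  simp only [h.card]
  rw [← sum_mul, sum_wt ht]

lemma card_uns {sh : Finset V → Prop} {K t b : ℕ} (ht : 1 ≤ t)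
    (ts : List (Fin (K + 1) → Finset V)) (h1 : ∀ T ∈ ts, Tile sh K t b T) (h2 : ts.Pairwise TD) :
    (ts.toFinset.biUnion un).card = K * t * b * ts.length ∧
      ∀ T, (∀ T' ∈ ts, TD T T') → Disjoint (un T) (ts.toFinset.biUnion un) := by
  have hd : ∀ (ts : List (Fin (K + 1) → Finset V)) T, (∀ T' ∈ ts, TD T T') →
      Disjoint (un T) (ts.toFinset.biUnion un) := by
    intro ts T hT
    rw [disjoint_biUnion_right]
    intro T' hT'
    exact hT T' (by simpa using hT')
  refine ⟨?_, hd ts⟩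
  induction ts with
  | nil => simp
  | cons T ts ih =>
    rw [List.pairwise_cons] at h2
    have := ih (fun T hT => h1 T (by simp [hT])) h2.2
    rw [List.toFinset_cons, biUnion_insert, card_union_of_disjoint (hd ts T h2.1), this,
      (h1 T (by simp)).card_un ht]
    simp; ring

/-- number of transversals meeting a set in a given coordinate -/
lemma card_hit {j : ℕ} {Y : Fin (j + 1) → Finset V} {β z : ℕ} (hY : ∀ i, (Y i).card ≤ β)
    (Z : Finset V) (i : Fin (j + 1)) (hz : (Y i ∩ Z).card ≤ z) :
    ((Fintype.piFinset Y).filter fun x => x i ∈ Z).card ≤ z * β ^ j := by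
  have h1 : (Fintype.piFinset Y).filter (fun x => x i ∈ Z) ⊆
      Fintype.piFinset (Function.update Y i (Y i ∩ Z)) := by
    intro x hx
    rw [mem_filter, Fintype.mem_piFinset] at hx
    rw [Fintype.mem_piFinset]
    intro i'
    by_cases h : i' = i
    · subst h; simp [hx.1 i', hx.2]
    · simp [h, hx.1 i']
  refine (card_le_card h1).trans ?_
  rw [Fintype.card_piFinset, Fin.prod_univ_succAbove _ i]
  simp only [Function.update_self]
  refine Nat.mul_le_mul hz ?_
  calc _ ≤ ∏ _i : Fin j, β := by
        refine prod_le_prod' fun i' _ => ?_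
        simp [Fin.succAbove_ne, hY]
    _ = _ := by simp

/-- Extract disjoint tiles along a list of dense edges with bounded loads. -/
lemma extract {ι : Type} [Fintype ι] {sh : Finset V → Prop} {K t b β A h B : ℕ} {c : ℝ}
    (hc : 0 < c) {C : ι → Finset V}
    (hdis : ∀ a a', a ≠ a' → Disjoint (C a) (C a')) (hC : ∀ a, (C a).card = β)
    (hB : ∀ i, wt K t i * b ≤ B) (hβ : β = A * h * b) (hh : 2 * (K + 1 : ℝ) ≤ c * h)
    (hk : ∀ Y : Fin (K + 1) → Finset V, (∀ i, (Y i).card ≤ β) →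
      ∀ P : (Fin (K + 1) → V) → Prop,
        c / 2 * (β : ℝ) ^ (K + 1) ≤ (((Fintype.piFinset Y).filter P).card : ℝ) →
        ∃ Z : Fin (K + 1) → Finset V, (∀ i, Z i ⊆ Y i ∧ (Z i).card = B) ∧
          ∀ x : Fin (K + 1) → V, (∀ i, x i ∈ Z i) → P x)
    (es : List (Fin (K + 1) → ι))
    (he : ∀ e ∈ es, Function.Injective e ∧ c * (β : ℝ) ^ (K + 1) ≤ cnt sh C e)
    (hl : ∀ a, load K t es a ≤ A) :
    ∃ (ts : List (Fin (K + 1) → Finset V)) (Z : Finset V), ts.length = es.length ∧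
      (∀ T ∈ ts, Tile sh K t b T ∧ un T ⊆ Z) ∧ ts.Pairwise TD ∧
      ∀ a, (C a ∩ Z).card ≤ load K t es a * b := by
  induction es with
  | nil => exact ⟨[], ∅, rfl, by simp, by simp, by simp⟩
  | cons e es ih =>
    have hload : ∀ a, load K t (e :: es) a = lw K t e a + load K t es a := fun a => by simp [load]
    obtain ⟨ts, Z, h1, h2, h3, h4⟩ := ih (fun e' he' => he e' (by simp [he']))
      (fun a => by have := hl a; rw [hload] at this; omega)
    obtain ⟨hinj, hcnt⟩ := he e (by simp)
    have hZ : ∀ a, (C a ∩ Z).card ≤ A * b := fun a => (h4 a).trans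
      (Nat.mul_le_mul_right _ (by have := hl a; rw [hload] at this; omega))
    let Y : Fin (K + 1) → Finset V := fun i => C (e i) \ Z
    have hcov : (Fintype.piFinset fun i => C (e i)).filter (fun x => sh (univ.image x)) ⊆
        ((Fintype.piFinset Y).filter fun x => sh (univ.image x)) ∪
        univ.biUnion fun i => (Fintype.piFinset fun i => C (e i)).filter fun x => x i ∈ Z := by
      intro x hx
      rw [mem_filter, Fintype.mem_piFinset] at hx
      by_cases hxZ : ∃ i, x i ∈ Z
      · obtain ⟨i, hi⟩ := hxZ
        apply mem_union_right
        rw [mem_biUnion]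
        exact ⟨i, mem_univ _, mem_filter.2 ⟨Fintype.mem_piFinset.2 hx.1, hi⟩⟩
      · push Not at hxZ
        apply mem_union_left
        rw [mem_filter, Fintype.mem_piFinset]
        exact ⟨fun i => mem_sdiff.2 ⟨hx.1 i, hxZ i⟩, hx.2⟩
    have hle := (card_le_card hcov).trans (card_union_le _ _)
    have hle2 : (univ.biUnion fun i => (Fintype.piFinset fun i => C (e i)).filter
        fun x => x i ∈ Z).card ≤ (K + 1) * (A * b * β ^ K) := by
      refine card_biUnion_le.trans ?_
      refine (sum_le_card_nsmul _ _ (A * b * β ^ K) fun i _ => ?_).trans ?_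
      · exact card_hit (fun i => (hC _).le) Z i (hZ _)
      · simp
    have hdense : c / 2 * (β : ℝ) ^ (K + 1) ≤
        (((Fintype.piFinset Y).filter fun x => sh (univ.image x)).card : ℝ) := by
      have a1 : (cnt sh C e : ℝ) ≤ (((Fintype.piFinset Y).filter fun x => sh (univ.image x)).card : ℝ)
          + (K + 1) * (A * b * β ^ K) := by
        have := hle.trans (Nat.add_le_add_left hle2 _)
        unfold cnt
        exact_mod_cast this
      have a2 : ((K : ℝ) + 1) * (A * b * β ^ K) ≤ c / 2 * (β : ℝ) ^ (K + 1) := by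
        have : (β : ℝ) = A * h * b := by exact_mod_cast hβ
        calc ((K : ℝ) + 1) * (A * b * β ^ K) ≤ (c * h / 2) * (A * b * β ^ K) := by
              gcongr; linarith
          _ = c / 2 * ((β : ℝ) ^ K * (A * h * b)) := by ring
          _ = _ := by rw [← this, pow_succ]
      linarith
    obtain ⟨Z', hZ'1, hZ'2⟩ := hk Y (fun i => (card_le_card sdiff_subset).trans (hC _).le) _ hdense
    have : ∀ i, ∃ S ⊆ Z' i, S.card = wt K t i * b := fun i =>
      exists_subset_card_eq (by rw [(hZ'1 i).2]; exact hB i)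
    choose T hT1 hT2 using this
    have hTC : ∀ i, T i ⊆ C (e i) := fun i => ((hT1 i).trans (hZ'1 i).1).trans sdiff_subset
    have hTZ : ∀ i, Disjoint (T i) Z := fun i => by
      refine disjoint_of_subset_left ((hT1 i).trans (hZ'1 i).1) ?_
      exact sdiff_disjoint
    have hTile : Tile sh K t b T := by
      refine ⟨hT2, fun i j hij => ?_, fun x hx => hZ'2 x fun i => hT1 i (hx i)⟩
      exact disjoint_of_subset_left (hTC i) (disjoint_of_subset_right (hTC j)
        (hdis _ _ fun h => hij (hinj h)))
    refine ⟨T :: ts, Z ∪ un T, by simp [h1], ?_, ?_, ?_⟩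
    · intro T' hT'
      rcases List.mem_cons.1 hT' with rfl | hT'
      · exact ⟨hTile, subset_union_right⟩
      · exact ⟨(h2 T' hT').1, (h2 T' hT').2.trans subset_union_left⟩
    · rw [List.pairwise_cons]
      refine ⟨fun T' hT' => ?_, h3⟩
      refine disjoint_of_subset_right (h2 T' hT').2 ?_
      rw [un, disjoint_biUnion_left]
      exact fun i _ => hTZ i
    · intro a
      have h5 : C a ∩ (Z ∪ un T) ⊆ (C a ∩ Z) ∪ univ.biUnion fun i => if e i = a then T i else ∅ := by
        intro v hv
        rw [mem_inter, mem_union] at hv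
        rcases hv.2 with hvZ | hvT
        · exact mem_union_left _ (mem_inter.2 ⟨hv.1, hvZ⟩)
        · apply mem_union_right
          obtain ⟨i, -, hi⟩ := mem_biUnion.1 hvT
          rw [mem_biUnion]
          refine ⟨i, mem_univ _, ?_⟩
          have : e i = a := by
            by_contra hne
            exact disjoint_left.1 (hdis _ _ hne) (hTC i hi) hv.1
          rw [if_pos this]; exact hi
      refine (card_le_card h5).trans ((card_union_le _ _).trans ?_)
      rw [hload, add_mul, add_comm]
      refine Nat.add_le_add ?_ (h4 a)
      refine card_biUnion_le.trans ?_
      rw [lw, sum_mul]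
      refine sum_le_sum fun i _ => ?_
      split_ifs <;> simp [hT2]

/-- split a large complete multipartite piece into small tiles -/
lemma split_tile {sh : Finset V → Prop} {K t b : ℕ} (m : ℕ) :
    ∀ T : Fin (K + 1) → Finset V, (∀ i, wt K t i * (m * b) ≤ (T i).card) →
    (∀ i j, i ≠ j → Disjoint (T i) (T j)) →
    (∀ x : Fin (K + 1) → V, (∀ i, x i ∈ T i) → sh (univ.image x)) →
    ∃ ts : List (Fin (K + 1) → Finset V), ts.length = m ∧
      (∀ T' ∈ ts, Tile sh K t b T' ∧ un T' ⊆ un T) ∧ ts.Pairwise TD := by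
  induction m with
  | zero => intro T _ _ _; exact ⟨[], rfl, by simp, by simp⟩
  | succ m ih =>
    intro T hc hd htr
    have : ∀ i, ∃ S ⊆ T i, S.card = wt K t i * b := fun i =>
      exists_subset_card_eq (le_trans (Nat.mul_le_mul_left _ (by nlinarith)) (hc i))
    choose T0 h1 h2 using this
    obtain ⟨ts, g1, g2, g3⟩ := ih (fun i => T i \ T0 i) (fun i => by
        rw [card_sdiff_of_subset (h1 i), h2]
        have := hc i
        have e : wt K t i * ((m + 1) * b) = wt K t i * (m * b) + wt K t i * b := by ring
        omega)
      (fun i j hij => disjoint_of_subset_left sdiff_subset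
        (disjoint_of_subset_right sdiff_subset (hd i j hij)))
      (fun x hx => htr x fun i => sdiff_subset (hx i))
    refine ⟨T0 :: ts, by simp [g1], ?_, ?_⟩
    · intro T' hT'
      rcases List.mem_cons.1 hT' with rfl | hT'
      · refine ⟨⟨h2, fun i j hij => disjoint_of_subset_left (h1 i)
          (disjoint_of_subset_right (h1 j) (hd i j hij)), fun x hx => htr x fun i => h1 i (hx i)⟩,
          biUnion_mono fun i _ => h1 i⟩
      · exact ⟨(g2 T' hT').1, (g2 T' hT').2.trans (biUnion_mono fun i _ => sdiff_subset)⟩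
    · rw [List.pairwise_cons]
      refine ⟨fun T' hT' => ?_, g3⟩
      refine disjoint_of_subset_right (g2 T' hT').2 ?_
      rw [un, un, disjoint_biUnion_left]
      intro i _
      rw [disjoint_biUnion_right]
      intro j _
      by_cases hij : i = j
      · subst hij; exact disjoint_sdiff
      · exact disjoint_of_subset_left (h1 i) (disjoint_of_subset_right sdiff_subset (hd i j hij))

/-- chop a set into cells -/
lemma chop (β m : ℕ) : ∀ S : Finset V, m * β ≤ S.card →
    ∃ f : Fin m → Finset V, (∀ a, f a ⊆ S ∧ (f a).card = β) ∧
      ∀ a a', a ≠ a' → Disjoint (f a) (f a') := by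
  induction m with
  | zero => intro S _; exact ⟨fun a => a.elim0, fun a => a.elim0, fun a => a.elim0⟩
  | succ m ih =>
    intro S hS
    obtain ⟨S0, h1, h2⟩ := exists_subset_card_eq (s := S) (n := β) (by nlinarith)
    obtain ⟨f, g1, g2⟩ := ih (S \ S0) (by
      rw [card_sdiff_of_subset h1, h2]
      have : (m + 1) * β = m * β + β := by ring
      omega)
    refine ⟨Fin.cons S0 f, ?_, ?_⟩
    · intro a
      refine Fin.cases ?_ (fun a => ?_) a
      · simpa using ⟨h1, h2⟩
      · simpa using ⟨(g1 a).1.trans sdiff_subset, (g1 a).2⟩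
    · intro a a'
      refine Fin.cases ?_ (fun a => ?_) a
      · refine Fin.cases ?_ (fun a' => ?_) a'
        · intro h; exact absurd rfl h
        · intro _
          simp only [Fin.cons_zero, Fin.cons_succ]
          exact disjoint_of_subset_right (g1 a').1 disjoint_sdiff
      · refine Fin.cases ?_ (fun a' => ?_) a'
        · intro _
          simp only [Fin.cons_zero, Fin.cons_succ]
          exact disjoint_of_subset_left (g1 a).1 sdiff_disjoint
        · intro h
          simp only [Fin.cons_succ]
          exact g2 a a' fun e => h (by rw [e])

end PartD4

set_option linter.unusedSectionVars false
set_option linter.unusedVariables false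
set_option linter.unusedSimpArgs false

section PartD5
open scoped Classical

/-- almost perfect tilings with leftover proportion `lam` exist at every scale -/
def TP (K t : ℕ) (α lam : ℝ) : Prop :=
  ∀ b : ℕ, 1 ≤ b → ∃ n1 : ℕ, ∀ (V : Type) [Fintype V] [DecidableEq V] (sh : Finset V → Prop),
    Sys sh (K + 1) t α → n1 ≤ Fintype.card V →
    ∃ ts : List (Fin (K + 1) → Finset V), (∀ T ∈ ts, Tile sh K t b T) ∧ ts.Pairwise TD ∧
      (Fintype.card V : ℝ) ≤ ((K * t : ℕ) : ℝ) * b * ts.length + lam * Fintype.card V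

lemma tp_one (K t : ℕ) (α : ℝ) : TP K t α 1 := by
  intro b _
  refine ⟨0, fun V _ _ sh _ _ => ⟨[], by simp, by simp, by simp⟩⟩

lemma wt_le {K t : ℕ} (i : Fin (K + 1)) : wt K t i ≤ K + t := by
  unfold wt; split_ifs <;> omega

lemma step_arith {n N s b A h r w e : ℝ} {ζ lam β : ℝ} (hζ : 0 < ζ) (hh : 1 ≤ h)
    (hβ : β = A * h * b) (hb : 0 ≤ b) (hN : N = r * s + w)
    (h1 : n ≤ N * β + β) (h2 : N * β ≤ n) (h3 : (1 - ζ) * (A * N) ≤ s * e)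
    (h4 : n ≤ s * β * r + lam * n) (h5 : β ≤ ζ * n) (hn : 0 ≤ n) :
    n ≤ s * b * (e + r * (A * (h - 1))) + (lam * (1 - 1 / h) + 2 * ζ) * n := by
  have hh0 : 0 < h := by linarith
  have a1 : b * ((1 - ζ) * (A * N)) ≤ b * (s * e) := mul_le_mul_of_nonneg_left h3 hb
  -- multiply everything by `h`
  refine le_of_mul_le_mul_right ?_ hh0
  have e1 : (s * b * (e + r * (A * (h - 1))) + (lam * (1 - 1 / h) + 2 * ζ) * n) * h =
      h * (b * (s * e)) + s * r * (A * h * b) * (h - 1) + lam * n * (h - 1) + 2 * ζ * n * h := by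
    field_simp
    ring
  rw [e1]
  have a2 : h * (b * ((1 - ζ) * (A * N))) ≤ h * (b * (s * e)) := mul_le_mul_of_nonneg_left a1 hh0.le
  have e2 : h * (b * ((1 - ζ) * (A * N))) = (1 - ζ) * (N * β) := by rw [hβ]; ring
  rw [← hβ]
  have a3 : (n - lam * n) * (h - 1) ≤ (s * β * r) * (h - 1) :=
    mul_le_mul_of_nonneg_right (by linarith) (by linarith)
  have a4 : ζ * (N * β) ≤ ζ * n := mul_le_mul_of_nonneg_left h2 hζ.le
  have a5 : ζ * n * 1 ≤ ζ * n * h := mul_le_mul_of_nonneg_left hh (by positivity)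
  nlinarith

lemma tp_step {K t h : ℕ} {α ζ lam : ℝ} (hK : 1 ≤ K) (ht : 2 ≤ t) (hα : 0 < α) (hζ : 0 < ζ)
    (hh1 : 1 ≤ h) (hh : 2 * (K + 1 : ℝ) ≤ (α / 4) ^ K * h) (H : TP K t α lam) :
    TP K t α (lam * (1 - 1 / h) + 2 * ζ) := by
  intro b hb
  set c : ℝ := (α / 4) ^ K with hcdef
  have hc : 0 < c := by positivity
  obtain ⟨β0, hβ0⟩ := kst ((K + t) * b) (K + 1) (c / 2) (by positivity)
  obtain ⟨A1, hA1⟩ := exists_nat_ge (8 * ((K * t : ℕ) : ℝ) ^ 3 / ζ ^ 2)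
  obtain ⟨A2, hA2⟩ := exists_nat_ge (2 / ζ)
  obtain ⟨A, hA⟩ : ∃ A : ℕ, A = β0 + A1 + A2 + 1 := ⟨_, rfl⟩
  obtain ⟨β, hβ⟩ : ∃ β : ℕ, β = A * h * b := ⟨_, rfl⟩
  have hAβ : A ≤ β := by
    rw [hβ, mul_assoc]
    exact Nat.le_mul_of_pos_right _ (Nat.mul_pos hh1 hb)
  have hβpos : 0 < β := by omega
  obtain ⟨n1, hn1⟩ := H β hβpos
  obtain ⟨N1, hN1⟩ := exists_nat_ge ((K + 1 + 1 : ℝ) / (3 * α / 4))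
  obtain ⟨n2, hn2⟩ := exists_nat_ge ((β : ℝ) / ζ)
  refine ⟨n1 + n2 + β * (N1 + K * t + 2), fun V _ _ sh S hV => ?_⟩
  have hbase : 0 < β * (N1 + K * t + 2) := by positivity
  set n := Fintype.card V with hn
  obtain ⟨ts, ht1, ht2, ht3⟩ := hn1 V sh S (by omega)
  set r := ts.length with hr
  set W := univ \ ts.toFinset.biUnion un with hW
  have hun := card_uns (by omega) ts ht1 ht2
  have hWc : W.card + K * t * β * r = n := by
    have hu1 : (ts.toFinset.biUnion un).card = K * t * β * r := hun.1
    have hu2 : (ts.toFinset.biUnion un).card ≤ n := card_le_univ _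
    rw [hW, card_sdiff_of_subset (subset_univ _), hu1, card_univ]
    rw [hu1] at hu2
    omega
  have hmem : ∀ τ : Fin r, ts[τ] ∈ ts := fun τ => List.getElem_mem _
  obtain ⟨fW, hfW1, hfW2⟩ := chop β (W.card / β) W (Nat.div_mul_le_self _ _)
  have hcell : ∀ (τ : Fin r) (i : Fin (K + 1)), ∃ f : Fin (wt K t i) → Finset V,
      (∀ a, f a ⊆ ts[τ] i ∧ (f a).card = β) ∧ ∀ a a', a ≠ a' → Disjoint (f a) (f a') := by
    intro τ i
    apply chop
    exact ((ht1 ts[τ] (hmem τ)).card i).ge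
  choose f hf1 hf2 using hcell
  let ι := (Fin r × (Σ i : Fin (K + 1), Fin (wt K t i))) ⊕ Fin (W.card / β)
  let C : ι → Finset V := fun a => match a with
    | Sum.inl p => f p.1 p.2.1 p.2.2
    | Sum.inr a => fW a
  have hC : ∀ a, (C a).card = β := by
    rintro (⟨τ, i, a⟩ | a)
    · exact (hf1 τ i a).2
    · exact (hfW1 a).2
  have hWd : ∀ τ : Fin r, Disjoint (un ts[τ]) W := by
    intro τ
    rw [hW]
    refine disjoint_of_subset_left ?_ disjoint_sdiff
    exact subset_biUnion_of_mem un (by simp)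
  have htsd : ∀ τ τ' : Fin r, τ ≠ τ' → TD ts[τ] ts[τ'] := by
    intro τ τ' hne
    rw [List.pairwise_iff_getElem] at ht2
    rcases lt_or_gt_of_ne hne with h | h
    · exact ht2 τ τ' τ.2 τ'.2 h
    · exact (ht2 τ' τ τ'.2 τ.2 h).symm
  have hdis : ∀ a a', a ≠ a' → Disjoint (C a) (C a') := by
    rintro (⟨τ, i, a⟩ | a) (⟨τ', i', a'⟩ | a') hne
    · by_cases h1 : τ = τ'
      · subst h1
        by_cases h2 : i = i'
        · subst h2
          exact hf2 τ i a a' fun e => hne (by rw [e])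
        · exact disjoint_of_subset_left (hf1 τ i a).1 (disjoint_of_subset_right (hf1 τ i' a').1
            ((ht1 _ (List.getElem_mem _)).dis i i' h2))
      · exact disjoint_of_subset_left ((hf1 τ i a).1.trans (sub_un _ _))
          (disjoint_of_subset_right ((hf1 τ' i' a').1.trans (sub_un _ _)) (htsd τ τ' h1))
    · exact disjoint_of_subset_left ((hf1 τ i a).1.trans (sub_un _ _))
        (disjoint_of_subset_right (hfW1 a').1 (hWd τ))
    · exact (disjoint_of_subset_left ((hf1 τ' i' a').1.trans (sub_un _ _))
        (disjoint_of_subset_right (hfW1 a).1 (hWd τ'))).symm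
    · exact hfW2 a a' fun e => hne (by rw [e])
  have hcardι : Fintype.card ι = r * (K * t) + W.card / β := by
    simp only [ι, Fintype.card_sum, Fintype.card_prod, Fintype.card_sigma, Fintype.card_fin]
    rw [sum_wt (by omega)]
  have hnN : n ≤ Fintype.card ι * β + β := by
    rw [hcardι]
    have h1 := Nat.div_add_mod W.card β
    have h2 := Nat.mod_lt W.card hβpos
    have e : (r * (K * t) + W.card / β) * β = K * t * β * r + β * (W.card / β) := by ring
    omega
  have hNn : Fintype.card ι * β ≤ n := by
    rw [← cells_le hdis hC]; exact card_le_univ _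
  have hNbig : N1 + K * t + 1 ≤ Fintype.card ι := by
    by_contra hcon
    have : (Fintype.card ι + 1) * β ≤ (N1 + K * t + 1) * β := Nat.mul_le_mul_right _ (by omega)
    have e1 : (Fintype.card ι + 1) * β = Fintype.card ι * β + β := by ring
    have e2 : β * (N1 + K * t + 2) = (N1 + K * t + 1) * β + β := by ring
    omega
  have : Nonempty ι := Fintype.card_pos_iff.1 (by omega)
  have hNR : ((K + 1 : ℕ) + 1 : ℝ) ≤ 3 * α / 4 * Fintype.card ι := by
    rw [div_le_iff₀ (by positivity)] at hN1
    have : (N1 : ℝ) ≤ Fintype.card ι := by exact_mod_cast (by omega : N1 ≤ Fintype.card ι)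
    have := mul_le_mul_of_nonneg_right this (show 0 ≤ 3 * α / 4 by positivity)
    push_cast; linarith
  have hA1' : 8 * ((K * t : ℕ) : ℝ) ^ 3 ≤ ζ ^ 2 * A := by
    rw [div_le_iff₀ (by positivity)] at hA1
    have : (A1 : ℝ) ≤ A := by exact_mod_cast (by omega : A1 ≤ A)
    have := mul_le_mul_of_nonneg_right this (show 0 ≤ ζ ^ 2 by positivity)
    linarith
  have hA2' : 2 ≤ ζ * A := by
    rw [div_le_iff₀ hζ] at hA2
    have : (A2 : ℝ) ≤ A := by exact_mod_cast (by omega : A2 ≤ A)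
    have := mul_le_mul_of_nonneg_right this hζ.le
    linarith
  obtain ⟨es, he1, he2, he3⟩ := loads (ι := ι) hK ht
    (Q := fun e => Function.Injective e ∧ c * (β : ℝ) ^ (K + 1) ≤ cnt sh C e)
    (fun L hL a => by
      obtain ⟨e, q1, q2, q3, q4⟩ := pick ht hα S hdis hβpos hC hnN hNR L hL a K (by omega)
      exact ⟨e, ⟨q1, q4⟩, q2, q3⟩)
    hζ hA1' hA2' (by omega)
  obtain ⟨ts1, Z, x1, x2, x3, x4⟩ := extract (b := b) (B := (K + t) * b) hc hdis hC
    (fun i => Nat.mul_le_mul_right _ (wt_le i)) hβ hh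
    (fun Y hY P hP => by
      obtain ⟨Z, hZ⟩ := hβ0 β (by omega) V Y hY P (by convert hP)
      exact ⟨Z, hZ⟩) es he1 he2
  have hsplit : ∀ T ∈ ts, ∃ l : List (Fin (K + 1) → Finset V), l.length = A * (h - 1) ∧
      (∀ T' ∈ l, Tile sh K t b T' ∧ un T' ⊆ un (fun i => T i \ Z)) ∧ l.Pairwise TD := by
    intro T hT
    obtain ⟨τ0, hτ0, rfl⟩ := List.getElem_of_mem hT
    refine split_tile (A * (h - 1)) _ (fun i => ?_)
      (fun i j hij => disjoint_of_subset_left sdiff_subset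
        (disjoint_of_subset_right sdiff_subset ((ht1 _ hT).dis i j hij)))
      (fun x hx => (ht1 _ hT).tr x fun i => sdiff_subset (hx i))
    set τ : Fin r := ⟨τ0, hτ0⟩ with hτ
    have hcov : ts[τ] i ∩ Z ⊆ univ.biUnion fun a => f τ i a ∩ Z := by
      have : univ.biUnion (f τ i) = ts[τ] i := by
        refine eq_of_subset_of_card_le (biUnion_subset.2 fun a _ => (hf1 τ i a).1) ?_
        rw [cells_le (hf2 τ i) (fun a => (hf1 τ i a).2)]
        rw [show (ts[τ] i).card = _ from (ht1 ts[τ] (hmem τ)).card i]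
        simp
      intro v hv
      rw [mem_inter, ← this, mem_biUnion] at hv
      obtain ⟨⟨a, ha, hva⟩, hvZ⟩ := hv
      exact mem_biUnion.2 ⟨a, ha, mem_inter.2 ⟨hva, hvZ⟩⟩
    have hle : (ts[τ] i ∩ Z).card ≤ wt K t i * (A * b) := by
      refine (card_le_card hcov).trans (card_biUnion_le.trans ?_)
      refine (sum_le_card_nsmul _ _ (A * b) fun a _ => ?_).trans (by simp)
      exact (x4 (Sum.inl (τ, ⟨i, a⟩))).trans (Nat.mul_le_mul_right _ (he2 _))
    have hcT := (ht1 _ hT).card i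
    change wt K t i * (A * (h - 1) * b) ≤ (ts[τ] i \ Z).card
    change (ts[τ] i).card = _ at hcT
    have hs := card_sdiff_add_card_inter (ts[τ] i) Z
    obtain ⟨g, rfl⟩ : ∃ g, h = g + 1 := ⟨h - 1, by omega⟩
    simp only [Nat.add_sub_cancel]
    have e : wt K t i * β = wt K t i * (A * g * b) + wt K t i * (A * b) := by rw [hβ]; ring
    omega
  choose! g hg1 hg2 hg3 using hsplit
  refine ⟨ts1 ++ ts.flatMap g, ?_, ?_, ?_⟩
  · intro T hT
    rcases List.mem_append.1 hT with hT | hT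
    · exact (x2 T hT).1
    · obtain ⟨T0, hT0, hT⟩ := List.mem_flatMap.1 hT
      exact (hg2 T0 hT0 T hT).1
  · rw [List.pairwise_append]
    refine ⟨x3, ?_, ?_⟩
    · rw [List.pairwise_flatMap]
      refine ⟨hg3, ht2.imp_of_mem ?_⟩
      intro T T' hT hT' hTT' T1 hT1 T1' hT1'
      refine disjoint_of_subset_left (((hg2 T hT T1 hT1).2).trans
        (biUnion_mono fun i _ => sdiff_subset)) ?_
      exact disjoint_of_subset_right (((hg2 T' hT' T1' hT1').2).trans
        (biUnion_mono fun i _ => sdiff_subset)) hTT'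
    · intro T hT T' hT'
      obtain ⟨T0, hT0, hT'⟩ := List.mem_flatMap.1 hT'
      refine disjoint_of_subset_left (x2 T hT).2 (disjoint_of_subset_right (hg2 T0 hT0 T' hT').2 ?_)
      rw [un, disjoint_biUnion_right]
      exact fun i _ => disjoint_sdiff
  · have hlen : (ts1 ++ ts.flatMap g).length = es.length + r * (A * (h - 1)) := by
      rw [List.length_append, x1, List.length_flatMap, List.map_congr_left hg1, List.map_const',
        List.sum_replicate]
      simp [hr]
    rw [hlen]
    have := step_arith (n := n) (N := Fintype.card ι) (s := ((K * t : ℕ) : ℝ)) (b := b) (A := A)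
      (h := h) (r := r) (w := ((W.card / β : ℕ) : ℝ)) (e := es.length) (ζ := ζ) (lam := lam)
      (β := β) hζ (by exact_mod_cast hh1) (by exact_mod_cast hβ) (by positivity)
      (by exact_mod_cast hcardι) (by exact_mod_cast hnN) (by exact_mod_cast hNn) he3 ht3
      (by
        rw [div_le_iff₀ hζ] at hn2
        have : (n2 : ℝ) ≤ n := by exact_mod_cast (by omega : n2 ≤ n)
        have := mul_le_mul_of_nonneg_right this hζ.le
        linarith) (by positivity)
    have e : ((es.length + r * (A * (h - 1)) : ℕ) : ℝ) = es.length + r * (A * ((h : ℝ) - 1)) := by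
      push_cast [Nat.cast_sub hh1]; ring
    rw [e]
    exact this

/-- almost perfect tilings -/
lemma tp_all {K t : ℕ} {α ε : ℝ} (hK : 1 ≤ K) (ht : 2 ≤ t) (hα : 0 < α) (hε : 0 < ε) :
    TP K t α ε := by
  obtain ⟨h0, hh0⟩ := exists_nat_ge (2 * (K + 1 : ℝ) / (α / 4) ^ K)
  set h := h0 + 1 with hh
  have hh1 : 2 * (K + 1 : ℝ) ≤ (α / 4) ^ K * h := by
    rw [div_le_iff₀ (by positivity)] at hh0
    have : (h : ℝ) = h0 + 1 := by rw [hh]; push_cast; rfl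
    rw [this]
    have : 0 < (α / 4) ^ K := by positivity
    linarith
  have hpos : (0 : ℝ) < h := by rw [hh]; positivity
  set ζ := ε / (4 * h) with hζ
  have hζ0 : 0 < ζ := by positivity
  have key : ∀ m : ℕ, TP K t α ((1 - 1 / h) ^ m + 2 * ζ * h) := by
    intro m
    induction m with
    | zero =>
      intro b hb
      obtain ⟨n1, hn1⟩ := tp_one K t α b hb
      refine ⟨n1, fun V _ _ sh S hV => ?_⟩
      obtain ⟨ts, a1, a2, a3⟩ := hn1 V sh S hV
      refine ⟨ts, a1, a2, a3.trans ?_⟩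
      have : 0 ≤ 2 * ζ * h * (Fintype.card V : ℝ) := by positivity
      simp only [pow_zero]
      linarith
    | succ m ih =>
      have := tp_step hK ht hα hζ0 (by omega) hh1 ih
      convert this using 1
      rw [pow_succ]; field_simp; ring
  have hlt : (1 - 1 / (h : ℝ)) < 1 := by
    have : 0 < 1 / (h : ℝ) := by positivity
    linarith
  have hnn : 0 ≤ (1 - 1 / (h : ℝ)) := by
    rw [sub_nonneg, div_le_one hpos]
    rw [hh]; push_cast; linarith [(Nat.cast_nonneg h0 : (0 : ℝ) ≤ h0)]
  obtain ⟨m, hm⟩ := exists_pow_lt_of_lt_one (show 0 < ε / 2 by positivity) hlt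
  have h2 : 2 * ζ * h = ε / 2 := by rw [hζ]; field_simp; ring
  intro b hb
  obtain ⟨n1, hn1⟩ := key m b hb
  refine ⟨n1, fun V _ _ sh S hV => ?_⟩
  obtain ⟨ts, a1, a2, a3⟩ := hn1 V sh S hV
  refine ⟨ts, a1, a2, a3.trans ?_⟩
  have : ((1 - 1 / (h : ℝ)) ^ m + 2 * ζ * h) * (Fintype.card V : ℝ) ≤ ε * Fintype.card V := by
    refine mul_le_mul_of_nonneg_right ?_ (by positivity)
    linarith
  linarith

end PartD5

set_option linter.unusedSectionVars false
set_option linter.unusedVariables false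
set_option linter.unusedSimpArgs false

section PartD6
open scoped Classical

/-- number of heavy positions before `p` -/
def hvN (d t p : ℕ) : ℕ := (p + t - d) / t

lemma hvN_mono {d t p p' : ℕ} (h : p ≤ p') : hvN d t p ≤ hvN d t p' :=
  Nat.div_le_div_right (by omega)

lemma hvN_succ {d t p : ℕ} (hd : 1 ≤ d) (hdt : d ≤ t) :
    hvN d t (p + 1) = if p % t = d - 1 then hvN d t p + 1 else hvN d t p := by
  unfold hvN
  have ht : 0 < t := by omega
  have h1 := Nat.div_add_mod p t
  have h2 := Nat.mod_lt p ht
  set m := p / t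
  set r := p % t
  split_ifs with h
  · have e1 : p + 1 + t - d = 0 + t * (m + 1) := by rw [mul_add]; omega
    have e2 : p + t - d = (t - 1) + t * m := by omega
    rw [e1, e2, Nat.add_mul_div_left _ _ ht, Nat.add_mul_div_left _ _ ht, Nat.zero_div,
      Nat.div_eq_of_lt (by omega)]
    omega
  · rcases Nat.lt_or_ge r d with h3 | h3
    · have e1 : p + 1 + t - d = (r + 1 + t - d) + t * m := by omega
      have e2 : p + t - d = (r + t - d) + t * m := by omega
      rw [e1, e2, Nat.add_mul_div_left _ _ ht, Nat.add_mul_div_left _ _ ht,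
        Nat.div_eq_of_lt (by omega), Nat.div_eq_of_lt (by omega)]
    · have e1 : p + 1 + t - d = (r + 1 - d) + t * (m + 1) := by rw [mul_add]; omega
      have e2 : p + t - d = (r - d) + t * (m + 1) := by rw [mul_add]; omega
      rw [e1, e2, Nat.add_mul_div_left _ _ ht, Nat.add_mul_div_left _ _ ht,
        Nat.div_eq_of_lt (by omega), Nat.div_eq_of_lt (by omega)]

lemma hvN_add {d t p : ℕ} (hd : 1 ≤ d) (hdt : d ≤ t) (j : ℕ) : hvN d t (p + j) ≤ hvN d t p + j := by
  induction j with
  | zero => simp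
  | succ j ih =>
    rw [← add_assoc, hvN_succ hd hdt]
    split_ifs <;> omega

lemma hvN_zero {d t : ℕ} (hd : 1 ≤ d) (hdt : d ≤ t) : hvN d t 0 = 0 := by
  unfold hvN
  exact Nat.div_eq_of_lt (by omega)

lemma hvN_mul {d t a : ℕ} (hd : 1 ≤ d) (hdt : d ≤ t) : hvN d t (t * a) = a := by
  unfold hvN
  rw [show t * a + t - d = (t - d) + t * a by omega, Nat.add_mul_div_left _ _ (by omega),
    Nat.div_eq_of_lt (by omega)]
  omega

lemma hvN_window {k d t : ℕ} (par : Par k d t) (i : ℕ) :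
    hvN d t (i * d + k) = hvN d t (i * d) + 1 := by
  obtain ⟨hd, ⟨q, rfl⟩, ht, htk, hkt⟩ := par
  have hq : 0 < q := by
    rcases Nat.eq_zero_or_pos q with h | h
    · subst h; omega
    · exact h
  have h1 := Nat.div_add_mod i q
  have h2 := Nat.mod_lt i hq
  set m := i / q
  set j := i % q
  have e : i * d = d * q * m + j * d := by rw [← h1]; ring
  have e3 : j * d + d ≤ d * q := by
    have : (j + 1) * d ≤ q * d := Nat.mul_le_mul_right _ h2
    nlinarith
  have hjd : j = 0 ∨ d ≤ j * d := by
    rcases Nat.eq_zero_or_pos j with h | h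
    · exact Or.inl h
    · exact Or.inr (Nat.le_mul_of_pos_left _ h)
  have ht0 : 0 < d * q := by omega
  unfold hvN
  rw [e]
  set t := d * q
  set jd := j * d with hjd'
  rcases hjd with h | h
  · have : jd = 0 := by rw [hjd', h]; simp
    rw [this]
    rw [show t * m + 0 + k + t - d = (k - d) + t * (m + 1) by rw [mul_add]; omega,
      show t * m + 0 + t - d = (t - d) + t * m by omega,
      Nat.add_mul_div_left _ _ ht0, Nat.add_mul_div_left _ _ ht0,
      Nat.div_eq_of_lt (by omega), Nat.div_eq_of_lt (by omega)]
    omega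
  · rw [show t * m + jd + k + t - d = (jd + k - d - t) + t * (m + 2) by rw [mul_add]; omega,
      show t * m + jd + t - d = (jd - d) + t * (m + 1) by rw [mul_add]; omega,
      Nat.add_mul_div_left _ _ ht0, Nat.add_mul_div_left _ _ ht0,
      Nat.div_eq_of_lt (by omega), Nat.div_eq_of_lt (by omega)]
    omega

/-- colour of a position -/
def colr (K d t : ℕ) (hK : 0 < K) (p : ℕ) : Fin (K + 1) :=
  if p % t = d - 1 then Fin.last K
  else Fin.castSucc ⟨(p - hvN d t p) % K, Nat.mod_lt _ hK⟩

/-- index of a position inside its part -/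
def cidx (K d t : ℕ) (p : ℕ) : ℕ :=
  if p % t = d - 1 then p / t else (p - hvN d t p) / K

lemma mod_ne {K a b : ℕ} (h : a < b) (h2 : b < a + K) : a % K ≠ b % K := by
  intro e
  have h3 : K ∣ b - a := (Nat.modEq_iff_dvd' h.le).1 e
  have := Nat.le_of_dvd (by omega) h3
  omega

lemma light_lt {d t p p' : ℕ} (hd : 1 ≤ d) (hdt : d ≤ t) (hp : p < p') (h : ¬ p % t = d - 1) :
    p - hvN d t p < p' - hvN d t p' := by
  have h1 := hvN_succ (p := p) hd hdt
  rw [if_neg h] at h1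
  have h2 := hvN_add (p := p + 1) hd hdt (p' - (p + 1))
  rw [show p + 1 + (p' - (p + 1)) = p' by omega] at h2
  have h3 := hvN_add (p := 0) hd hdt p
  rw [hvN_zero hd hdt, zero_add] at h3
  omega

lemma colr_ne {K d t i p p' : ℕ} (par : Par (K + 1) d t) (hK : 0 < K) (h1 : i * d ≤ p)
    (hp : p < p') (h2 : p' < i * d + (K + 1)) : colr K d t hK p ≠ colr K d t hK p' := by
  have hd := par.hd
  have hdt : d ≤ t := Nat.le_of_dvd (by have := par.ht; omega) par.hdt
  have hw := hvN_window par i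
  have s1 := hvN_succ (p := p) hd hdt
  have s2 := hvN_succ (p := p') hd hdt
  have m1 := hvN_mono (d := d) (t := t) h1
  have m2 := hvN_mono (d := d) (t := t) (show p' + 1 ≤ i * d + (K + 1) by omega)
  have m3 := hvN_mono (d := d) (t := t) (show p + 1 ≤ p' by omega)
  have z1 := hvN_add (p := 0) hd hdt p
  have z2 := hvN_add (p := 0) hd hdt p'
  rw [hvN_zero hd hdt, zero_add] at z1 z2
  unfold colr
  by_cases c1 : p % t = d - 1 <;> by_cases c2 : p' % t = d - 1
  · rw [if_pos c1] at s1; rw [if_pos c2] at s2; omega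
  · rw [if_pos c1, if_neg c2]; exact (Fin.castSucc_lt_last _).ne'
  · rw [if_neg c1, if_pos c2]; exact (Fin.castSucc_lt_last _).ne
  · rw [if_neg c1, if_neg c2]
    have hl := light_lt hd hdt hp c1
    rw [if_neg c1] at s1; rw [if_neg c2] at s2
    intro e
    have e2 := congrArg Fin.val e
    simp only [Fin.val_castSucc] at e2
    refine mod_ne hl ?_ e2
    rcases Nat.lt_or_ge (p' - p) K with h | h
    · omega
    · have : p = i * d := by omega
      have : p' + 1 = i * d + (K + 1) := by omega
      simp_all
      omega

variable {V : Type} [Fintype V] [DecidableEq V]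

lemma enum_set [Nonempty V] (A : Finset V) :
    ∃ e : ℕ → V, (∀ j < A.card, e j ∈ A) ∧ ∀ j < A.card, ∀ j' < A.card, e j = e j' → j = j' := by
  refine ⟨fun j => if h : j < A.card then (A.equivFin.symm ⟨j, h⟩ : V) else Classical.arbitrary V,
    ?_, ?_⟩
  · intro j hj
    simp [hj]
  · intro j hj j' hj' h
    simp only [hj, hj', dif_pos] at h
    have := A.equivFin.symm.injective (Subtype.ext h)
    simpa using this

lemma tile_path {sh : Finset V → Prop} {K d t b : ℕ} {T : Fin (K + 1) → Finset V}
    (par : Par (K + 1) d t) (mono : ∀ S T, S ⊆ T → sh T → sh S) (hb : 1 ≤ b) (hK : 0 < K)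
    (hT : Tile sh K t b T) :
    ∃ l : List V, l.length = K * t * b ∧ l.Nodup ∧ (∀ v ∈ l, v ∈ un T) ∧ Good sh (K + 1) d l := by
  have hd := par.hd
  have ht := par.ht
  have hdt : d ≤ t := Nat.le_of_dvd (by omega) par.hdt
  have hwt : ∀ i, 0 < wt K t i * b := by
    intro i
    refine Nat.mul_pos ?_ hb
    unfold wt; split_ifs <;> omega
  have hne : Nonempty V := by
    have := hwt (Fin.last K)
    rw [← hT.card] at this
    exact ⟨(card_pos.1 this).choose⟩
  choose e he1 he2 using fun i => enum_set (T i)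
  simp only [hT.card] at he1 he2
  let φ : ℕ → V := fun p => e (colr K d t hK p) (cidx K d t p)
  have hlen : K * t * b = t * (K * b) := by ring
  have hlt : ∀ p < K * t * b, cidx K d t p < wt K t (colr K d t hK p) * b := by
    intro p hp
    unfold cidx colr
    by_cases c : p % t = d - 1
    · rw [if_pos c, if_pos c, wt, if_pos rfl, Nat.div_lt_iff_lt_mul (by omega)]
      linarith [hlen, mul_comm t (K * b)]
    · rw [if_neg c, if_neg c, wt, if_neg (Fin.castSucc_lt_last _).ne, Nat.div_lt_iff_lt_mul hK]
      have h1 := light_lt hd hdt hp c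
      have h2 : hvN d t (K * t * b) = K * b := by rw [hlen, hvN_mul hd hdt]
      rw [h2] at h1
      have h3 : K * t * b - K * b = (t - 1) * b * K := by
        obtain ⟨s, rfl⟩ : ∃ s, t = s + 1 := ⟨t - 1, by omega⟩
        simp only [Nat.add_sub_cancel]
        rw [show K * (s + 1) * b = s * b * K + K * b by ring]
        omega
      omega
  have hmemT : ∀ p < K * t * b, φ p ∈ T (colr K d t hK p) := fun p hp => he1 _ _ (hlt p hp)
  have hinj : ∀ p < K * t * b, ∀ p' < K * t * b, p < p' → φ p ≠ φ p' := by
    intro p hp p' hp' hpp heq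
    have hc : colr K d t hK p = colr K d t hK p' := by
      by_contra hcon
      have := hT.dis _ _ hcon
      exact (disjoint_left.1 this (hmemT p hp)) (heq ▸ hmemT p' hp')
    have hi : cidx K d t p = cidx K d t p' := by
      refine he2 (colr K d t hK p) _ (hlt p hp) _ (hc ▸ hlt p' hp') ?_
      have : φ p' = e (colr K d t hK p) (cidx K d t p') := by rw [hc]
      rw [← this]; exact heq
    unfold colr at hc
    unfold cidx at hi
    by_cases c1 : p % t = d - 1 <;> by_cases c2 : p' % t = d - 1
    · rw [if_pos c1, if_pos c2] at hi
      have h1 := Nat.div_add_mod p t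
      have h2 := Nat.div_add_mod p' t
      rw [c1] at h1; rw [c2, ← hi] at h2
      omega
    · rw [if_pos c1, if_neg c2] at hc; exact (Fin.castSucc_lt_last _).ne' hc
    · rw [if_neg c1, if_pos c2] at hc; exact (Fin.castSucc_lt_last _).ne hc
    · rw [if_neg c1, if_neg c2] at hc hi
      have e2 := congrArg Fin.val hc
      simp only [Fin.val_castSucc] at e2
      have hl := light_lt hd hdt hpp c1
      have h1 := Nat.div_add_mod (p - hvN d t p) K
      have h2 := Nat.div_add_mod (p' - hvN d t p') K
      rw [e2, hi] at h1
      omega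
  refine ⟨(List.range (K * t * b)).map φ, by simp, ?_, ?_, ?_⟩
  · rw [List.nodup_map_iff_inj_on List.nodup_range]
    intro p hp p' hp' heq
    rw [List.mem_range] at hp hp'
    rcases lt_trichotomy p p' with h | h | h
    · exact absurd heq (hinj p hp p' hp' h)
    · exact h
    · exact absurd heq.symm (hinj p' hp' p hp h)
  · intro v hv
    rw [List.mem_map] at hv
    obtain ⟨p, hp, rfl⟩ := hv
    exact sub_un _ _ (hmemT p (List.mem_range.1 hp))
  · refine goodF_of mono fun i => ?_
    let Q : Fin (K + 1) → ℕ → Prop := fun c p =>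
      i * d ≤ p ∧ p < i * d + (K + 1) ∧ p < K * t * b ∧ colr K d t hK p = c
    let x : Fin (K + 1) → V := fun c => if h : ∃ p, Q c p then φ h.choose else e c 0
    refine ⟨univ.image x, hT.tr x ?_, ?_⟩
    · intro c
      by_cases h : ∃ p, Q c p
      · simp only [x, dif_pos h]
        have hs := h.choose_spec
        have := hmemT _ hs.2.2.1
        rwa [hs.2.2.2] at this
      · simp only [x, dif_neg h]
        exact he1 c 0 (hwt c)
    · intro p v h1 h2 h3
      rw [List.getElem?_eq_some_iff] at h3
      obtain ⟨h4, h5⟩ := h3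
      simp only [List.length_map, List.length_range] at h4
      simp only [List.getElem_map, List.getElem_range] at h5
      have h : ∃ p', Q (colr K d t hK p) p' := ⟨p, h1, h2, h4, rfl⟩
      refine mem_image.2 ⟨colr K d t hK p, mem_univ _, ?_⟩
      simp only [x, dif_pos h]
      obtain ⟨s1, s2, s3, s4⟩ := h.choose_spec
      rw [← h5]
      congr 1
      rcases lt_trichotomy h.choose p with g | g | g
      · exact absurd s4 (colr_ne par hK s1 g h2)
      · exact g
      · exact absurd s4.symm (colr_ne par hK h1 g s2)

end PartD6

set_option linter.unusedSectionVars false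
set_option linter.unusedVariables false
set_option linter.unusedSimpArgs false

section PartD7
open scoped Classical

variable {V : Type} [Fintype V] [DecidableEq V]

lemma good_map {W : Type} [Fintype W] [DecidableEq W] (f : W ↪ V) {sh : Finset V → Prop} {k d : ℕ}
    (mono : ∀ S T, S ⊆ T → sh T → sh S) {l : List W}
    (h : Good (fun S : Finset W => sh (S.map f)) k d l) : Good sh k d (l.map f) := by
  refine goodF_of mono fun i => ⟨_, h i, ?_⟩
  intro p v h1 h2 h3
  rw [List.getElem?_map, Option.map_eq_some_iff] at h3
  obtain ⟨w, hw, rfl⟩ := h3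
  exact mem_map_of_mem _ (mem_cont.2 ⟨p, h1, h2, hw⟩)

lemma Sys.alpha_le {sh : Finset V → Prop} {k t : ℕ} {α : ℝ} (hk : 1 ≤ k) (ht : 2 ≤ t)
    (S : Sys sh k t α) (hn : 0 < Fintype.card V) : α ≤ 1 / 2 := by
  have h1 := S.deg ∅ S.emp (by rw [card_empty]; omega)
  have h2 : ((univ.filter fun v => sh (insert v ∅)).card : ℝ) ≤ Fintype.card V := by
    exact_mod_cast card_le_univ _
  have h3 : (0 : ℝ) < Fintype.card V := by exact_mod_cast hn
  have h4 : (1 - 1 / (t : ℝ) + α) * Fintype.card V ≤ 1 * Fintype.card V := by linarith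
  have h5 := le_of_mul_le_mul_right h4 h3
  have h6 : 1 / (t : ℝ) ≤ 1 / 2 := by
    apply one_div_le_one_div_of_le (by norm_num)
    exact_mod_cast ht
  linarith

lemma sys_sub {sh : Finset V → Prop} {k t : ℕ} {α : ℝ} (ht : 2 ≤ t) (hα : 0 < α)
    (S : Sys sh k t α) (U : Finset V) (hU : (U.card : ℝ) ≤ α / 2 * Fintype.card V) :
    Sys (V := {v // v ∉ U})
      (fun S => sh (S.map (Function.Embedding.subtype _))) k t (α / 2) := by
  refine ⟨?_, ?_, ?_, ?_⟩
  · intro A B hAB hB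
    exact S.mono _ _ (map_subset_map.2 hAB) hB
  · simpa using S.emp
  · intro v
    simpa using S.sing v
  · intro A hA hAc
    have h1 := S.deg _ hA (by simpa using hAc)
    set A' := A.map (Function.Embedding.subtype fun v => v ∉ U) with hA'
    set F := univ.filter fun v : {v // v ∉ U} =>
      sh ((insert v A).map (Function.Embedding.subtype _)) with hF
    have h2 : (univ.filter fun v => sh (insert v A')) ⊆
        F.map (Function.Embedding.subtype _) ∪ U := by
      intro v hv
      rw [mem_union]
      by_cases hvU : v ∈ U
      · exact Or.inr hvU
      · refine Or.inl (mem_map.2 ⟨⟨v, hvU⟩, ?_, rfl⟩)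
        rw [hF, mem_filter, map_insert]
        exact ⟨mem_univ _, (mem_filter.1 hv).2⟩
    have h3 := (card_le_card h2).trans (card_union_le _ _)
    rw [card_map] at h3
    have h4 : ((univ.filter fun v => sh (insert v A')).card : ℝ) ≤ F.card + U.card := by
      exact_mod_cast h3
    have h5 : (Fintype.card {v // v ∉ U} : ℝ) ≤ Fintype.card V := by
      exact_mod_cast Fintype.card_subtype_le _
    have h6 : 1 / (t : ℝ) ≤ 1 := by
      rw [div_le_one (by positivity)]
      exact_mod_cast (by omega : 1 ≤ t)
    have h7 := mul_le_mul_of_nonneg_left h5 (show 0 ≤ 1 - 1 / (t : ℝ) + α / 2 by linarith)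
    have h8 : (1 - 1 / (t : ℝ) + α) * Fintype.card V =
      (1 - 1 / (t : ℝ) + α / 2) * Fintype.card V + α / 2 * Fintype.card V := by ring
    have : (F.card : ℝ) = ((univ.filter fun v : {v // v ∉ U} =>
      sh ((insert v A).map (Function.Embedding.subtype _))).card : ℝ) := rfl
    linarith

lemma tiles_avoid {K d t : ℕ} {α ε : ℝ} (par : Par (K + 1) d t) (hα : 0 < α) (hε : 0 < ε)
    (b : ℕ) (hb : 1 ≤ b) :
    ∃ n1 : ℕ, ∀ (V : Type) [Fintype V] [DecidableEq V] (sh : Finset V → Prop),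
    Sys sh (K + 1) t α → n1 ≤ Fintype.card V → ∀ U : Finset V,
    (U.card : ℝ) ≤ α / 2 * Fintype.card V →
    ∃ ls : List (List V), (∀ l ∈ ls, l.length = K * t * b ∧ Good sh (K + 1) d l) ∧
      ls.flatten.Nodup ∧ (∀ v ∈ ls.flatten, v ∉ U) ∧
      (Fintype.card V : ℝ) ≤ U.card + ls.flatten.length + ε * Fintype.card V := by
  have hK : 0 < K := by have := par.ht; have := par.htk; omega
  obtain ⟨n1, hn1⟩ := tp_all (K := K) (t := t) hK par.ht (show 0 < α / 2 by positivity) hε b hb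
  refine ⟨2 * n1 + 1, fun V _ _ sh S hn U hU => ?_⟩
  have hα2 := S.alpha_le (by omega) par.ht (by omega)
  have hc : Fintype.card {v // v ∉ U} + U.card = Fintype.card V := by
    rw [Fintype.card_subtype_compl (fun v => v ∈ U)]
    simp only [Fintype.card_coe]
    have := card_le_univ U
    omega
  have hcR : (Fintype.card {v // v ∉ U} : ℝ) + U.card = Fintype.card V := by exact_mod_cast hc
  have hW : n1 ≤ Fintype.card {v // v ∉ U} := by
    have h1 : (U.card : ℝ) ≤ 1 / 2 * Fintype.card V := by
      refine hU.trans (mul_le_mul_of_nonneg_right (by linarith) (by positivity))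
    have h2 : ((2 * n1 + 1 : ℕ) : ℝ) ≤ Fintype.card V := by exact_mod_cast hn
    push_cast at h2
    have h3 : (n1 : ℝ) ≤ Fintype.card {v // v ∉ U} := by linarith
    exact_mod_cast h3
  have S' := sys_sub par.ht hα S U hU
  obtain ⟨ts, t1, t2, t3⟩ := hn1 {v // v ∉ U} _ S' hW
  have hp : ∀ T ∈ ts, _ := fun T hT => tile_path par S'.mono hb hK (t1 T hT)
  choose! g g1 g2 g3 g4 using hp
  have hlen : (ts.map fun T => (g T).map (Function.Embedding.subtype fun v => v ∉ U)).flatten.length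
      = K * t * b * ts.length := by
    rw [List.length_flatten, List.map_map]
    rw [List.map_congr_left (g := fun _ => K * t * b)]
    · rw [List.map_const', List.sum_replicate, smul_eq_mul, mul_comm]
    · intro T hT
      simp [g1 T hT]
  refine ⟨ts.map fun T => (g T).map (Function.Embedding.subtype _), ?_, ?_, ?_, ?_⟩
  · intro l hl
    obtain ⟨T, hT, rfl⟩ := List.mem_map.1 hl
    exact ⟨by rw [List.length_map, g1 T hT], good_map _ S.mono (g4 T hT)⟩
  · rw [List.nodup_flatten]
    constructor
    · intro l hl
      obtain ⟨T, hT, rfl⟩ := List.mem_map.1 hl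
      exact (g2 T hT).map (Function.Embedding.injective _)
    · rw [List.pairwise_map]
      refine t2.imp_of_mem ?_
      intro T T' hT hT' hd v hv hv'
      obtain ⟨a, ha, rfl⟩ := List.mem_map.1 hv
      obtain ⟨a', ha', e⟩ := List.mem_map.1 hv'
      have : a' = a := Function.Embedding.injective _ e
      subst this
      exact disjoint_left.1 hd (g3 T hT _ ha) (g3 T' hT' _ ha')
  · intro v hv
    obtain ⟨l, hl, hv⟩ := List.mem_flatten.1 hv
    obtain ⟨T, hT, rfl⟩ := List.mem_map.1 hl
    obtain ⟨a, ha, rfl⟩ := List.mem_map.1 hv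
    exact a.2
  · rw [hlen]
    push_cast
    push_cast at t3
    have h5 : (Fintype.card {v // v ∉ U} : ℝ) ≤ Fintype.card V := by
      linarith [(Nat.cast_nonneg U.card : (0 : ℝ) ≤ U.card)]
    have := mul_le_mul_of_nonneg_left h5 hε.le
    linarith

end PartD7

set_option linter.unusedSectionVars false
set_option linter.unusedVariables false
set_option linter.unusedSimpArgs false

section PartB1
open scoped Classical

/-- derandomised selection -/
lemma hits_sel {Ω I : Type} [Fintype Ω] [Fintype I] (A : I → Finset Ω) (conf : Ω → Finset Ω)
    {c κ : ℝ} (hc : 0 < c) (hc1 : c ≤ 1) (hΩ : 0 < Fintype.card Ω)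
    (hA : ∀ i, c * Fintype.card Ω ≤ ((A i).card : ℝ))
    (hconf : ∀ f, ((conf f).card : ℝ) ≤ κ * Fintype.card Ω) (T : ℕ) (hT : T * κ ≤ c / 2) :
    ∃ fs : List Ω, fs.length = T ∧ fs.Pairwise (fun f g => f ∉ conf g) ∧
      ∀ i, (1 / 2 : ℝ) ^ (fs.countP (fun f => f ∈ A i)) ≤ Fintype.card I * (1 - c / 4) ^ T := by
  have hN : (0 : ℝ) < Fintype.card Ω := by exact_mod_cast hΩ
  have hκ : 0 ≤ κ := by
    obtain ⟨f⟩ := Fintype.card_pos_iff.1 hΩ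
    have := hconf f
    by_contra h
    have h2 : κ * Fintype.card Ω < 0 := mul_neg_of_neg_of_pos (by linarith) hN
    linarith [(Nat.cast_nonneg (conf f).card : (0 : ℝ) ≤ (conf f).card)]
  have key : ∀ j ≤ T, ∃ fs : List Ω, fs.length = j ∧ fs.Pairwise (fun f g => f ∉ conf g) ∧
      ∑ i, (1 / 2 : ℝ) ^ (fs.countP (fun f => f ∈ A i)) ≤ Fintype.card I * (1 - c / 4) ^ j := by
    intro j
    induction j with
    | zero => exact fun _ => ⟨[], by simp, by simp, by simp⟩
    | succ j ih =>
      intro hj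
      obtain ⟨fs, h1, h2, h3⟩ := ih (by omega)
      set C := fs.toFinset.biUnion conf with hC
      have hCc : (C.card : ℝ) ≤ c / 2 * Fintype.card Ω := by
        have e1 : (C.card : ℝ) ≤ ∑ f ∈ fs.toFinset, ((conf f).card : ℝ) := by
          exact_mod_cast card_biUnion_le
        have e2 : ∑ f ∈ fs.toFinset, ((conf f).card : ℝ) ≤ fs.toFinset.card * (κ * Fintype.card Ω) := by
          rw [← nsmul_eq_mul]
          exact sum_le_card_nsmul _ _ _ fun f _ => hconf f
        have e3 : (fs.toFinset.card : ℝ) ≤ T := by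
          have := fs.toFinset_card_le
          exact_mod_cast (by omega : fs.toFinset.card ≤ T)
        have e4 := mul_le_mul_of_nonneg_right e3 (show 0 ≤ κ * Fintype.card Ω by positivity)
        have e5 := mul_le_mul_of_nonneg_right hT hN.le
        linarith [mul_assoc (T : ℝ) κ (Fintype.card Ω)]
      set B := univ \ C with hB
      have hBC : (B.card : ℝ) + C.card = Fintype.card Ω := by
        have := card_sdiff_add_card_eq_card (subset_univ C)
        rw [card_univ] at this
        exact_mod_cast this
      have hBne : B.Nonempty := by
        rw [← card_pos]
        have : (0 : ℝ) < B.card := by nlinarith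
        exact_mod_cast this
      have hBpos : (0 : ℝ) < B.card := by exact_mod_cast card_pos.2 hBne
      set p : I → ℝ := fun i => (1 / 2 : ℝ) ^ (fs.countP (fun f => f ∈ A i)) with hp
      have hp0 : ∀ i, 0 ≤ p i := fun i => by simp only [hp]; positivity
      have hsum : ∑ f ∈ B, ∑ i, (1 / 2 : ℝ) ^ ((f :: fs).countP (fun f => f ∈ A i)) ≤
          ∑ f ∈ B, (1 - c / 4) * ∑ i, p i := by
        rw [sum_comm, sum_const, nsmul_eq_mul, mul_sum, mul_sum]
        refine sum_le_sum fun i _ => ?_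
        have e1 : ∀ f, (1 / 2 : ℝ) ^ ((f :: fs).countP (fun f => f ∈ A i)) =
            p i - (if f ∈ A i then p i / 2 else 0) := by
          intro f
          rw [List.countP_cons]
          by_cases h : f ∈ A i
          · simp [h, hp, pow_succ]; ring
          · simp [h, hp]
        simp only [e1]
        rw [sum_sub_distrib, sum_const, nsmul_eq_mul, ← sum_filter, sum_const, nsmul_eq_mul]
        have e2 : A i ⊆ B.filter (fun f => f ∈ A i) ∪ C := by
          intro f hf
          by_cases hfC : f ∈ C
          · exact mem_union_right _ hfC
          · exact mem_union_left _ (mem_filter.2 ⟨mem_sdiff.2 ⟨mem_univ _, hfC⟩, hf⟩)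
        have e3 : ((A i).card : ℝ) ≤ (B.filter (fun f => f ∈ A i)).card + C.card := by
          exact_mod_cast (card_le_card e2).trans (card_union_le _ _)
        have e4 := hA i
        have e5 : c / 2 * B.card ≤ (B.filter (fun f => f ∈ A i)).card := by
          have : (B.card : ℝ) ≤ Fintype.card Ω := by
            linarith [(Nat.cast_nonneg C.card : (0 : ℝ) ≤ C.card)]
          have := mul_le_mul_of_nonneg_left this (show 0 ≤ c / 2 by positivity)
          linarith
        have := mul_le_mul_of_nonneg_right e5 (show 0 ≤ p i / 2 by have := hp0 i; positivity)
        linarith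
      obtain ⟨f, hfB, hf⟩ := exists_le_of_sum_le hBne hsum
      refine ⟨f :: fs, by simp [h1], ?_, ?_⟩
      · rw [List.pairwise_cons]
        refine ⟨fun g hg hfg => ?_, h2⟩
        exact (mem_sdiff.1 hfB).2 (mem_biUnion.2 ⟨g, by simpa using hg, hfg⟩)
      · refine hf.trans ?_
        have := mul_le_mul_of_nonneg_left h3 (show 0 ≤ 1 - c / 4 by linarith)
        rw [pow_succ]
        linarith
  obtain ⟨fs, h1, h2, h3⟩ := key T le_rfl
  refine ⟨fs, h1, h2, fun i => le_trans ?_ h3⟩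
  exact single_le_sum (f := fun i => (1 / 2 : ℝ) ^ (fs.countP (fun f => f ∈ A i)))
    (fun i _ => by positivity) (mem_univ i)

lemma hits_cor {c τ : ℝ} (hc : 0 < c) (hc1 : c ≤ 1) (hτ : 0 < τ) (p : ℕ) :
    ∃ γ : ℝ, 0 < γ ∧ ∃ n0 : ℕ, ∀ n : ℕ, n0 ≤ n → ∀ h T : ℕ, τ * n ≤ T + 1 →
      (1 / 2 : ℝ) ^ h ≤ ((n : ℝ) + 1) ^ p * (1 - c / 4) ^ T → γ * n ≤ h := by
  obtain ⟨m, hm⟩ := exists_pow_lt_of_lt_one (show (0 : ℝ) < 1 / 4 by norm_num)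
    (show 1 - c / 4 < 1 by linarith)
  have hm0 : 0 < m := by
    rcases Nat.eq_zero_or_pos m with h | h
    · subst h; norm_num at hm
    · exact h
  have hmR : (0 : ℝ) < m := by exact_mod_cast hm0
  set C : ℝ := m / τ + 1 with hC
  have hC0 : 0 < C := by positivity
  have hlim := tendsto_pow_const_div_const_pow_of_one_lt p (show (1 : ℝ) < 2 by norm_num)
  have hev := (hlim.eventually (gt_mem_nhds (show (0 : ℝ) < 1 / (2 * C ^ p) by positivity)))
  obtain ⟨s0, hs0⟩ := Filter.eventually_atTop.1 hev
  obtain ⟨n1, hn1⟩ := exists_nat_ge (m * (s0 + 1) / τ)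
  obtain ⟨n2, hn2⟩ := exists_nat_ge (2 * m / τ)
  refine ⟨τ / (2 * m), by positivity, n1 + n2, fun n hn h T hT hh => ?_⟩
  obtain ⟨s, hs⟩ : ∃ s, s = T / m := ⟨_, rfl⟩
  have hTs : T + 1 ≤ m * (s + 1) := by
    have h1 := Nat.div_add_mod T m
    have h2 := Nat.mod_lt T hm0
    rw [← hs] at h1
    rw [mul_add]; omega
  have hTs' : τ * n ≤ m * (s + 1) := by
    have : ((T + 1 : ℕ) : ℝ) ≤ ((m * (s + 1) : ℕ) : ℝ) := by exact_mod_cast hTs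
    push_cast at this
    linarith
  have hnR1 : (n1 : ℝ) ≤ n := by exact_mod_cast (by omega : n1 ≤ n)
  have hnR2 : (n2 : ℝ) ≤ n := by exact_mod_cast (by omega : n2 ≤ n)
  rw [div_le_iff₀ hτ] at hn1 hn2
  have hss0 : s0 ≤ s := by
    have h1 : (m : ℝ) * (s0 + 1) ≤ m * (s + 1) := by nlinarith
    have h2 := le_of_mul_le_mul_left h1 hmR
    have : (s0 : ℝ) ≤ s := by linarith
    exact_mod_cast this
  have hγ : τ / (2 * m) * n ≤ s := by
    rw [div_mul_eq_mul_div, div_le_iff₀ (by positivity)]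
    nlinarith
  refine hγ.trans ?_
  suffices s ≤ h by exact_mod_cast this
  by_contra hcon
  push Not at hcon
  have hq0 : 0 ≤ 1 - c / 4 := by linarith
  have hq1 : 1 - c / 4 ≤ 1 := by linarith
  have e1 : (1 - c / 4) ^ T ≤ (1 / 4 : ℝ) ^ s := by
    calc (1 - c / 4) ^ T ≤ (1 - c / 4) ^ (m * s) :=
          pow_le_pow_of_le_one hq0 hq1 (by rw [hs]; exact Nat.mul_div_le T m)
      _ = ((1 - c / 4) ^ m) ^ s := by rw [pow_mul]
      _ ≤ (1 / 4 : ℝ) ^ s := pow_le_pow_left₀ (by positivity) hm.le _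
  have e2 : (n : ℝ) + 1 ≤ C * ((s + 1 : ℕ) : ℝ) := by
    have h1 : (n : ℝ) ≤ m / τ * (s + 1) := by
      rw [div_mul_eq_mul_div, le_div_iff₀ hτ]; linarith
    rw [hC]; push_cast
    have : (0 : ℝ) ≤ s := by positivity
    linarith
  have e3 : ((n : ℝ) + 1) ^ p ≤ C ^ p * ((s + 1 : ℕ) : ℝ) ^ p := by
    rw [← mul_pow]; exact pow_le_pow_left₀ (by positivity) e2 _
  have e4 := hs0 (s + 1) (by omega)
  rw [div_lt_div_iff₀ (by positivity) (by positivity)] at e4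
  have e5 : C ^ p * ((s + 1 : ℕ) : ℝ) ^ p < 2 ^ s := by
    rw [pow_succ] at e4; linarith
  have e6 : (1 / 4 : ℝ) ^ s = (1 / 2) ^ s * (1 / 2) ^ s := by rw [← mul_pow]; norm_num
  have e7 : (2 : ℝ) ^ s * (1 / 2) ^ s = 1 := by rw [← mul_pow]; norm_num
  have e8 : (1 / 2 : ℝ) ^ s ≤ (1 / 2) ^ h := pow_le_pow_of_le_one (by norm_num) (by norm_num) hcon.le
  have e9 : ((n : ℝ) + 1) ^ p * (1 - c / 4) ^ T ≤ ((n : ℝ) + 1) ^ p * (1 / 4) ^ s :=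
    mul_le_mul_of_nonneg_left e1 (by positivity)
  have hpos : (0 : ℝ) < (1 / 2) ^ s * (1 / 2) ^ s := by positivity
  have e10 : ((n : ℝ) + 1) ^ p * ((1 / 2) ^ s * (1 / 2) ^ s) < 2 ^ s * ((1 / 2) ^ s * (1 / 2) ^ s) :=
    mul_lt_mul_of_pos_right (by linarith) hpos
  rw [e6] at e9
  have e11 : (2 : ℝ) ^ s * ((1 / 2) ^ s * (1 / 2) ^ s) = (1 / 2) ^ s := by
    rw [← mul_assoc, e7, one_mul]
  linarith

variable {V : Type} [Fintype V] [DecidableEq V]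

/-- iterated many choices quantifier -/
def Many (M : ℝ) : ℕ → (List V → Prop) → Prop
  | 0, P => P []
  | m + 1, P => M ≤ ((univ.filter fun v => Many M m (fun l => P (v :: l))).card : ℝ)

lemma Many.mono {M : ℝ} : ∀ {m : ℕ} {P P' : List V → Prop},
    (∀ l, l.length = m → P l → P' l) → Many M m P → Many M m P'
  | 0, P, P', h, hP => h [] rfl hP
  | m + 1, P, P', h, hP => by
    refine le_trans (show M ≤ _ from hP) ?_
    have : (univ.filter fun v => Many M m (fun l => P (v :: l))) ⊆
        (univ.filter fun v => Many M m (fun l => P' (v :: l))) := by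
      intro v hv
      rw [mem_filter] at hv ⊢
      exact ⟨hv.1, Many.mono (fun l hl => h (v :: l) (by simp [hl])) hv.2⟩
    exact_mod_cast card_le_card this

lemma Many.comp {M : ℝ} : ∀ {a b : ℕ} {P : List V → Prop},
    Many M a (fun l => Many M b (fun l' => P (l ++ l'))) → Many M (a + b) P
  | 0, b, P, h => by simpa [Many] using h
  | a + 1, b, P, h => by
    rw [show a + 1 + b = (a + b) + 1 by ring]
    refine le_trans (show M ≤ _ from h) ?_
    have : (univ.filter fun v => Many M a (fun l => Many M b (fun l' => P (v :: l ++ l')))) ⊆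
        (univ.filter fun v => Many M (a + b) (fun l => P (v :: l))) := by
      intro v hv
      rw [mem_filter] at hv ⊢
      exact ⟨hv.1, Many.comp (P := fun l => P (v :: l)) hv.2⟩
    exact_mod_cast card_le_card this

lemma many_step {M : ℝ} {R : List V → Prop}
    (h : ∀ l, R l → M ≤ ((univ.filter fun v => R (l ++ [v])).card : ℝ)) :
    ∀ (m : ℕ) (w : List V), R w → Many M m (fun l => R (w ++ l))
  | 0, w, hw => by simpa [Many] using hw
  | m + 1, w, hw => by
    refine (h w hw).trans ?_
    have : (univ.filter fun v => R (w ++ [v])) ⊆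
        (univ.filter fun v => Many M m (fun l => R (w ++ v :: l))) := by
      intro v hv
      rw [mem_filter] at hv ⊢
      refine ⟨hv.1, (many_step h m (w ++ [v]) hv.2).mono ?_⟩
      intro l _ hl
      simpa using hl
    exact_mod_cast card_le_card this

lemma Many.count {M : ℝ} (hM : 0 ≤ M) : ∀ {m : ℕ} {P : List V → Prop}, Many M m P →
    M ^ m ≤ ((univ.filter fun f : Fin m → V => P (List.ofFn f)).card : ℝ)
  | 0, P, h => by
    have h : P [] := h
    simp [h]
  | m + 1, P, h => by
    have h : M ≤ ((univ.filter fun v => Many M m (fun l => P (v :: l))).card : ℝ) := h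
    have e : (univ.filter fun f : Fin (m + 1) → V => P (List.ofFn f)).card =
        ∑ v, (univ.filter fun f : Fin m → V => P (v :: List.ofFn f)).card := by
      simp only [card_filter]
      rw [← (Fin.consEquiv fun _ => V).sum_comp, Fintype.sum_prod_type]
      refine sum_congr rfl fun v _ => sum_congr rfl fun f _ => ?_
      simp [Fin.consEquiv, List.ofFn_succ]
    rw [e]
    push_cast
    calc M ^ (m + 1) = M * M ^ m := by rw [pow_succ]; ring
      _ ≤ ((univ.filter fun v => Many M m (fun l => P (v :: l))).card : ℝ) * M ^ m :=
          mul_le_mul_of_nonneg_right h (by positivity)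
      _ = ∑ v ∈ univ.filter fun v => Many M m (fun l => P (v :: l)), M ^ m := by
          rw [sum_const, nsmul_eq_mul]
      _ ≤ ∑ v ∈ univ.filter fun v => Many M m (fun l => P (v :: l)),
          ((univ.filter fun f : Fin m → V => P (v :: List.ofFn f)).card : ℝ) :=
          sum_le_sum fun v hv => Many.count hM (mem_filter.1 hv).2
      _ ≤ _ := sum_le_sum_of_subset_of_nonneg (subset_univ _) fun _ _ _ => by positivity

lemma card_det {m : ℕ} (i : Fin (m + 1)) (S : Finset (Fin (m + 1) → V))
    (h : ∀ f ∈ S, ∀ g ∈ S, (∀ j, j ≠ i → f j = g j) → f i = g i) :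
    S.card ≤ Fintype.card V ^ m := by
  have : Fintype.card V ^ m = (univ : Finset (Fin m → V)).card := by
    rw [card_univ, Fintype.card_fun, Fintype.card_fin]
  rw [this]
  refine card_le_card_of_injOn (fun f j => f (i.succAbove j)) (fun _ _ => by simp) ?_
  intro f hf g hg hfg
  have h1 : ∀ j, j ≠ i → f j = g j := by
    intro j hj
    obtain ⟨j', rfl⟩ := Fin.exists_succAbove_eq hj
    exact congrFun hfg j'
  funext j
  by_cases hj : j = i
  · subst hj; exact h f hf g hg h1
  · exact h1 j hj

lemma card_noninj (m : ℕ) : (univ.filter fun f : Fin (m + 1) → V => ¬ Function.Injective f).card ≤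
    (m + 1) * (m + 1) * Fintype.card V ^ m := by
  have h1 : (univ.filter fun f : Fin (m + 1) → V => ¬ Function.Injective f) ⊆
      (univ : Finset (Fin (m + 1) × Fin (m + 1))).biUnion fun q =>
        univ.filter fun f : Fin (m + 1) → V => q.1 ≠ q.2 ∧ f q.1 = f q.2 := by
    intro f hf
    have h := (mem_filter.1 hf).2
    simp only [Function.Injective, not_forall] at h
    obtain ⟨a, b, e, hne⟩ := h
    exact mem_biUnion.2 ⟨(a, b), mem_univ _, mem_filter.2 ⟨mem_univ _, hne, e⟩⟩
  refine (card_le_card h1).trans (card_biUnion_le.trans ?_)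
  refine (sum_le_card_nsmul _ _ (Fintype.card V ^ m) fun q _ => ?_).trans (by simp)
  refine card_det q.1 _ ?_
  intro f hf g hg h
  obtain ⟨h2, h3⟩ := (mem_filter.1 hf).2
  rw [h3, (mem_filter.1 hg).2.2, h _ (Ne.symm h2)]

/-- tuples meeting `g` -/
noncomputable def confl {m : ℕ} (g : Fin m → V) : Finset (Fin m → V) :=
  univ.filter fun f => ∃ i j, f i = g j

lemma card_confl {m : ℕ} (g : Fin (m + 1) → V) :
    (confl g).card ≤ (m + 1) * (m + 1) * Fintype.card V ^ m := by
  have h1 : confl g ⊆ (univ : Finset (Fin (m + 1) × Fin (m + 1))).biUnion fun q =>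
        univ.filter fun f : Fin (m + 1) → V => f q.1 = g q.2 := by
    intro f hf
    obtain ⟨a, b, e⟩ := (mem_filter.1 hf).2
    exact mem_biUnion.2 ⟨(a, b), mem_univ _, mem_filter.2 ⟨mem_univ _, e⟩⟩
  refine (card_le_card h1).trans (card_biUnion_le.trans ?_)
  refine (sum_le_card_nsmul _ _ (Fintype.card V ^ m) fun q _ => ?_).trans (by simp)
  refine card_det q.1 _ ?_
  intro f hf g hg h
  rw [(mem_filter.1 hf).2, (mem_filter.1 hg).2]

end PartB1

set_option linter.unusedSectionVars false
set_option linter.unusedVariables false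
set_option linter.unusedSimpArgs false

section PartB2
open scoped Classical
variable {V : Type} [Fintype V] [DecidableEq V] {sh : Finset V → Prop} {k d : ℕ}

lemma ext_set (mono : ∀ S T, S ⊆ T → sh T → sh S) (hd : 1 ≤ d) (hdk : d ≤ k) {w : List V}
    (h : Good sh k d w) :
    ∃ S, sh S ∧ S.card < k ∧ ∀ v, sh (insert v S) → Good sh k d (w ++ [v]) := by
  have hex : ∃ i, w.length < i * d + k := ⟨w.length, by
    have : w.length * 1 ≤ w.length * d := Nat.mul_le_mul_left _ hd
    omega⟩
  set i0 := Nat.find hex with hi0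
  have h0 : w.length < i0 * d + k := Nat.find_spec hex
  have hle : i0 * d ≤ w.length := by
    have h1 : i0 ≤ w.length / d := by
      apply Nat.find_min'
      have h1 := Nat.div_add_mod w.length d
      have h2 := Nat.mod_lt w.length (show 0 < d by omega)
      rw [mul_comm]; omega
    calc i0 * d ≤ w.length / d * d := Nat.mul_le_mul_right _ h1
      _ ≤ w.length := Nat.div_mul_le_self _ _
  set f : ℕ → Option V := fun p => w[p]? with hf
  refine ⟨(Finset.Ico (i0 * d) w.length).biUnion fun p => (f p).toFinset, ?_, ?_, ?_⟩
  · refine mono _ _ ?_ (h i0)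
    exact biUnion_subset_biUnion_of_subset_left _ (Ico_subset_Ico le_rfl h0.le)
  · refine lt_of_le_of_lt (card_biUnion_le_card_mul _ _ 1 ?_) ?_
    · intro p _
      cases f p <;> simp
    · simp only [Nat.card_Ico]; omega
  · intro v hv
    refine goodF_of mono fun i => ?_
    by_cases hi : w.length < i * d + k
    · refine ⟨_, hv, ?_⟩
      intro p u h1 h2 h3
      have hii : i0 * d ≤ i * d := Nat.mul_le_mul_right _ (Nat.find_min' hex hi)
      rcases Nat.lt_or_ge p w.length with hp | hp
      · rw [List.getElem?_append_left hp] at h3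
        refine mem_insert_of_mem (mem_biUnion.2 ⟨p, mem_Ico.2 ⟨by omega, hp⟩, ?_⟩)
        simp [hf, h3]
      · rw [List.getElem?_append_right hp] at h3
        have := (List.getElem?_eq_some_iff.1 h3)
        obtain ⟨h4, h5⟩ := this
        simp at h5
        rw [← h5]; exact mem_insert_self _ _
    · refine ⟨_, h i, ?_⟩
      intro p u h1 h2 h3
      rw [List.getElem?_append_left (by omega)] at h3
      exact mem_cont.2 ⟨p, h1, h2, h3⟩

lemma two_ext {t : ℕ} {α : ℝ} (ht : 2 ≤ t) (hα : 0 < α) (S : Sys sh k t α) {A B : Finset V}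
    (hA : sh A) (hB : sh B) (cA : A.card < k) (cB : B.card < k) (Q : V → Prop)
    (hQ : ∀ v, sh (insert v A) → sh (insert v B) → Q v) :
    α * Fintype.card V ≤ ((univ.filter Q).card : ℝ) := by
  have h := avail_univ ht S (fun j => if (j : ℕ) = 0 then A else B) (by
    intro j
    split_ifs
    · exact ⟨hA, cA⟩
    · exact ⟨hB, cB⟩)
  have h1 : (univ.filter fun v => ∀ j : Fin t, sh (insert v (if (j : ℕ) = 0 then A else B))) ⊆
      univ.filter Q := by
    intro v hv
    rw [mem_filter] at hv ⊢
    refine ⟨hv.1, hQ v ?_ ?_⟩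
    · simpa using hv.2 ⟨0, by omega⟩
    · simpa using hv.2 ⟨1, by omega⟩
  have h2 : ((univ.filter fun v => ∀ j : Fin t,
      sh (insert v (if (j : ℕ) = 0 then A else B))).card : ℝ) ≤ ((univ.filter Q).card : ℝ) := by
    exact_mod_cast card_le_card h1
  have h3 : (1 : ℝ) ≤ t := by exact_mod_cast (by omega : 1 ≤ t)
  have h4 : 1 * (α * Fintype.card V) ≤ t * (α * Fintype.card V) :=
    mul_le_mul_of_nonneg_right h3 (by positivity)
  linarith [mul_assoc (t : ℝ) α (Fintype.card V)]

/-- insert a vertex in position `k-1` -/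
def ins (k : ℕ) (Z : List V) (y : V) : List V := Z.take (k - 1) ++ [y] ++ Z.drop (k - 1)

lemma good_of_sh (mono : ∀ S T, S ⊆ T → sh T → sh S) {l : List V} {S : Finset V} (hS : sh S)
    (h : ∀ v ∈ l, v ∈ S) : Good sh k d l := by
  refine goodF_of mono fun i => ⟨S, hS, ?_⟩
  intro p v _ _ h3
  exact h v (List.mem_of_getElem? h3)

lemma ins_ext (mono : ∀ S T, S ⊆ T → sh T → sh S) (hd : 1 ≤ d) (hdk : d ≤ k) {Z : List V} {y : V}
    (h : Good sh k d (ins k Z y)) :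
    ∃ S, sh S ∧ S.card < k ∧ ∀ v, sh (insert v S) → Good sh k d (ins k (Z ++ [v]) y) := by
  rcases Nat.lt_or_ge Z.length (k - 1) with hZ | hZ
  · have e : ins k Z y = Z ++ [y] := by
      simp [ins, List.take_of_length_le hZ.le, List.drop_of_length_le hZ.le]
    rw [e] at h
    refine ⟨(Z ++ [y]).toFinset, mono _ _ ?_ (h 0), ?_, ?_⟩
    · intro v hv
      rw [List.mem_toFinset] at hv
      obtain ⟨p, hp, rfl⟩ := List.getElem_of_mem hv
      refine mem_cont.2 ⟨p, by omega, ?_, List.getElem?_eq_getElem hp⟩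
      simp at hp; omega
    · refine lt_of_le_of_lt (List.toFinset_card_le _) ?_
      simp; omega
    · intro v hv
      refine good_of_sh mono hv ?_
      intro u hu
      simp only [ins, List.mem_append, List.mem_singleton] at hu
      simp only [mem_insert, List.mem_toFinset, List.mem_append, List.mem_singleton]
      rcases hu with (hu | hu) | hu
      · have := List.mem_of_mem_take hu
        simp at this; tauto
      · tauto
      · have := List.mem_of_mem_drop hu
        simp at this; tauto
  · obtain ⟨S, h1, h2, h3⟩ := ext_set mono hd hdk h
    refine ⟨S, h1, h2, fun v hv => ?_⟩
    have e : ins k (Z ++ [v]) y = ins k Z y ++ [v] := by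
      simp [ins, List.take_append_of_le_length hZ, List.drop_append_of_le_length hZ]
    rw [e]
    exact h3 v hv

/-- validity of the swapping gadgets -/
def PZ (sh : Finset V → Prop) (k d z : ℕ) : List V → List V → List V → Prop
  | y :: ys, v :: vs, l => Good sh k d (ins k (l.take z) y) ∧ Good sh k d (ins k (l.take z) v) ∧
      PZ sh k d z ys vs (l.drop z)
  | _, _, _ => True

/-- the swapping gadgets -/
def gads (k z : ℕ) : List V → List V → List (List V)
  | [], _ => []
  | y :: ys, l => ins k (l.take z) y :: gads k z ys (l.drop z)

lemma many_pz {t : ℕ} {α : ℝ} (ht : 2 ≤ t) (hα : 0 < α) (S : Sys sh k t α) (hd : 1 ≤ d)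
    (hdk : d ≤ k) (z : ℕ) : ∀ ys vs : List V, ys.length = vs.length →
    Many (α * Fintype.card V) (ys.length * z) (PZ sh k d z ys vs)
  | [], [], _ => by simp [Many, PZ]
  | y :: ys, v :: vs, h => by
    rw [List.length_cons, show (ys.length + 1) * z = z + ys.length * z by ring]
    apply Many.comp
    have h1 := many_step (M := α * Fintype.card V)
      (R := fun Z => Good sh k d (ins k Z y) ∧ Good sh k d (ins k Z v)) (by
        rintro Z ⟨g1, g2⟩
        obtain ⟨A, a1, a2, a3⟩ := ins_ext S.mono hd hdk g1
        obtain ⟨B, b1, b2, b3⟩ := ins_ext S.mono hd hdk g2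
        exact two_ext ht hα S a1 b1 a2 b2 _ fun u hA hB => ⟨a3 u hA, b3 u hB⟩)
      z [] (by
        refine ⟨good_of_sh S.mono (S.sing y) ?_, good_of_sh S.mono (S.sing v) ?_⟩ <;> simp [ins])
    refine h1.mono ?_
    rintro Z hZ ⟨g1, g2⟩
    refine (many_pz ht hα S hd hdk z ys vs (by simpa using h)).mono ?_
    intro l hl hP
    have e1 : (Z ++ l).take z = Z := by rw [← hZ]; simp
    have e2 : (Z ++ l).drop z = l := by rw [← hZ]; simp
    simp only [PZ, e1, e2]
    exact ⟨g1, g2, hP⟩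
  | [], _ :: _, h => by simp at h
  | _ :: _, [], h => by simp at h

/-- validity of a whole absorber for `D` -/
def Pabs (sh : Finset V → Prop) (k d q : ℕ) (D l : List V) : Prop :=
  Good sh k d (l.take q ++ (l.drop q).take d ++ (l.drop (q + d)).take q) ∧
  Good sh k d (l.take q ++ (l.drop (q + d)).take q) ∧
  PZ sh k d (2 * q - 1) ((l.drop q).take d) D (l.drop (q + d + q))

lemma many_abs {t : ℕ} {α : ℝ} (ht : 2 ≤ t) (hα : 0 < α) (S : Sys sh k t α) (hd : 1 ≤ d)
    (hdk : d ≤ k) (q : ℕ) (D : List V) (hD : D.length = d) :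
    Many (α * Fintype.card V) (q + d + (q + d * (2 * q - 1))) (Pabs sh k d q D) := by
  apply Many.comp
  have h1 := many_step (M := α * Fintype.card V) (R := fun w => Good sh k d w) (by
        intro w hw
        obtain ⟨A, a1, a2, a3⟩ := ext_set S.mono hd hdk hw
        exact two_ext ht hα S a1 a1 a2 a2 _ fun u hA hB => a3 u hA)
      (q + d) [] (good_of_sh S.mono S.emp (by simp))
  refine h1.mono ?_
  intro l hl hg
  rw [List.nil_append] at hg
  apply Many.comp
  have hgA : Good sh k d (l.take q) := by
    rw [← List.take_append_drop q l] at hg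
    exact good_front S.mono hg
  have h2 := many_step (M := α * Fintype.card V)
    (R := fun w => Good sh k d (l ++ w) ∧ Good sh k d (l.take q ++ w)) (by
        rintro w ⟨g1, g2⟩
        obtain ⟨A, a1, a2, a3⟩ := ext_set S.mono hd hdk g1
        obtain ⟨B, b1, b2, b3⟩ := ext_set S.mono hd hdk g2
        refine two_ext ht hα S a1 b1 a2 b2 _ fun u hA hB => ⟨?_, ?_⟩
        · rw [← List.append_assoc]; exact a3 u hA
        · rw [← List.append_assoc]; exact b3 u hB)
      q [] (by simpa using ⟨hg, hgA⟩)
  refine h2.mono ?_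
  intro w hw hgw
  rw [List.nil_append] at hgw
  have h3 := many_pz ht hα S hd hdk (2 * q - 1) (l.drop q) D (by simp [hl, hD])
  rw [show (l.drop q).length = d by simp [hl]] at h3
  refine h3.mono ?_
  intro r hr hP
  have e1 : (l ++ (w ++ r)).take q = l.take q := by
    rw [List.take_append_of_le_length (by omega)]
  have e2 : ((l ++ (w ++ r)).drop q).take d = l.drop q := by
    rw [List.drop_append_of_le_length (by omega), List.take_append_of_le_length (by simp; omega),
      List.take_of_length_le (by simp; omega)]
  have e3 : (l ++ (w ++ r)).drop (q + d) = w ++ r := by rw [← hl]; simp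
  have e4 : (w ++ r).take q = w := by rw [← hw]; simp
  have e5 : (l ++ (w ++ r)).drop (q + d + q) = r := by
    rw [← List.drop_drop, e3, ← hw]; simp
  unfold Pabs
  rw [e1, e2, e3, e4, e5, List.take_append_drop]
  exact ⟨hgw.1, hgw.2, hP⟩

/-- gadget lists of an absorber: initial state -/
def gad0 (k d q : ℕ) (l : List V) : List (List V) :=
  (l.take q ++ (l.drop (q + d)).take q) ::
    gads k (2 * q - 1) ((l.drop q).take d) (l.drop (q + d + q))

/-- gadget lists of an absorber: after absorbing `D` -/
def gad1 (k d q : ℕ) (D l : List V) : List (List V) :=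
  (l.take q ++ (l.drop q).take d ++ (l.drop (q + d)).take q) ::
    gads k (2 * q - 1) D (l.drop (q + d + q))

lemma ins_perm (k : ℕ) (Z : List V) (y : V) : (ins k Z y).Perm (y :: Z) := by
  unfold ins
  rw [List.append_assoc]
  refine List.perm_append_comm.trans ?_
  simp only [List.singleton_append, List.cons_append]
  refine List.Perm.cons _ ?_
  refine List.perm_append_comm.trans ?_
  rw [List.nil_append, List.take_append_drop]

lemma gads_perm (k z : ℕ) : ∀ (ys l : List V), l.length = ys.length * z →
    (gads k z ys l).flatten.Perm (ys ++ l)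
  | [], l, h => by
    have : l = [] := by simpa using h
    simp [gads, this]
  | y :: ys, l, h => by
    simp only [gads, List.flatten_cons, List.cons_append]
    rw [List.length_cons] at h
    have ih := gads_perm k z ys (l.drop z) (by rw [List.length_drop, h, add_mul]; omega)
    refine ((ins_perm k _ _).append ih).trans ?_
    rw [List.cons_append]
    refine List.Perm.cons _ ?_
    rw [← List.append_assoc]
    refine (List.perm_append_comm.append_right _).trans ?_
    rw [List.append_assoc, List.take_append_drop]

lemma gads_good {q : ℕ} (hq : 1 ≤ q) : ∀ (ys vs l : List V), ys.length = vs.length →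
    l.length = ys.length * (2 * q - 1) → PZ sh k d (2 * q - 1) ys vs l →
    ∀ x ∈ gads k (2 * q - 1) ys l, x.length = 2 * q ∧ Good sh k d x
  | [], _, l, _, _, _ => by simp [gads]
  | y :: ys, v :: vs, l, h0, h, hP => by
    simp only [gads, List.mem_cons]
    obtain ⟨g1, g2, g3⟩ := hP
    rw [List.length_cons] at h
    rintro x (rfl | hx)
    · refine ⟨?_, g1⟩
      rw [(ins_perm k _ _).length_eq, List.length_cons, List.length_take, h]
      have : 2 * q - 1 ≤ (ys.length + 1) * (2 * q - 1) := Nat.le_mul_of_pos_left _ (by omega)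
      rw [min_eq_left this]; omega
    · exact gads_good hq ys vs (l.drop (2 * q - 1)) (by simpa using h0)
        (by rw [List.length_drop, h, add_mul]; omega) g3 x hx
  | _ :: _, [], l, h, _, _ => by simp at h

lemma gads_repl {q : ℕ} (mono : ∀ S T, S ⊆ T → sh T → sh S) (hd : 1 ≤ d) (hk : 1 ≤ k)
    (hq : k ≤ q) (hdq : d ∣ q) :
    ∀ (ys vs l : List V), ys.length = vs.length →
    l.length = ys.length * (2 * q - 1) → PZ sh k d (2 * q - 1) ys vs l →
    List.Forall₂ (Repl sh k d) (gads k (2 * q - 1) ys l) (gads k (2 * q - 1) vs l)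
  | [], [], l, _, _, _ => by simp [gads]
  | y :: ys, v :: vs, l, h0, h, hP => by
    simp only [gads]
    obtain ⟨g1, g2, g3⟩ := hP
    rw [List.length_cons] at h
    refine List.Forall₂.cons ?_ (gads_repl mono hd hk hq hdq ys vs (l.drop (2 * q - 1))
      (by simpa using h0) (by rw [List.length_drop, h, add_mul]; omega) g3)
    set Z := l.take (2 * q - 1) with hZ
    have hZl : Z.length = 2 * q - 1 := by
      rw [hZ, List.length_take, h]
      have : 2 * q - 1 ≤ (ys.length + 1) * (2 * q - 1) := Nat.le_mul_of_pos_left _ (by omega)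
      rw [min_eq_left this]
    have e : ∀ u, ins k Z u = Z.take (k - 1) ++ (u :: (Z.drop (k - 1)).take (q - k)) ++
        Z.drop (q - 1) := by
      intro u
      have : Z.drop (q - 1) = (Z.drop (k - 1)).drop (q - k) := by
        rw [List.drop_drop]; congr 1; omega
      rw [this]
      simp only [ins, List.append_assoc, List.singleton_append, List.cons_append,
        List.take_append_drop, List.nil_append]
    rw [e y, e v]
    rw [e v] at g2
    have hl : ∀ u, (Z.take (k - 1) ++ (u :: (Z.drop (k - 1)).take (q - k))).length = q := by
      intro u
      simp only [List.length_append, List.length_take, List.length_cons, List.length_drop, hZl]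
      omega
    refine rep_gadget mono hd ?_ ?_ ?_ ?_ ?_ g2
    · rw [List.length_take, hZl]; omega
    · rw [List.length_drop, hZl]; omega
    · rw [hl]; exact hdq
    · rw [hl]; exact hdq
    · rw [List.length_drop, hZl, show 2 * q - 1 - (q - 1) = q by omega]; exact hdq
  | [], _ :: _, _, h, _, _ => by simp at h
  | _ :: _, [], _, h, _, _ => by simp at h

lemma split_list (q d : ℕ) (l : List V) :
    l = l.take q ++ ((l.drop q).take d ++ ((l.drop (q + d)).take q ++ l.drop (q + d + q))) := by
  have e1 : l.drop (q + d + q) = (l.drop (q + d)).drop q := by rw [List.drop_drop]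
  have e2 : l.drop (q + d) = (l.drop q).drop d := by rw [List.drop_drop]
  rw [e1, List.take_append_drop, e2, List.take_append_drop, List.take_append_drop]

lemma gad0_perm {q : ℕ} {l : List V} (h : l.length = q + d + (q + d * (2 * q - 1))) :
    (gad0 k d q l).flatten.Perm l := by
  conv_rhs => rw [split_list q d l]
  simp only [gad0, List.flatten_cons]
  have := gads_perm k (2 * q - 1) ((l.drop q).take d) (l.drop (q + d + q)) (by
    simp only [List.length_drop, List.length_take, h]
    rw [min_eq_left (by omega)]; omega)
  refine (this.append_left _).trans ?_
  rw [List.append_assoc]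
  refine List.Perm.append_left _ ?_
  rw [← List.append_assoc, ← List.append_assoc]
  exact List.perm_append_comm.append_right _

lemma gad1_perm {q : ℕ} {l D : List V} (hD : D.length = d)
    (h : l.length = q + d + (q + d * (2 * q - 1))) :
    (gad1 k d q D l).flatten.Perm (l ++ D) := by
  conv_rhs => rw [split_list q d l]
  simp only [gad1, List.flatten_cons]
  have := gads_perm k (2 * q - 1) D (l.drop (q + d + q)) (by
    simp only [List.length_drop, h, hD]; omega)
  refine (this.append_left _).trans ?_
  simp only [List.append_assoc]
  refine List.Perm.append_left _ (List.Perm.append_left _ (List.Perm.append_left _ ?_))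
  exact List.perm_append_comm

lemma gad0_good {q : ℕ} {l D : List V} (hq : 1 ≤ q) (hD : D.length = d)
    (h : l.length = q + d + (q + d * (2 * q - 1))) (hP : Pabs sh k d q D l) :
    ∀ x ∈ gad0 k d q l, x.length = 2 * q ∧ Good sh k d x := by
  obtain ⟨h1, h2, h3⟩ := hP
  simp only [gad0, List.mem_cons]
  rintro x (rfl | hx)
  · refine ⟨?_, h2⟩
    simp only [List.length_append, List.length_take, List.length_drop, h]; omega
  · refine gads_good hq _ D _ ?_ ?_ h3 x hx
    · simp only [List.length_take, List.length_drop, h, hD]; omega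
    · simp only [List.length_drop, List.length_take, h]
      rw [min_eq_left (by omega)]; omega

lemma gads_length (z : ℕ) : ∀ (ys l : List V), (gads k z ys l).length = ys.length
  | [], _ => rfl
  | y :: ys, l => by simp [gads, gads_length z ys]

lemma gad0_length {q : ℕ} {l : List V} (h : l.length = q + d + (q + d * (2 * q - 1))) :
    (gad0 k d q l).length = d + 1 := by
  simp only [gad0, List.length_cons, gads_length, List.length_take, List.length_drop, h]; omega

lemma gad_repl {q : ℕ} {l D : List V} (mono : ∀ S T, S ⊆ T → sh T → sh S) (hd : 1 ≤ d) (hk : 1 ≤ k)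
    (hq : k ≤ q) (hdq : d ∣ q) (hD : D.length = d)
    (h : l.length = q + d + (q + d * (2 * q - 1))) (hP : Pabs sh k d q D l) :
    List.Forall₂ (Repl sh k d) (gad0 k d q l) (gad1 k d q D l) := by
  obtain ⟨h1, h2, h3⟩ := hP
  have l1 : (l.take q).length = q := by rw [List.length_take, h]; omega
  have l2 : ((l.drop q).take d).length = d := by
    rw [List.length_take, List.length_drop, h]; omega
  have l3 : ((l.drop (q + d)).take q).length = q := by
    rw [List.length_take, List.length_drop, h]; omega
  refine List.Forall₂.cons ?_ (gads_repl mono hd hk hq hdq _ D _ ?_ ?_ h3)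
  · have := rep_gadget (M := []) mono hd (by rw [l1]; omega) (by rw [l3]; omega)
      (by rw [List.append_nil, l1]; exact hdq) (by rw [List.length_append, l1, l2]; exact Dvd.dvd.add hdq dvd_rfl)
      (by rw [l3]; exact hdq) h1
    simpa using this
  · rw [l2, hD]
  · rw [l2, List.length_drop, h]; omega

end PartB2

set_option linter.unusedSectionVars false
set_option linter.unusedVariables false
set_option linter.unusedSimpArgs false

section PartB3
open scoped Classical
variable {V : Type} [Fintype V] [DecidableEq V] {sh : Finset V → Prop} {k d : ℕ}

/-- word with the lists `xs`, each followed by `q` blanks -/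
def bw (q : ℕ) : List (List V) → List (Option V)
  | [] => []
  | x :: xs => x.map some ++ List.replicate q none ++ bw q xs

lemma bw_good (mono : ∀ S T, S ⊆ T → sh T → sh S) (emp : sh ∅) {q : ℕ} (hd : 1 ≤ d) (hdq : d ∣ q)
    (hq : k ≤ q) : ∀ xs : List (List V), (∀ x ∈ xs, d ∣ x.length ∧ Good sh k d x) →
    GoodW sh k d (bw q xs)
  | [], _ => by
    intro i
    refine mono _ _ ?_ emp
    intro v hv
    obtain ⟨p, _, _, h⟩ := mem_cont.1 hv
    simp [bw] at h
  | x :: xs, h => by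
    refine goodW_blank mono hd (by simpa using (h x (by simp)).1) hdq hq
      (goodW_map.2 (h x (by simp)).2) (bw_good mono emp hd hdq hq xs fun y hy => h y (by simp [hy]))

lemma bw_count (q : ℕ) : ∀ xs : List (List V), (bw q xs).count none = q * xs.length
  | [] => by simp [bw]
  | x :: xs => by
    have : (x.map some).count none = 0 := by
      rw [List.count_eq_zero]; simp
    simp only [bw, List.count_append, bw_count q xs, this, List.count_replicate_self,
      List.length_cons]
    ring

lemma bw_fill (q : ℕ) : ∀ (xs : List (List V)) (c : List V), c.length = q * xs.length →
    ∃ cs : List (List V), cs.length = xs.length ∧ (∀ y ∈ cs, y.length = q) ∧ cs.flatten = c ∧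
      fill (bw q xs) c = (List.zipWith (· ++ ·) xs cs).flatten
  | [], c, h => ⟨[], by simp, by simp, by
      have : c = [] := by simpa using h
      simp [this], by simp [bw, fill]⟩
  | x :: xs, c, h => by
    rw [List.length_cons, mul_add] at h
    obtain ⟨cs, h1, h2, h3, h4⟩ := bw_fill q xs (c.drop q) (by rw [List.length_drop]; omega)
    refine ⟨c.take q :: cs, by simp [h1], ?_, ?_, ?_⟩
    · intro y hy
      rw [List.mem_cons] at hy
      rcases hy with rfl | hy
      · rw [List.length_take]; omega
      · exact h2 y hy
    · rw [List.flatten_cons, h3, List.take_append_drop]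
    · rw [bw, List.append_assoc, fill_map, fill_blank _ _ _ (by omega), h4]
      simp

lemma connect {t m q : ℕ} {R : Finset V} (par : Par k d t) (mono : ∀ S T, S ⊆ T → sh T → sh S)
    (emp : sh ∅) (hav : Avail sh k t R m) (hdq : d ∣ q) (hq : k ≤ q) (xs : List (List V))
    (hxs : ∀ x ∈ xs, d ∣ x.length ∧ Good sh k d x) (X : Finset V)
    (hm : q * (xs.length + 1) + X.card ≤ m) :
    ∃ (C0 : List V) (cs : List (List V)), C0.length = q ∧ cs.length = xs.length ∧
      (∀ y ∈ cs, y.length = q) ∧ (C0 ++ cs.flatten).Nodup ∧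
      (∀ v ∈ C0 ++ cs.flatten, v ∈ R ∧ v ∉ X) ∧
      Good sh k d (C0 ++ (List.zipWith (· ++ ·) xs cs).flatten) := by
  have hw := goodW_blank (w₁ := []) mono par.hd (by simp) hdq hq
    (bw_good mono emp par.hd hdq hq [] (by simp)) (bw_good mono emp par.hd hdq hq xs hxs)
  rw [List.nil_append] at hw
  have hcnt : (List.replicate q (none : Option V) ++ bw q xs).count none = q * (xs.length + 1) := by
    rw [List.count_append, bw_count, List.count_replicate_self]; ring
  obtain ⟨c, c1, c2, c3, c4⟩ := fill_exists par mono emp hav (List.replicate q none ++ bw q xs) [] X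
    (by simpa using hw) (by rw [hcnt]; exact hm)
  rw [hcnt] at c2
  rw [List.nil_append, fill_blank _ _ _ (by rw [c2]; exact Nat.le_mul_of_pos_right _ (by omega))] at c4
  obtain ⟨cs, h1, h2, h3, h4⟩ := bw_fill q xs (c.drop q) (by rw [List.length_drop, c2, mul_add]; omega)
  rw [h4] at c4
  have e : c.take q ++ cs.flatten = c := by rw [h3, List.take_append_drop]
  refine ⟨c.take q, cs, ?_, h1, h2, by rw [e]; exact c1, by rw [e]; exact c3, c4⟩
  rw [List.length_take, c2, mul_add]; omega

lemma zip_perm : ∀ xs cs : List (List V), cs.length = xs.length →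
    (List.zipWith (· ++ ·) xs cs).flatten.Perm (xs.flatten ++ cs.flatten)
  | [], [], _ => by simp
  | x :: xs, c :: cs, h => by
    simp only [List.zipWith_cons_cons, List.flatten_cons, List.append_assoc]
    refine List.Perm.append_left _ ?_
    refine ((zip_perm xs cs (by simpa using h)).append_left c).trans ?_
    rw [← List.append_assoc, ← List.append_assoc]
    exact List.perm_append_comm.append_right _
  | [], _ :: _, h => by simp at h
  | _ :: _, [], h => by simp at h

lemma zip_repl : ∀ {xs xs' cs : List (List V)}, cs.length = xs.length → (∀ y ∈ cs, d ∣ y.length) →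
    List.Forall₂ (Repl sh k d) xs xs' →
    List.Forall₂ (Repl sh k d) (List.zipWith (· ++ ·) xs cs) (List.zipWith (· ++ ·) xs' cs)
  | _, _, [], h, _, List.Forall₂.nil => by simp
  | _, _, c :: cs, h, hc, List.Forall₂.cons h1 h2 => by
    simp only [List.zipWith_cons_cons]
    exact List.Forall₂.cons (h1.append (Repl.refl (hc c (by simp))))
      (zip_repl (by simpa using h) (fun y hy => hc y (by simp [hy])) h2)
  | _, _, [], h, _, List.Forall₂.cons _ _ => by simp at h
  | _, _, _ :: _, h, _, List.Forall₂.nil => by simp at h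

lemma forall₂_flatMap {Ω : Type} {R : List V → List V → Prop} {g h : Ω → List (List V)} :
    ∀ fs : List Ω, (∀ f ∈ fs, List.Forall₂ R (g f) (h f)) →
    List.Forall₂ R (fs.flatMap g) (fs.flatMap h)
  | [], _ => by simp
  | f :: fs, H => by
    simp only [List.flatMap_cons]
    exact List.rel_append (H f (by simp)) (forall₂_flatMap fs fun f' hf' => H f' (by simp [hf']))

lemma assign {Ω : Type} (fs : List Ω) (hfs : fs.Nodup) (g0 : Ω → List (List V))
    (g1 : List V → Ω → List (List V)) (A : List V → Ω → Prop)
    (hperm : ∀ D f, A D f → f ∈ fs → (g1 D f).flatten.Perm ((g0 f).flatten ++ D)) :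
    ∀ Ds : List (List V), (∀ D ∈ Ds, Ds.length ≤ (fs.toFinset.filter (A D)).card) →
    ∃ (ys : Ω → List (List V)) (used : Finset Ω), used.card ≤ Ds.length ∧
      (∀ f ∉ used, ys f = g0 f) ∧
      (∀ f ∈ fs, ys f = g0 f ∨ ∃ D ∈ Ds, A D f ∧ ys f = g1 D f) ∧
      (fs.flatMap ys).flatten.Perm ((fs.flatMap g0).flatten ++ Ds.flatten)
  | [], _ => ⟨g0, ∅, by simp, by simp, by simp, by simp⟩
  | D :: Ds, h => by
    obtain ⟨ys, used, u1, u2, u3, u4⟩ := assign fs hfs g0 g1 A hperm Ds (fun D' hD' =>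
      le_trans (by simp) (h D' (by simp [hD'])))
    have hlt : used.card < (fs.toFinset.filter (A D)).card := by
      have := h D (by simp)
      rw [List.length_cons] at this
      omega
    obtain ⟨f, hf, hfu⟩ := exists_mem_notMem_of_card_lt_card hlt
    rw [mem_filter, List.mem_toFinset] at hf
    refine ⟨Function.update ys f (g1 D f), insert f used, ?_, ?_, ?_, ?_⟩
    · exact (card_insert_le _ _).trans (by simpa using u1)
    · intro f' hf'
      rw [mem_insert, not_or] at hf'
      rw [Function.update_of_ne hf'.1]
      exact u2 f' hf'.2
    · intro f' hf'
      by_cases e : f' = f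
      · subst e
        exact Or.inr ⟨D, by simp, hf.2, by simp⟩
      · rw [Function.update_of_ne e]
        rcases u3 f' hf' with h1 | ⟨D', h1, h2, h3⟩
        · exact Or.inl h1
        · exact Or.inr ⟨D', by simp [h1], h2, h3⟩
    · have hp := List.perm_cons_erase hf.1
      have hne : ∀ x ∈ fs.erase f, x ≠ f := fun x hx e => by
        subst e
        exact (hfs.not_mem_erase) hx
      have e1 : (fs.erase f).flatMap (Function.update ys f (g1 D f)) = (fs.erase f).flatMap ys := by
        rw [List.flatMap_def, List.flatMap_def]
        congr 1
        exact List.map_congr_left fun x hx => Function.update_of_ne (hne x hx) _ _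
      have p1 : (fs.flatMap (Function.update ys f (g1 D f))).flatten.Perm
          ((g1 D f).flatten ++ ((fs.erase f).flatMap ys).flatten) := by
        refine ((hp.flatMap_right _).flatten).trans ?_
        rw [List.flatMap_cons, List.flatten_append, Function.update_self, e1]
      have p2 : (fs.flatMap ys).flatten.Perm
          ((g0 f).flatten ++ ((fs.erase f).flatMap ys).flatten) := by
        refine ((hp.flatMap_right _).flatten).trans ?_
        rw [List.flatMap_cons, List.flatten_append, u2 f hfu]
      refine p1.trans (((hperm D f hf.2 hf.1).append_right _).trans ?_)
      rw [List.flatten_cons]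
      have p3 : ((g0 f).flatten ++ D ++ ((fs.erase f).flatMap ys).flatten).Perm
          (D ++ ((g0 f).flatten ++ ((fs.erase f).flatMap ys).flatten)) := by
        rw [← List.append_assoc]
        exact List.perm_append_comm.append_right _
      refine p3.trans (((p2.symm.trans u4).append_left D).trans ?_)
      rw [← List.append_assoc, ← List.append_assoc]
      exact List.perm_append_comm.append_right _

/-- chopping a list into pieces of length `d` -/
lemma chunks : ∀ (s : ℕ) (L : List V), L.length = d * s →
    ∃ Ds : List (List V), Ds.length = s ∧ (∀ D ∈ Ds, D.length = d) ∧ Ds.flatten = L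
  | 0, L, h => ⟨[], by simp, by simp, by
      have : L = [] := by simpa using h
      simp [this]⟩
  | s + 1, L, h => by
    rw [mul_add] at h
    obtain ⟨Ds, h1, h2, h3⟩ := chunks s (L.drop d) (by rw [List.length_drop]; omega)
    refine ⟨L.take d :: Ds, by simp [h1], ?_, by rw [List.flatten_cons, h3, List.take_append_drop]⟩
    intro D hD
    rw [List.mem_cons] at hD
    rcases hD with rfl | hD
    · rw [List.length_take]; omega
    · exact h2 D hD

end PartB3

set_option linter.unusedSectionVars false
set_option linter.unusedVariables false
set_option linter.unusedSimpArgs false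

section PartB4
open scoped Classical

lemma flatMap_flatten_perm {V Ω : Type} {g : Ω → List (List V)} {h : Ω → List V} :
    ∀ fs : List Ω, (∀ f ∈ fs, (g f).flatten.Perm (h f)) →
    (fs.flatMap g).flatten.Perm (fs.flatMap h)
  | [], _ => by simp
  | f :: fs, H => by
    simp only [List.flatMap_cons, List.flatten_append]
    exact (H f (by simp)).append (flatMap_flatten_perm fs fun f' hf' => H f' (by simp [hf']))

lemma flatMap_len {Ω β : Type} {g : Ω → List β} {a : ℕ} :
    ∀ fs : List Ω, (∀ f ∈ fs, (g f).length = a) → (fs.flatMap g).length = fs.length * a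
  | [], _ => by simp
  | f :: fs, H => by
    simp only [List.flatMap_cons, List.length_append, List.length_cons]
    rw [H f (by simp), flatMap_len fs fun f' hf' => H f' (by simp [hf'])]
    ring

lemma flatten_len {β : Type} {a : ℕ} :
    ∀ fs : List (List β), (∀ f ∈ fs, f.length = a) → fs.flatten.length = fs.length * a
  | [], _ => by simp
  | f :: fs, H => by
    simp only [List.flatten_cons, List.length_append, List.length_cons]
    rw [H f (by simp), flatten_len fs fun f' hf' => H f' (by simp [hf'])]
    ring

variable {V : Type} [Fintype V] [DecidableEq V] {sh : Finset V → Prop} {k d : ℕ}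

/-- assembling an absorbing path from disjoint absorbers -/
lemma abs_build {t q m : ℕ} {α : ℝ} (par : Par k d t) (S : Sys sh k t α)
    (hdq : d ∣ q) (hq : k ≤ q) (hm : m = q + d + (q + d * (2 * q - 1)))
    (fs : List (Fin m → V)) (hfs : fs.Pairwise (fun f g => f ∉ confl g))
    (hinj : ∀ f ∈ fs, Function.Injective f)
    (hP : ∀ f ∈ fs, ∃ D : List V, D.length = d ∧ Pabs sh k d q D (List.ofFn f))
    (h : ℕ) (hh : ∀ D : List V, D.length = d →
      h ≤ (fs.toFinset.filter fun f => Pabs sh k d q D (List.ofFn f)).card)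
    (hcard : ((q * (fs.length * (d + 1) + 1) + m * fs.length : ℕ) : ℝ) ≤ t * α * Fintype.card V) :
    ∃ P : List V, P.Nodup ∧ P.length = q * (fs.length * (d + 1) + 1) + m * fs.length ∧
      d ∣ P.length ∧ q ≤ P.length ∧
      Good sh k d P ∧ ∀ L : List V, L.Nodup → (∀ v ∈ L, v ∉ P) → d ∣ L.length → L.length ≤ h →
        ∃ P' : List V, P'.Perm (P ++ L) ∧ P'.take q = P.take q ∧ Repl sh k d P P' := by
  have hd := par.hd
  have ht := par.ht
  have hk1 : 1 ≤ k := by have := par.htk; omega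
  have hfsn : fs.Nodup := by
    refine hfs.imp ?_
    rintro f g hfg rfl
    apply hfg
    have hm0 : 0 < m := by omega
    exact mem_filter.2 ⟨mem_univ _, ⟨0, hm0⟩, ⟨0, hm0⟩, rfl⟩
  set g0 : (Fin m → V) → List (List V) := fun f => gad0 k d q (List.ofFn f) with hg0
  set xs := fs.flatMap g0 with hxs
  have hlen : ∀ f : Fin m → V, (List.ofFn f).length = q + d + (q + d * (2 * q - 1)) := by
    intro f; rw [List.length_ofFn, hm]
  have hxperm : xs.flatten.Perm (fs.flatMap fun f => List.ofFn f) :=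
    flatMap_flatten_perm fs fun f _ => gad0_perm (hlen f)
  have hYn : (fs.flatMap fun f => List.ofFn f).Nodup := by
    rw [List.nodup_flatMap]
    refine ⟨fun f hf => List.nodup_ofFn.2 (hinj f hf), hfs.imp ?_⟩
    intro f g hfg v hv hv'
    rw [List.mem_ofFn] at hv hv'
    obtain ⟨i, hi⟩ := hv
    obtain ⟨j, hj⟩ := hv'
    exact hfg (mem_filter.2 ⟨mem_univ _, i, j, hi.trans hj.symm⟩)
  have hxn : xs.flatten.Nodup := hxperm.nodup_iff.2 hYn
  have hxl : xs.flatten.length = m * fs.length := by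
    rw [hxperm.length_eq, flatMap_len (a := m) fs (fun f _ => List.length_ofFn), mul_comm]
  have hxsl : xs.length = fs.length * (d + 1) :=
    flatMap_len fs fun f _ => gad0_length (hlen f)
  have hxg : ∀ x ∈ xs, d ∣ x.length ∧ Good sh k d x := by
    intro x hx
    obtain ⟨f, hf, hx⟩ := List.mem_flatMap.1 hx
    obtain ⟨D, hD, hPD⟩ := hP f hf
    have := gad0_good (by omega) hD (hlen f) hPD x hx
    exact ⟨by rw [this.1]; exact Dvd.dvd.mul_left hdq 2, this.2⟩
  have hav : Avail sh k t univ (q * (xs.length + 1) + xs.flatten.toFinset.card) := by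
    intro g hg
    have h1 := avail_univ ht S g hg
    have h2 : xs.flatten.toFinset.card = m * fs.length := by
      rw [List.toFinset_card_of_nodup hxn, hxl]
    rw [h2, hxsl]
    exact_mod_cast hcard.trans h1
  obtain ⟨C0, cs, c1, c2, c3, c4, c5, c6⟩ := connect par S.mono S.emp hav hdq hq xs hxg
    xs.flatten.toFinset le_rfl
  have hpP := (zip_perm xs cs c2).append_left C0
  have hPn : (C0 ++ (xs.flatten ++ cs.flatten)).Nodup := by
    have e : (C0 ++ (xs.flatten ++ cs.flatten)).Perm ((C0 ++ cs.flatten) ++ xs.flatten) := by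
      rw [List.append_assoc]
      exact List.perm_append_comm.append_left _
    rw [e.nodup_iff, List.nodup_append]
    refine ⟨c4, hxn, ?_⟩
    rintro a ha b hb rfl
    exact (c5 a ha).2 (by simpa using hb)
  have hcl : cs.flatten.length = cs.length * q := flatten_len cs c3
  have hdc : ∀ y ∈ cs, d ∣ y.length := fun y hy => by rw [c3 y hy]; exact hdq
  have hreplx : List.Forall₂ (Repl sh k d) xs xs :=
    List.forall₂_same.2 fun x hx => Repl.refl (hxg x hx).1
  have hC0 : Repl sh k d C0 C0 := Repl.refl (by rw [c1]; exact hdq)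
  refine ⟨C0 ++ (List.zipWith (· ++ ·) xs cs).flatten, hpP.nodup_iff.2 hPn, ?_, ?_, ?_, c6, ?_⟩
  · rw [hpP.length_eq]
    simp only [List.length_append, c1, hxl, hcl, c2, hxsl]
    ring
  · exact (hC0.append (Repl.flatten (zip_repl c2 hdc hreplx))).1
  · rw [List.length_append, c1]; omega
  · intro L hLn hLd hLdvd hLl
    obtain ⟨s, hs⟩ := hLdvd
    obtain ⟨Ds, d1, d2, d3⟩ := chunks s L hs
    have hsh : s ≤ h := by
      have : 1 * s ≤ d * s := Nat.mul_le_mul_right _ hd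
      omega
    obtain ⟨ys, used, u1, u2, u3, u4⟩ := assign fs hfsn g0
      (fun D f => gad1 k d q D (List.ofFn f))
      (fun D f => D.length = d ∧ Pabs sh k d q D (List.ofFn f))
      (by
        intro D f hD hf
        refine (gad1_perm hD.1 (hlen f)).trans ?_
        exact ((gad0_perm (hlen f)).append_right D).symm) Ds (by
        intro D hD
        rw [d1]
        refine hsh.trans ((hh D (d2 D hD)).trans (card_le_card ?_))
        intro f hf
        simp only [mem_filter, List.mem_toFinset] at hf ⊢
        exact ⟨hf.1, d2 D hD, hf.2⟩)
    have hrepl : List.Forall₂ (Repl sh k d) xs (fs.flatMap ys) := by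
      refine forall₂_flatMap fs fun f hf => ?_
      rcases u3 f hf with e | ⟨D, hD, hA, e⟩
      · rw [e]
        exact List.forall₂_same.2 fun x hx =>
          Repl.refl (hxg x (List.mem_flatMap.2 ⟨f, hf, hx⟩)).1
      · rw [e]
        exact gad_repl S.mono hd hk1 hq hdq hA.1 (hlen f) hA.2
    refine ⟨C0 ++ (List.zipWith (· ++ ·) (fs.flatMap ys) cs).flatten, ?_, ?_,
      hC0.append (Repl.flatten (zip_repl c2 hdc hrepl))⟩
    · have p1 := (zip_perm (fs.flatMap ys) cs (by rw [c2, hrepl.length_eq])).append_left C0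
      refine p1.trans ?_
      rw [d3] at u4
      have p2 : (C0 ++ ((fs.flatMap ys).flatten ++ cs.flatten)).Perm
          (C0 ++ (xs.flatten ++ L ++ cs.flatten)) := (u4.append_right _).append_left _
      refine p2.trans ?_
      have p3 : (C0 ++ (xs.flatten ++ L ++ cs.flatten)).Perm
          (C0 ++ (xs.flatten ++ cs.flatten) ++ L) := by
        simp only [List.append_assoc]
        exact (List.perm_append_comm.append_left _).append_left _
      exact p3.trans (hpP.symm.append_right _)
    · rw [List.take_append_of_le_length (by omega), List.take_append_of_le_length (by omega)]

set_option maxHeartbeats 1600000 in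
lemma abs_main {k d t : ℕ} {α μ : ℝ} (par : Par k d t) (hα : 0 < α) (hμ : 0 < μ) :
    ∃ γ : ℝ, 0 < γ ∧ ∃ n0 : ℕ, ∀ (V : Type) [Fintype V] [DecidableEq V] (sh : Finset V → Prop),
    Sys sh k t α → n0 ≤ Fintype.card V →
    ∃ P : List V, P.Nodup ∧ (P.length : ℝ) ≤ μ * Fintype.card V ∧
      d ∣ P.length ∧ k * d ≤ P.length ∧
      Good sh k d P ∧ ∀ L : List V, L.Nodup → (∀ v ∈ L, v ∉ P) → d ∣ L.length →
        (L.length : ℝ) ≤ γ * Fintype.card V →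
        ∃ P' : List V, P'.Perm (P ++ L) ∧ P'.take (k * d) = P.take (k * d) ∧ Repl sh k d P P' := by
  have hd := par.hd
  have ht := par.ht
  have htk := par.htk
  have hdk : d ≤ k := by
    have := Nat.le_of_dvd (by omega) par.hdt
    omega
  by_cases hα1 : α ≤ 1
  swap
  · refine ⟨1, by norm_num, 1, fun V _ _ sh S hn => ?_⟩
    have := S.alpha_le (by omega) ht (by omega)
    linarith
  obtain ⟨q, hqd⟩ : ∃ q, q = k * d := ⟨_, rfl⟩
  have hq : k ≤ q := by rw [hqd]; exact Nat.le_mul_of_pos_right _ hd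
  have hdq : d ∣ q := by rw [hqd]; exact dvd_mul_left _ _
  obtain ⟨m, hm⟩ : ∃ m, m + 1 = q + d + (q + d * (2 * q - 1)) :=
    ⟨q + d + (q + d * (2 * q - 1)) - 1, by omega⟩
  set c : ℝ := α ^ (m + 1) / 2 with hcdef
  have hc : 0 < c := by positivity
  have hc1 : c ≤ 1 := by
    have : α ^ (m + 1) ≤ 1 := pow_le_one₀ hα.le hα1
    rw [hcdef]; linarith
  set M2 : ℝ := (((m + 1) * (m + 1) : ℕ) : ℝ) with hM2
  have hM2p : 0 < M2 := by rw [hM2]; positivity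
  set W : ℝ := ((q * (d + 1) + (m + 1) : ℕ) : ℝ) with hW
  have hWp : 0 < W := by rw [hW]; positivity
  set ν : ℝ := min μ α with hν
  have hνp : 0 < ν := lt_min hμ hα
  set τ : ℝ := min (c / (2 * M2)) (ν / (2 * W)) with hτ
  have hτp : 0 < τ := by rw [hτ]; positivity
  have hτ1 : τ * M2 ≤ c / 2 := by
    have : τ ≤ c / (2 * M2) := min_le_left _ _
    rw [le_div_iff₀ (by positivity)] at this
    linarith
  have hτ2 : τ * W ≤ ν / 2 := by
    have : τ ≤ ν / (2 * W) := min_le_right _ _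
    rw [le_div_iff₀ (by positivity)] at this
    linarith
  obtain ⟨γ, hγ, n1, hn1⟩ := hits_cor hc hc1 hτp d
  obtain ⟨n2, hn2⟩ := exists_nat_ge (2 * q / ν)
  obtain ⟨n3, hn3⟩ := exists_nat_ge (M2 / c)
  refine ⟨γ, hγ, n1 + n2 + n3 + 1, fun V _ _ sh S hn => ?_⟩
  obtain ⟨n, hnV⟩ : ∃ n, n = Fintype.card V := ⟨_, rfl⟩
  have hnR2 : (n2 : ℝ) ≤ n := by exact_mod_cast (by omega : n2 ≤ n)
  have hnR3 : (n3 : ℝ) ≤ n := by exact_mod_cast (by omega : n3 ≤ n)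
  have hnp : (0 : ℝ) < n := by exact_mod_cast (by omega : 0 < n)
  rw [div_le_iff₀ hνp] at hn2
  rw [div_le_iff₀ hc] at hn3
  have hΩ : (Fintype.card (Fin (m + 1) → V) : ℝ) = (n : ℝ) ^ (m + 1) := by
    rw [Fintype.card_fun, Fintype.card_fin, hnV]; push_cast; rfl
  set A : (Fin d → V) → Finset (Fin (m + 1) → V) := fun D =>
    univ.filter fun f => Function.Injective f ∧ Pabs sh k d q (List.ofFn D) (List.ofFn f) with hA
  have hAc : ∀ D, c * Fintype.card (Fin (m + 1) → V) ≤ ((A D).card : ℝ) := by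
    intro D
    have h1 := many_abs ht hα S hd hdk q (List.ofFn D) List.length_ofFn
    rw [← hm] at h1
    have h2 := h1.count (by positivity)
    have h3 : (univ.filter fun f : Fin (m + 1) → V => Pabs sh k d q (List.ofFn D) (List.ofFn f)) ⊆
        A D ∪ univ.filter fun f : Fin (m + 1) → V => ¬ Function.Injective f := by
      intro f hf
      by_cases hi : Function.Injective f
      · exact mem_union_left _ (mem_filter.2 ⟨mem_univ _, hi, (mem_filter.1 hf).2⟩)
      · exact mem_union_right _ (mem_filter.2 ⟨mem_univ _, hi⟩)
    have h4 := (card_le_card h3).trans (card_union_le _ _)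
    have h5 := h4.trans (Nat.add_le_add_left (card_noninj (V := V) m) _)
    have h6 : ((univ.filter fun f : Fin (m + 1) → V =>
        Pabs sh k d q (List.ofFn D) (List.ofFn f)).card : ℝ) ≤ (A D).card + M2 * (n : ℝ) ^ m := by
      rw [hM2, hnV]
      exact_mod_cast h5
    rw [hΩ]
    rw [← hnV, mul_pow] at h2
    have h7 : M2 * (n : ℝ) ^ m ≤ c * (n : ℝ) ^ (m + 1) := by
      rw [pow_succ]
      have := mul_le_mul_of_nonneg_right (show M2 ≤ c * n by linarith [mul_le_mul_of_nonneg_right hnR3 hc.le])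
        (show (0 : ℝ) ≤ (n : ℝ) ^ m by positivity)
      linarith
    have h8 : α ^ (m + 1) = 2 * c := by rw [hcdef]; ring
    rw [h8] at h2
    linarith
  have hconf : ∀ f : Fin (m + 1) → V, ((confl f).card : ℝ) ≤
      M2 / n * Fintype.card (Fin (m + 1) → V) := by
    intro f
    have h1 : ((confl f).card : ℝ) ≤ M2 * (n : ℝ) ^ m := by
      rw [hM2, hnV]
      exact_mod_cast card_confl f
    rw [hΩ, pow_succ]
    have : M2 / n * ((n : ℝ) ^ m * n) = M2 * (n : ℝ) ^ m := by field_simp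
    rw [this]; exact h1
  obtain ⟨T, hT⟩ : ∃ T, T = ⌊τ * n⌋₊ := ⟨_, rfl⟩
  have hT1 : (T : ℝ) ≤ τ * n := by rw [hT]; exact Nat.floor_le (by positivity)
  have hT2 : τ * n ≤ T + 1 := by rw [hT]; exact (Nat.lt_floor_add_one _).le
  have hTκ : T * (M2 / n) ≤ c / 2 := by
    rw [mul_div_assoc', div_le_iff₀ hnp]
    have := mul_le_mul_of_nonneg_right hT1 hM2p.le
    have := mul_le_mul_of_nonneg_right hτ1 hnp.le
    linarith
  obtain ⟨fs, f1, f2, f3⟩ := hits_sel A confl hc hc1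
    (by
      have : (0 : ℝ) < Fintype.card (Fin (m + 1) → V) := by rw [hΩ]; positivity
      exact_mod_cast this) hAc hconf T hTκ
  have hfsn : fs.Nodup := by
    refine f2.imp ?_
    rintro f g hfg rfl
    exact hfg (mem_filter.2 ⟨mem_univ _, 0, 0, rfl⟩)
  have hhit : ∀ D : Fin d → V, γ * n ≤ (fs.countP (fun f => f ∈ A D) : ℝ) := by
    intro D
    have f3' : (1 / 2 : ℝ) ^ (fs.countP (fun f => f ∈ A D)) ≤
        Fintype.card (Fin d → V) * (1 - c / 4) ^ T := by convert f3 D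
    refine hn1 n (by omega) _ T hT2 (f3'.trans ?_)
    refine mul_le_mul_of_nonneg_right ?_ (pow_nonneg (by linarith) _)
    rw [Fintype.card_fun, Fintype.card_fin, ← hnV]
    push_cast
    exact pow_le_pow_left₀ (by positivity) (by linarith) _
  set fs' := fs.filter fun f => ∃ D, f ∈ A D with hfs'
  have hfl : fs'.length ≤ T := by rw [← f1]; exact List.length_filter_le _ _
  have hsize : ((q * (fs'.length * (d + 1) + 1) + (m + 1) * fs'.length : ℕ) : ℝ) ≤ ν * n := by
    have e : ((q * (fs'.length * (d + 1) + 1) + (m + 1) * fs'.length : ℕ) : ℝ) =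
        fs'.length * W + q := by rw [hW]; push_cast; ring
    rw [e]
    have h1 : (fs'.length : ℝ) ≤ τ * n := le_trans (by exact_mod_cast hfl) hT1
    have h2 := mul_le_mul_of_nonneg_right h1 hWp.le
    have h3 := mul_le_mul_of_nonneg_right hτ2 hnp.le
    have h4 := mul_le_mul_of_nonneg_right hnR2 hνp.le
    linarith
  obtain ⟨P, p1, p2, p3, p4, p5, p6⟩ := abs_build (m := m + 1) par S hdq hq hm fs'
    (f2.filter _)
    (by
      intro f hf
      rw [hfs', List.mem_filter] at hf
      obtain ⟨D, hD⟩ := of_decide_eq_true hf.2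
      exact (mem_filter.1 hD).2.1)
    (by
      intro f hf
      rw [hfs', List.mem_filter] at hf
      obtain ⟨D, hD⟩ := of_decide_eq_true hf.2
      exact ⟨List.ofFn D, List.length_ofFn, (mem_filter.1 hD).2.2⟩)
    ⌊γ * n⌋₊
    (by
      intro D hD
      obtain ⟨Dv, rfl⟩ : ∃ Dv : Fin d → V, List.ofFn Dv = D := by
        subst hD
        exact ⟨fun i => D.get i, List.ofFn_get D⟩
      have h1 := hhit Dv
      have h2 : fs.countP (fun f => f ∈ A Dv) ≤
          (fs'.toFinset.filter fun f => Pabs sh k d q (List.ofFn Dv) (List.ofFn f)).card := by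
        rw [List.countP_eq_length_filter, ← List.toFinset_card_of_nodup (hfsn.filter _)]
        refine card_le_card ?_
        intro f hf
        rw [List.mem_toFinset, List.mem_filter] at hf
        have hfA : f ∈ A Dv := of_decide_eq_true hf.2
        rw [mem_filter, List.mem_toFinset, hfs', List.mem_filter]
        exact ⟨⟨hf.1, decide_eq_true ⟨Dv, hfA⟩⟩, (mem_filter.1 hfA).2.2⟩
      have h3 : (⌊γ * n⌋₊ : ℝ) ≤ γ * n := Nat.floor_le (by positivity)
      have h4 : (⌊γ * n⌋₊ : ℝ) ≤ (fs.countP (fun f => f ∈ A Dv) : ℝ) := h3.trans h1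
      exact le_trans (by exact_mod_cast h4) h2)
    (by
      rw [← hnV]
      refine hsize.trans (mul_le_mul_of_nonneg_right ?_ hnp.le)
      have h1 : (1 : ℝ) ≤ t := by exact_mod_cast (by omega : 1 ≤ t)
      have h2 := mul_le_mul_of_nonneg_right h1 hα.le
      have h3 : ν ≤ α := min_le_right _ _
      linarith)
  refine ⟨P, p1, ?_, p3, by rw [← hqd]; exact p4, p5, ?_⟩
  · rw [p2, ← hnV]
    exact hsize.trans (mul_le_mul_of_nonneg_right (min_le_left _ _) hnp.le)
  · intro L l1 l2 l3 l4
    rw [← hqd]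
    refine p6 L l1 l2 l3 ?_
    rw [← hnV] at l4
    exact Nat.le_floor l4

end PartB4

set_option linter.unusedSectionVars false
set_option linter.unusedVariables false
set_option linter.unusedSimpArgs false

section PartC
open scoped Classical

/-- decoding of a small set from a tuple -/
noncomputable def decS {V : Type} {k : ℕ} (e : Fin k → Option V) : Finset V :=
  univ.biUnion fun i => (e i).toFinset

lemma decS_surj {V : Type} {k : ℕ} (S : Finset V) (hS : S.card < k) :
    ∃ e : Fin k → Option V, decS e = S := by
  refine ⟨fun i => S.toList[(i : ℕ)]?, ?_⟩
  ext v
  simp only [decS, mem_biUnion, mem_univ, true_and, Option.mem_toFinset, Option.mem_def]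
  constructor
  · rintro ⟨i, hi⟩
    exact Finset.mem_toList.1 (List.mem_of_getElem? hi)
  · intro hv
    obtain ⟨i, hi, e⟩ := List.getElem_of_mem (Finset.mem_toList.2 hv)
    rw [Finset.length_toList] at hi
    refine ⟨⟨i, by omega⟩, ?_⟩
    simp only
    rw [List.getElem?_eq_getElem (by rw [Finset.length_toList]; exact hi), e]

set_option maxHeartbeats 1000000 in
/-- a small reservoir in which common extensions remain plentiful -/
lemma reservoir {k t : ℕ} {α ρ : ℝ} (hk : 1 ≤ k) (ht : 2 ≤ t) (hα : 0 < α) (hρ : 0 < ρ) :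
    ∃ γ : ℝ, 0 < γ ∧ ∃ n0 : ℕ, ∀ (V : Type) [Fintype V] [DecidableEq V] (sh : Finset V → Prop),
    Sys sh k t α → n0 ≤ Fintype.card V → ∀ U : Finset V, (U.card : ℝ) ≤ α / 2 * Fintype.card V →
    ∃ R : Finset V, (∀ v ∈ R, v ∉ U) ∧ (R.card : ℝ) ≤ ρ * Fintype.card V ∧
      ∀ m : ℕ, (m : ℝ) ≤ γ * Fintype.card V → Avail sh k t R m := by
  by_cases hα1 : α ≤ 1
  swap
  · refine ⟨1, by norm_num, 1, fun V _ _ sh S hn => ?_⟩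
    have := S.alpha_le (by omega) ht (by omega)
    linarith
  obtain ⟨c, hcd⟩ : ∃ c : ℝ, c = α / 2 := ⟨_, rfl⟩
  have hc : 0 < c := by rw [hcd]; positivity
  have hc1 : c ≤ 1 := by rw [hcd]; linarith
  obtain ⟨τ, hτd⟩ : ∃ τ : ℝ, τ = min (c / 2) ρ := ⟨_, rfl⟩
  have hτ : 0 < τ := by rw [hτd]; positivity
  have hτ1 : τ ≤ c / 2 := by rw [hτd]; exact min_le_left _ _
  have hτ2 : τ ≤ ρ := by rw [hτd]; exact min_le_right _ _
  obtain ⟨γ, hγ, n1, hn1⟩ := hits_cor hc hc1 hτ (k * t)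
  refine ⟨γ, hγ, n1 + 1, fun V _ _ sh S hn U hU => ?_⟩
  obtain ⟨n, hnV⟩ : ∃ n, n = Fintype.card V := ⟨_, rfl⟩
  have hnp : (0 : ℝ) < n := by exact_mod_cast (by omega : 0 < n)
  obtain ⟨A, hA⟩ : ∃ A : (Fin t → Fin k → Option V) → Finset V, A = fun e =>
    if ∀ j, sh (decS (e j)) ∧ (decS (e j)).card < k then
      univ.filter fun v => v ∉ U ∧ ∀ j, sh (insert v (decS (e j)))
    else univ := ⟨_, rfl⟩
  have hAc : ∀ e, c * Fintype.card V ≤ ((A e).card : ℝ) := by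
    intro e
    rw [hA]
    dsimp only
    split_ifs with hg
    · have h1 := avail_univ ht S (fun j => decS (e j)) hg
      have h2 : (univ.filter fun v => ∀ j, sh (insert v (decS (e j)))) ⊆
          (univ.filter fun v => v ∉ U ∧ ∀ j, sh (insert v (decS (e j)))) ∪ U := by
        intro v hv
        by_cases hvU : v ∈ U
        · exact mem_union_right _ hvU
        · exact mem_union_left _ (mem_filter.2 ⟨mem_univ _, hvU, (mem_filter.1 hv).2⟩)
      have h3 := (card_le_card h2).trans (card_union_le _ _)
      have h4 : ((univ.filter fun v => ∀ j, sh (insert v (decS (e j)))).card : ℝ) ≤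
          ((univ.filter fun v => v ∉ U ∧ ∀ j, sh (insert v (decS (e j)))).card : ℝ) + U.card := by
        exact_mod_cast h3
      have h5 : (1 : ℝ) ≤ t := by exact_mod_cast (by omega : 1 ≤ t)
      have h6 : α * Fintype.card V ≤ t * α * Fintype.card V := by
        rw [mul_assoc]
        exact le_mul_of_one_le_left (by positivity) h5
      rw [hcd]
      linarith
    · rw [card_univ]
      exact mul_le_of_le_one_left (by positivity) hc1
  obtain ⟨T, hT⟩ : ∃ T, T = ⌊τ * n⌋₊ := ⟨_, rfl⟩
  have hT1 : (T : ℝ) ≤ τ * n := by rw [hT]; exact Nat.floor_le (by positivity)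
  have hT2 : τ * n ≤ T + 1 := by rw [hT]; exact (Nat.lt_floor_add_one _).le
  obtain ⟨fs, f1, f2, f3⟩ := hits_sel (κ := 1 / n) A (fun v => {v}) hc hc1 (by omega) hAc
    (by
      intro f
      rw [← hnV]
      simp only [card_singleton]
      rw [one_div, inv_mul_cancel₀ hnp.ne']
      simp) T (by
      rw [mul_one_div, div_le_iff₀ hnp]
      have := mul_le_mul_of_nonneg_right hτ1 hnp.le
      linarith)
  have hfsn : fs.Nodup := by
    refine f2.imp ?_
    intro f g hfg e
    exact hfg (by rw [e]; exact mem_singleton_self _)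
  refine ⟨fs.toFinset.filter fun v => v ∉ U, fun v hv => (mem_filter.1 hv).2, ?_, ?_⟩
  · have h1 : (fs.toFinset.filter fun v => v ∉ U).card ≤ T := by
      rw [← f1]
      exact (card_filter_le _ _).trans (List.toFinset_card_le _)
    have h2 : ((fs.toFinset.filter fun v => v ∉ U).card : ℝ) ≤ T := by exact_mod_cast h1
    have h3 := mul_le_mul_of_nonneg_right hτ2 hnp.le
    rw [← hnV]
    linarith
  · intro m hm g hg
    choose e he using fun j => decS_surj (k := k) (g j) (hg j).2
    have f3' : (1 / 2 : ℝ) ^ (fs.countP (fun f => f ∈ A e)) ≤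
        Fintype.card (Fin t → Fin k → Option V) * (1 - c / 4) ^ T := by convert f3 e
    have h1 := hn1 n (by omega) _ T hT2 (f3'.trans (by
      refine mul_le_mul_of_nonneg_right (le_of_eq ?_) (pow_nonneg (by linarith) _)
      rw [Fintype.card_fun, Fintype.card_fun, Fintype.card_fin, Fintype.card_fin,
        Fintype.card_option, ← hnV, pow_mul]
      push_cast
      rfl))
    have h2 : m ≤ fs.countP (fun f => f ∈ A e) := by
      rw [← hnV] at hm
      exact_mod_cast hm.trans h1
    refine h2.trans ?_
    rw [List.countP_eq_length_filter, ← List.toFinset_card_of_nodup (hfsn.filter _)]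
    refine card_le_card ?_
    intro v hv
    rw [List.mem_toFinset, List.mem_filter] at hv
    have hvA : v ∈ A e := of_decide_eq_true hv.2
    rw [hA] at hvA
    dsimp only at hvA
    rw [if_pos (fun j => by rw [he j]; exact hg j)] at hvA
    have := (mem_filter.1 hvA).2
    rw [mem_filter, mem_filter, List.mem_toFinset]
    refine ⟨⟨hv.1, this.1⟩, fun j => ?_⟩
    rw [← he j]
    exact this.2 j

end PartC

set_option linter.unusedSectionVars false
set_option linter.unusedVariables false
set_option linter.unusedSimpArgs false

section PartE
open scoped Classical

set_option maxHeartbeats 1000000 in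
lemma ham_sys {K d t : ℕ} {α : ℝ} (par : Par (K + 1) d t) (hα : 0 < α) :
    ∃ n0 : ℕ, ∀ (V : Type) [Fintype V] [DecidableEq V] (sh : Finset V → Prop),
    Sys sh (K + 1) t α → n0 ≤ Fintype.card V → d ∣ Fintype.card V →
    ∃ vs : List V, vs.Nodup ∧ (∀ v, v ∈ vs) ∧ (K + 1) * d ≤ vs.length ∧
      Good sh (K + 1) d (vs ++ vs.take ((K + 1) * d)) := by
  have hd := par.hd
  have ht := par.ht
  have htk := par.htk
  obtain ⟨q, hqd⟩ : ∃ q, q = (K + 1) * d := ⟨_, rfl⟩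
  have hq : K + 1 ≤ q := by rw [hqd]; exact Nat.le_mul_of_pos_right _ hd
  have hdq : d ∣ q := by rw [hqd]; exact dvd_mul_left _ _
  obtain ⟨γ, hγ, na, habs⟩ := abs_main (μ := α / 4) par hα (by positivity)
  obtain ⟨ρ, hρd⟩ : ∃ ρ : ℝ, ρ = min (α / 4) (γ / 2) := ⟨_, rfl⟩
  have hρ : 0 < ρ := by rw [hρd]; positivity
  have hρ1 : ρ ≤ α / 4 := by rw [hρd]; exact min_le_left _ _
  have hρ2 : ρ ≤ γ / 2 := by rw [hρd]; exact min_le_right _ _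
  obtain ⟨γ2, hγ2, nr, hres⟩ := reservoir (k := K + 1) (t := t) (by omega) ht hα hρ
  obtain ⟨b0, hb0⟩ := exists_nat_ge (2 * q / γ2)
  obtain ⟨b, hbd⟩ : ∃ b, b = b0 + 1 := ⟨_, rfl⟩
  obtain ⟨nt, htile⟩ := tiles_avoid (ε := γ / 2) par hα (by positivity) b (by omega)
  obtain ⟨n3, hn3⟩ := exists_nat_ge (6 * q / γ2)
  rw [div_le_iff₀ hγ2] at hb0 hn3
  refine ⟨na + nr + nt + n3 + 1, fun V _ _ sh S hn hdn => ?_⟩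
  obtain ⟨n, hnV⟩ : ∃ n, n = Fintype.card V := ⟨_, rfl⟩
  have hnp : (0 : ℝ) < n := by exact_mod_cast (by omega : 0 < n)
  have hn3' : (n3 : ℝ) ≤ n := by exact_mod_cast (by omega : n3 ≤ n)
  obtain ⟨P, p1, p2, p3, p4, p5, p6⟩ := habs V sh S (by omega)
  have hPc : P.toFinset.card = P.length := List.toFinset_card_of_nodup p1
  rw [← hqd] at p4 p6
  obtain ⟨R, r1, r2, r3⟩ := hres V sh S (by omega) P.toFinset (by
    rw [hPc]
    refine p2.trans (mul_le_mul_of_nonneg_right (by linarith) (by positivity)))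
  have hUc : (P.toFinset ∪ R).card ≤ P.length + R.card := by
    rw [← hPc]; exact card_union_le _ _
  have hUcR : ((P.toFinset ∪ R).card : ℝ) ≤ P.length + R.card := by exact_mod_cast hUc
  have hρn := mul_le_mul_of_nonneg_right hρ1 hnp.le
  have hρn2 := mul_le_mul_of_nonneg_right hρ2 hnp.le
  rw [← hnV] at p2 r2
  obtain ⟨ls, l1, l2, l3, l4⟩ := htile V sh S (by omega) (P.toFinset ∪ R) (by
    rw [← hnV]
    linarith)
  rw [← hnV] at l4
  -- number of tiles
  have hll : ls.flatten.length = ls.length * (K * t * b) := flatten_len ls fun l hl => (l1 l hl).1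
  have hln : ls.flatten.length ≤ n := by
    rw [← List.toFinset_card_of_nodup l2, hnV]; exact card_le_univ _
  have hlb : ls.length * b ≤ n := by
    refine le_trans (Nat.mul_le_mul_left _ ?_) (hll ▸ hln)
    have : 1 ≤ K * t := Nat.mul_pos (by omega) (by omega)
    calc b = 1 * b := (one_mul _).symm
      _ ≤ K * t * b := Nat.mul_le_mul_right _ this
  have hlbR : (ls.length : ℝ) * b ≤ n := by exact_mod_cast hlb
  have hbR : (b : ℝ) = b0 + 1 := by rw [hbd]; push_cast; rfl
  have hcount : ((q * ((P :: (ls ++ [P.take q])).length + 1) : ℕ) : ℝ) ≤ γ2 * Fintype.card V := by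
    rw [← hnV]
    simp only [List.length_cons, List.length_append, List.length_nil]
    push_cast
    have h1 : (2 * q : ℝ) ≤ b * γ2 := by rw [hbR]; linarith
    have h2 : (ls.length : ℝ) * (2 * q) ≤ ls.length * (b * γ2) :=
      mul_le_mul_of_nonneg_left h1 (by positivity)
    have h3 := mul_le_mul_of_nonneg_right hlbR hγ2.le
    have h4 := mul_le_mul_of_nonneg_right hn3' hγ2.le
    linarith
  have hav := r3 _ hcount
  have hPt : (P.take q).length = q := by rw [List.length_take]; omega
  have hxg : ∀ x ∈ P :: (ls ++ [P.take q]), d ∣ x.length ∧ Good sh (K + 1) d x := by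
    intro x hx
    simp only [List.mem_cons, List.mem_append, List.mem_singleton, List.not_mem_nil, or_false] at hx
    rcases hx with rfl | hx | rfl
    · exact ⟨p3, p5⟩
    · obtain ⟨e1, e2⟩ := l1 x hx
      refine ⟨?_, e2⟩
      rw [e1, mul_assoc]
      exact Dvd.dvd.mul_left (Dvd.dvd.mul_right par.hdt _) _
    · refine ⟨by rw [hPt]; exact hdq, good_front S.mono (Y := P.drop q) ?_⟩
      rw [List.take_append_drop]; exact p5
  obtain ⟨C0, cs, c1, c2, c3, c4, c5, c6⟩ := connect par S.mono S.emp hav hdq hq _ hxg ∅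
    (by simp)
  obtain ⟨c, cs2, rfl⟩ : ∃ c cs2, cs = c :: cs2 := by
    cases cs with
    | nil => simp at c2
    | cons c cs2 => exact ⟨c, cs2, rfl⟩
  obtain ⟨cs3, cl, rfl⟩ : ∃ cs3 cl, cs2 = cs3 ++ [cl] := by
    rcases List.eq_nil_or_concat cs2 with rfl | ⟨cs3, cl, h⟩
    · simp at c2
    · exact ⟨cs3, cl, by simpa using h⟩
  have hcs3 : cs3.length = ls.length := by
    simp only [List.length_cons, List.length_append, List.length_nil] at c2; omega
  obtain ⟨Z, hZ⟩ : ∃ Z, Z = (List.zipWith (· ++ ·) ls cs3).flatten := ⟨_, rfl⟩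
  have hZp : Z.Perm (ls.flatten ++ cs3.flatten) := by rw [hZ]; exact zip_perm ls cs3 hcs3
  have hcl : c.length = q := c3 c (by simp)
  have hG : Good sh (K + 1) d (P ++ (c ++ Z ++ P.take q)) := by
    rw [List.zipWith_cons_cons, List.zipWith_append hcs3.symm] at c6
    have h1 := good_suffix S.mono (by rw [c1]; exact hdq) c6
    refine good_front S.mono (Y := cl) ?_
    rw [hZ]
    simpa [List.append_assoc] using h1
  have hQp : (P ++ (c ++ Z)).Perm ((P ++ ls.flatten) ++ (c ++ cs3.flatten)) := by
    rw [List.append_assoc]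
    refine List.Perm.append_left _ ?_
    refine (hZp.append_left c).trans ?_
    rw [← List.append_assoc, ← List.append_assoc]
    exact List.perm_append_comm.append_right _
  have hQn : (P ++ (c ++ Z)).Nodup := by
    rw [hQp.nodup_iff, List.nodup_append, List.nodup_append]
    refine ⟨⟨p1, l2, ?_⟩, ?_, ?_⟩
    · rintro a ha _ hb rfl
      exact l3 a hb (mem_union_left _ (by simpa using ha))
    · refine c4.sublist ?_
      refine List.Sublist.trans ?_ (List.sublist_append_right _ _)
      simp [List.flatten_append]
    · rintro a ha _ hb rfl
      have hR : a ∈ R := (c5 a (by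
        simp only [List.mem_append, List.flatten_cons, List.flatten_append] at hb ⊢
        tauto)).1
      rcases List.mem_append.1 ha with h | h
      · exact r1 a hR (by simpa using h)
      · exact l3 a h (mem_union_right _ hR)
  obtain ⟨L, hL⟩ : ∃ L, L = ((univ : Finset V) \ (P ++ (c ++ Z)).toFinset).toList := ⟨_, rfl⟩
  have hLm : ∀ v, v ∈ L ↔ v ∉ P ++ (c ++ Z) := by
    intro v; rw [hL, Finset.mem_toList, mem_sdiff, List.mem_toFinset]; simp only [mem_univ, true_and]
  have hLn : L.Nodup := by rw [hL]; exact Finset.nodup_toList _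
  have hLl : L.length + (P ++ (c ++ Z)).length = n := by
    rw [hL, Finset.length_toList, ← List.toFinset_card_of_nodup hQn,
      Finset.card_sdiff_add_card_eq_card (subset_univ _), card_univ, hnV]
  have hQl : (P ++ (c ++ Z)).length = P.length + ls.flatten.length + (q + cs3.flatten.length) := by
    rw [hQp.length_eq]; simp only [List.length_append, hcl]
  have hdQ : d ∣ (P ++ (c ++ Z)).length := by
    rw [hQl]
    have e1 : d ∣ ls.flatten.length := by
      rw [hll]
      exact Dvd.dvd.mul_left (by rw [mul_assoc]; exact Dvd.dvd.mul_left (Dvd.dvd.mul_right par.hdt _) _) _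
    have e2 : d ∣ cs3.flatten.length := by
      rw [flatten_len cs3 (a := q) fun y hy => c3 y (by simp [hy])]
      exact Dvd.dvd.mul_left hdq _
    exact (p3.add e1).add (hdq.add e2)
  have hdL : d ∣ L.length := by
    rw [← hnV, ← hLl] at hdn
    exact (Nat.dvd_add_left hdQ).1 hdn
  obtain ⟨P', q1, q2, q3⟩ := p6 L hLn (fun v hv => by
      have := (hLm v).1 hv
      simp only [List.mem_append] at this
      tauto) hdL (by
      rw [← hnV]
      have h1 : (L.length : ℝ) + (P.length + ls.flatten.length) ≤ n := by
        exact_mod_cast (by omega : L.length + (P.length + ls.flatten.length) ≤ n)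
      linarith)
  have hvp : (P' ++ (c ++ Z)).Perm ((P ++ (c ++ Z)) ++ L) := by
    refine (q1.append_right _).trans ?_
    simp only [List.append_assoc]
    refine List.Perm.append_left _ ?_
    have : (L ++ (c ++ Z)).Perm ((c ++ Z) ++ L) := List.perm_append_comm
    simpa [List.append_assoc] using this
  have hP'l : q ≤ P'.length := by rw [q1.length_eq, List.length_append]; omega
  refine ⟨P' ++ (c ++ Z), ?_, ?_, ?_, ?_⟩
  · rw [hvp.nodup_iff, List.nodup_append]
    refine ⟨hQn, hLn, ?_⟩
    rintro a ha _ hb rfl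
    exact (hLm a).1 hb ha
  · intro v
    rw [hvp.mem_iff, List.mem_append, hLm]
    exact em _
  · rw [← hqd, List.length_append]; omega
  · rw [← hqd, List.take_append_of_le_length hP'l, q2]
    have := q3.2 [] (c ++ Z ++ P.take q) (by simp) (by simpa using hG)
    simpa [List.append_assoc] using this

end PartE

section PartF

lemma sys_of_posCodeg {V : Type} [Fintype V] [DecidableEq V] {E : Finset (Finset V)} {k t : ℕ}
    {α : ℝ} (hE : ∀ e ∈ E, e.card = k) (hV : 0 < Fintype.card V)
    (hdeg : (1 - 1 / (t : ℝ)) * Fintype.card V + α * Fintype.card V ≤ (posCodeg k E : ℝ))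
    (hiso : ∀ v : V, 1 ≤ degH E {v}) : Sys (fun S => ∃ e ∈ E, S ⊆ e) k t α := by
  have hs : ∀ v : V, ∃ e ∈ E, {v} ⊆ e := by
    intro v
    obtain ⟨e, he⟩ := card_pos.1 (hiso v)
    exact ⟨e, (mem_filter.1 he).1, (mem_filter.1 he).2⟩
  refine ⟨?_, ?_, hs, ?_⟩
  · rintro S T hST ⟨e, he, h⟩
    exact ⟨e, he, hST.trans h⟩
  · obtain ⟨v⟩ := Fintype.card_pos_iff.1 hV
    obtain ⟨e, he, _⟩ := hs v
    exact ⟨e, he, empty_subset _⟩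
  · rintro S ⟨e, he, hSe⟩ hSk
    obtain ⟨S', h1, h2, h3⟩ := Finset.exists_subsuperset_card_eq (n := k - 1) hSe (by omega)
      (by rw [hE e he]; omega)
    have h4 : 1 ≤ degH E S' := card_pos.2 ⟨e, mem_filter.2 ⟨he, h2⟩⟩
    have h5 : posCodeg k E ≤ degH E S' := Nat.sInf_le ⟨S', h3, h4, rfl⟩
    have h6 : degH E S' ≤ (univ.filter fun v => ∃ e ∈ E, insert v S ⊆ e).card := by
      unfold degH
      refine le_trans (card_le_card ?_) (card_image_le (f := fun v => insert v S'))
      intro e' he'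
      obtain ⟨m1, m2⟩ := mem_filter.1 he'
      obtain ⟨v, hv, rfl⟩ := Finset.exists_eq_insert_iff.2
        ⟨m2, by rw [h3, hE e' m1]; omega⟩
      exact mem_image.2 ⟨v, mem_filter.2 ⟨mem_univ _, _, m1, insert_subset_insert _ h1⟩, rfl⟩
    have h7 : (posCodeg k E : ℝ) ≤ ((univ.filter fun v => ∃ e ∈ E, insert v S ⊆ e).card : ℝ) := by
      exact_mod_cast h5.trans h6
    rw [add_mul]
    refine le_trans (hdeg.trans h7) (le_of_eq ?_)
    congr

lemma cycle_of_good {V : Type} [Fintype V] [DecidableEq V] {E : Finset (Finset V)} {k ℓ : ℕ}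
    (hE : ∀ e ∈ E, e.card = k) (hd : 1 ≤ k - ℓ) (vs : List V) (hvn : vs.Nodup)
    (hl : k * (k - ℓ) ≤ vs.length)
    (hg : Good (fun S => ∃ e ∈ E, S ⊆ e) k (k - ℓ) (vs ++ vs.take (k * (k - ℓ)))) :
    cycleEdges k ℓ vs ⊆ E := by
  intro W hW
  unfold cycleEdges at hW
  obtain ⟨i, hi, rfl⟩ := mem_image.1 hW
  rw [Finset.mem_range] at hi
  generalize hdd : k - ℓ = d at *
  have hkl : k ≤ k * d := Nat.le_mul_of_pos_right _ hd
  have hid : (i + 1) * d ≤ vs.length :=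
    (Nat.mul_le_mul_right _ hi).trans (Nat.div_mul_le_self _ _)
  have hid' : i * d + d ≤ vs.length := by rw [add_mul, one_mul] at hid; exact hid
  have hw : ((vs ++ vs).drop (i * d)).take k = (vs.rotate (i * d)).take k := by
    rw [List.rotate_eq_drop_append_take (by omega), List.drop_append_of_le_length (by omega)]
    rw [List.take_append, List.take_append, List.take_take, List.length_drop]
    congr 2
    omega
  have hwn : (((vs ++ vs).drop (i * d)).take k).Nodup := by
    rw [hw]
    exact (List.nodup_rotate.2 hvn).sublist (List.take_sublist _ _)
  have hwl : (((vs ++ vs).drop (i * d)).take k).length = k := by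
    rw [List.length_take, List.length_drop, List.length_append]; omega
  have hc : (((vs ++ vs).drop (i * d)).take k).toFinset.card = k := by
    rw [List.toFinset_card_of_nodup hwn, hwl]
  obtain ⟨e, he, hse⟩ := hg i
  have hsub : (((vs ++ vs).drop (i * d)).take k).toFinset ⊆ e := by
    intro v hv
    rw [List.mem_toFinset] at hv
    obtain ⟨j, hj, e1⟩ := List.getElem_of_mem hv
    have e2 := List.getElem?_eq_some_iff.2 ⟨hj, e1⟩
    rw [hwl] at hj
    rw [List.getElem?_take_of_lt hj, List.getElem?_drop] at e2
    refine hse (mem_cont.2 ⟨i * d + j, by omega, by omega, ?_⟩)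
    rcases Nat.lt_or_ge (i * d + j) vs.length with h | h
    · rw [List.getElem?_append_left h] at e2 ⊢
      exact e2
    · rw [List.getElem?_append_right h] at e2 ⊢
      rw [List.getElem?_take_of_lt (by omega)]
      exact e2
  rw [Finset.eq_of_subset_of_card_le hsub (by rw [hc, hE e he])]
  exact he

end PartF

/-- Theorem 1.1: positive codegree
`δ⁺(H) ≥ (1 - 1/(⌊k/(k-ℓ)⌋(k-ℓ)))n + αn` plus no isolated vertices forces a Hamilton
`ℓ`-cycle. -/
theorem statement0 (k ℓ : ℕ) (hk : 3 ≤ k) (hℓ1 : 1 ≤ ℓ) (hℓ2 : ℓ ≤ k - 1)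
    (α : ℝ) (hα : 0 < α) :
    ∃ n₀ : ℕ, ∀ n : ℕ, n₀ ≤ n → (k - ℓ) ∣ n →
      ∀ E : Finset (Finset (Fin n)),
        (∀ e ∈ E, e.card = k) →
        (1 - 1 / ((k / (k - ℓ) * (k - ℓ) : ℕ) : ℝ)) * n + α * n ≤ (posCodeg k E : ℝ) →
        (∀ v : Fin n, 1 ≤ degH E {v}) →
        HasHamiltonLCycle k ℓ E := by
  obtain ⟨K, rfl⟩ : ∃ K, k = K + 1 := ⟨k - 1, by omega⟩
  have hd : 1 ≤ K + 1 - ℓ := by omega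
  have par : Par (K + 1) (K + 1 - ℓ) ((K + 1) / (K + 1 - ℓ) * (K + 1 - ℓ)) := by
    generalize hdd : K + 1 - ℓ = d at *
    have h1 := Nat.div_add_mod (K + 1) d
    have h2 := Nat.mod_lt (K + 1) hd
    have h3 : d * ((K + 1) / d) = (K + 1) / d * d := mul_comm _ _
    have h4 : 1 ≤ (K + 1) / d := Nat.div_pos (by omega) hd
    have h5 : 1 * d ≤ (K + 1) / d * d := Nat.mul_le_mul_right _ h4
    refine ⟨hd, dvd_mul_left _ _, ?_, by omega, by omega⟩
    rcases Nat.lt_or_ge 1 d with h | h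
    · omega
    · have : d = 1 := by omega
      subst this
      simp
      omega
  obtain ⟨n0, hn0⟩ := ham_sys par hα
  refine ⟨n0 + 1, fun n hn hdn E hE hdeg hiso => ?_⟩
  have S := sys_of_posCodeg (V := Fin n) (k := K + 1) (α := α)
    (t := (K + 1) / (K + 1 - ℓ) * (K + 1 - ℓ)) hE (by rw [Fintype.card_fin]; omega)
    (by rw [Fintype.card_fin]; exact hdeg) hiso
  obtain ⟨vs, v1, v2, v3, v4⟩ := hn0 (Fin n) _ S (by rw [Fintype.card_fin]; omega)
    (by rw [Fintype.card_fin]; exact hdn)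
  have hu : vs.toFinset = univ := by
    ext v; simp [v2 v]
  have hl : vs.length = n := by
    rw [← List.toFinset_card_of_nodup v1, hu, card_univ, Fintype.card_fin]
  refine ⟨vs, v1, hu, le_trans (Nat.le_mul_of_pos_right _ hd) v3, by rw [hl]; exact hdn, ?_⟩
  refine cycle_of_good hE hd vs v1 v3 ?_
  convert v4
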